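/- The pair (8; 0.673) is admissible: for every ε > 0 there exists M such that for every integer m ≥ M and every integer a with gcd(a,m) = 1, the class a modulo m is represented by a product of at most 8 primes, each at most m^{0.673+ε}. -/

import Mathlib

namespace S17
open Finset

/-- The divisor function. -/
noncomputable def tau (n : ℕ) : ℝ := (n.divisors.card : ℝ)

lemma tau_nonneg (n : ℕ) : 0 ≤ tau n := Nat.cast_nonneg _

lemma one_le_tau {n : ℕ} (hn : n ≠ 0) : 1 ≤ tau n := by
  unfold tau
  exact_mod_cast Finset.card_pos.mpr ⟨1, by simp [hn]⟩

lemma divisor_bound (ε : ℝ) (hε : 0 < ε) :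
    ∃ C : ℝ, 1 ≤ C ∧ ∀ n : ℕ, n ≠ 0 → tau n ≤ C * (n : ℝ) ^ ε := by
  set C1 : ℝ := max 1 (1 / (ε * Real.log 2)) with hC1
  have hl2 : 0 < Real.log 2 := Real.log_pos (by norm_num)
  have h1 : 1 ≤ C1 := le_max_left _ _
  have hkey : ∀ a : ℕ, ((a : ℝ) + 1) ≤ C1 * (2 : ℝ) ^ (a * ε) := by
    intro a
    have e1 : (2 : ℝ) ^ (a * ε) = Real.exp (Real.log 2 * (a * ε)) := by
      rw [Real.rpow_def_of_pos (by norm_num)]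
    have e2 := Real.add_one_le_exp (Real.log 2 * (a * ε))
    rw [← e1] at e2
    have h2 : 1 / (ε * Real.log 2) ≤ C1 := le_max_right _ _
    have h3 : 1 ≤ C1 * (ε * Real.log 2) := by
      rw [div_le_iff₀ (by positivity)] at h2; exact h2
    have : (a : ℝ) * 1 ≤ a * (C1 * (ε * Real.log 2)) :=
      mul_le_mul_of_nonneg_left h3 (Nat.cast_nonneg _)
    nlinarith
  set P0 : ℕ := ⌈(2 : ℝ) ^ (1 / ε)⌉₊ with hP0
  refine ⟨C1 ^ P0, one_le_pow₀ h1, fun n hn => ?_⟩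
  have hb : ∀ p ∈ n.primeFactors, ((n.factorization p : ℝ) + 1) ≤
      (if p < P0 then C1 else 1) * ((p : ℝ) ^ (n.factorization p)) ^ ε := by
    intro p hp
    have hpp := Nat.prime_of_mem_primeFactors hp
    have hp2 : (2 : ℝ) ≤ p := by exact_mod_cast hpp.two_le
    set a := n.factorization p
    have e : ((p : ℝ) ^ a) ^ ε = (p : ℝ) ^ (a * ε) := by
      rw [← Real.rpow_natCast, ← Real.rpow_mul (by positivity)]
    rw [e]
    split_ifs with h
    · refine (hkey a).trans ?_
      gcongr
    · push Not at h
      have h2 : (2 : ℝ) ^ (1 / ε) ≤ p := (Nat.le_ceil _).trans (by exact_mod_cast h)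
      have h3 : (2 : ℝ) ≤ (p : ℝ) ^ ε := by
        have := Real.rpow_le_rpow (by positivity) h2 hε.le
        rwa [← Real.rpow_mul (by norm_num), one_div, inv_mul_cancel₀ hε.ne', Real.rpow_one] at this
      have h4 : (p : ℝ) ^ (a * ε) = ((p : ℝ) ^ ε) ^ a := by
        rw [mul_comm, Real.rpow_mul (by positivity), Real.rpow_natCast]
      rw [h4, one_mul]
      have h5 : (2 : ℝ) ^ a ≤ ((p : ℝ) ^ ε) ^ a := by gcongr
      have h6 : (a : ℝ) + 1 ≤ 2 ^ a := by exact_mod_cast Nat.lt_two_pow_self (n := a)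
      linarith
  have h0 : tau n = ∏ p ∈ n.primeFactors, ((n.factorization p : ℝ) + 1) := by
    unfold tau; rw [Nat.card_divisors hn]; push_cast; rfl
  have hn' : (n : ℝ) ^ ε = ∏ p ∈ n.primeFactors, ((p : ℝ) ^ (n.factorization p)) ^ ε := by
    conv_lhs => rw [← Nat.prod_factorization_pow_eq_self hn]
    rw [Finsupp.prod, Nat.support_factorization]
    push_cast
    rw [← Real.finsetProd_rpow]
    intros; positivity
  rw [h0, hn']
  refine (Finset.prod_le_prod (fun _ _ => by positivity) hb).trans ?_
  rw [Finset.prod_mul_distrib]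
  gcongr
  rw [← Finset.prod_filter, Finset.prod_const]
  apply pow_le_pow_right₀ h1
  refine (Finset.card_le_card (t := Finset.range P0) ?_).trans (by simp)
  intro p hp
  simp at hp ⊢
  exact hp.2

end S17

namespace S17
open Finset

lemma abel_bound (g : ℕ → ℂ) (B : ℝ) (a b : ℕ) (ha : 1 ≤ a) (hab : a ≤ b)
    (hB : ∀ x : ℕ, ‖∑ n ∈ Ioc 0 x, g n‖ ≤ B) :
    ‖∑ n ∈ Ioc a b, g n / n‖ ≤ 2 * B / a := by
  set D : ℕ → ℂ := fun x => ∑ n ∈ Ioc a x, g n with hD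
  have hDB : ∀ x, a ≤ x → ‖D x‖ ≤ 2 * B := by
    intro x hx
    have : D x = ∑ n ∈ Ioc 0 x, g n - ∑ n ∈ Ioc 0 a, g n := by
      rw [eq_sub_iff_add_eq', hD]
      exact Finset.sum_Ioc_consecutive g (Nat.zero_le a) hx
    rw [this]
    refine (norm_sub_le _ _).trans ?_
    linarith [hB x, hB a]
  have ha' : (0 : ℝ) < a := by exact_mod_cast ha
  have key : ∀ b, a ≤ b → ‖∑ n ∈ Ioc a b, g n / n - D b / b‖ ≤ 2 * B * (1 / a - 1 / b) := by
    intro b hb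
    induction b, hb using Nat.le_induction with
    | base => simp [hD]
    | succ b hb ih =>
      have hb' : (0 : ℝ) < b := by exact_mod_cast (lt_of_lt_of_le ha hb)
      have hbc : (b : ℂ) ≠ 0 := by exact_mod_cast hb'.ne'
      have hbc1 : ((b : ℂ) + 1) ≠ 0 := by exact_mod_cast (Nat.succ_ne_zero b)
      have e1 : ∑ n ∈ Ioc a (b + 1), g n / n = ∑ n ∈ Ioc a b, g n / n + g (b + 1) / ((b + 1 : ℕ) : ℂ) :=
        Finset.sum_Ioc_succ_top hb _
      have e2 : D (b + 1) = D b + g (b + 1) := Finset.sum_Ioc_succ_top hb _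
      have e3 : ∑ n ∈ Ioc a (b + 1), g n / n - D (b + 1) / ((b + 1 : ℕ) : ℂ) =
          (∑ n ∈ Ioc a b, g n / n - D b / b) + D b * ((1 / (b : ℝ) - 1 / ((b : ℝ) + 1) : ℝ) : ℂ) := by
        rw [e1, e2]; push_cast; field_simp; ring
      have hnn : 0 ≤ 1 / (b : ℝ) - 1 / ((b : ℝ) + 1) := by
        rw [sub_nonneg]; apply one_div_le_one_div_of_le hb'; linarith
      rw [e3]
      refine (norm_add_le _ _).trans ?_
      rw [norm_mul, Complex.norm_real, Real.norm_of_nonneg hnn]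
      have := mul_le_mul_of_nonneg_right (hDB b hb) hnn
      push_cast
      nlinarith
  have hb' : (0 : ℝ) < b := by exact_mod_cast (lt_of_lt_of_le ha hab)
  have h1 := key b hab
  have h2 : ‖D b / b‖ ≤ 2 * B * (1 / b) := by
    rw [norm_div, Complex.norm_natCast, div_eq_mul_one_div]
    exact mul_le_mul_of_nonneg_right (hDB b hab) (by positivity)
  calc ‖∑ n ∈ Ioc a b, g n / n‖ = ‖(∑ n ∈ Ioc a b, g n / n - D b / b) + D b / b‖ := by ring_nf
    _ ≤ _ := norm_add_le _ _
    _ ≤ 2 * B * (1 / a - 1 / b) + 2 * B * (1 / b) := add_le_add h1 h2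
    _ = 2 * B / a := by ring

variable {m : ℕ} [NeZero m]

/-- Twisted Gauss sum. -/
noncomputable def Gs (χ : DirichletCharacter ℂ m) (h : ZMod m) : ℂ :=
  ∑ n : ZMod m, χ n * ZMod.stdAddChar (n * h)

lemma Gs_unit (χ : DirichletCharacter ℂ m) (h : ZMod m) (u : (ZMod m)ˣ) :
    ‖Gs χ (h * u)‖ = ‖Gs χ h‖ := by
  have : Gs χ h = χ u * Gs χ (h * u) := by
    unfold Gs
    rw [← Equiv.sum_comp (Units.mulLeft u), Finset.mul_sum]
    refine Finset.sum_congr rfl fun n _ => ?_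
    simp only [Units.mulLeft_apply, map_mul]
    rw [show (u : ZMod m) * n * h = n * (h * u) by ring]; ring
  rw [this, norm_mul, DirichletCharacter.unit_norm_eq_one, one_mul]

lemma card_ann (h : ZMod m) :
    ((univ : Finset (ZMod m)).filter (fun t => t * h = 0)).card ≤ Nat.gcd h.val m := by
  set g := Nat.gcd h.val m with hg
  have hm : 0 < m := Nat.pos_of_ne_zero (NeZero.ne m)
  have hgpos : 0 < g := Nat.gcd_pos_of_pos_right _ hm
  have hgm : g ∣ m := Nat.gcd_dvd_right _ _
  have hdiv : ∀ t : ZMod m, t * h = 0 → (m / g) ∣ t.val := by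
    intro t ht
    have h1 : m ∣ t.val * h.val := by
      rw [← ZMod.natCast_eq_zero_iff]; push_cast; simpa using ht
    have h2 : m / g ∣ t.val * (h.val / g) := by
      have : m / g * g ∣ t.val * (h.val / g) * g := by
        rw [Nat.div_mul_cancel hgm, mul_assoc, Nat.div_mul_cancel (Nat.gcd_dvd_left _ _)]
        exact h1
      exact Nat.dvd_of_mul_dvd_mul_right hgpos this
    have h3 : Nat.Coprime (m / g) (h.val / g) := (Nat.coprime_div_gcd_div_gcd hgpos).symm
    exact h3.dvd_of_dvd_mul_right h2
  have hmg : 0 < m / g := Nat.div_pos (Nat.le_of_dvd hm hgm) hgpos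
  calc _ ≤ (range g).card := by
        refine Finset.card_le_card_of_injOn (fun t => t.val / (m / g)) ?_ ?_
        · intro t ht
          simp only [coe_range, Set.mem_Iio]
          rw [Nat.div_lt_iff_lt_mul hmg, Nat.mul_div_cancel' hgm]
          exact ZMod.val_lt t
        · intro t ht t' ht' h
          simp only [coe_filter, mem_univ, true_and, Set.mem_ofPred_eq] at ht ht'
          have := congrArg (· * (m / g)) h
          simp only at this
          rw [Nat.div_mul_cancel (hdiv t ht), Nat.div_mul_cancel (hdiv t' ht')] at this
          exact ZMod.val_injective m this
    _ = g := card_range g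

lemma norm_char_le (χ : DirichletCharacter ℂ m) (n : ZMod m) :
    ‖χ n‖ ≤ if IsUnit n then 1 else 0 := by
  split_ifs with h
  · exact χ.norm_le_one n
  · rw [MulChar.map_nonunit χ h]; simp

lemma card_isUnit : (((univ : Finset (ZMod m)).filter (fun t => IsUnit t)).card) = m.totient := by
  rw [← ZMod.card_units_eq_totient m, ← Finset.card_univ (α := (ZMod m)ˣ),
    ← Finset.card_map (⟨fun u : (ZMod m)ˣ => (u : ZMod m), Units.val_injective⟩)]
  congr 1
  ext t
  simp only [mem_filter, mem_univ, true_and, mem_map, Function.Embedding.coeFn_mk]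
  exact Iff.rfl

lemma Gs_bound (χ : DirichletCharacter ℂ m) (h : ZMod m) :
    ‖Gs χ h‖ ^ 2 ≤ m * Nat.gcd h.val m := by
  have h1 : (m.totient : ℝ) * ‖Gs χ h‖ ^ 2 ≤ ∑ u : ZMod m, ‖Gs χ (h * u)‖ ^ 2 := by
    calc (m.totient : ℝ) * ‖Gs χ h‖ ^ 2
        = ∑ u ∈ (univ : Finset (ZMod m)).filter (fun t => IsUnit t), ‖Gs χ (h * u)‖ ^ 2 := by
          rw [← card_isUnit, ← nsmul_eq_mul, ← Finset.sum_const]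
          refine Finset.sum_congr rfl fun u hu => ?_
          obtain ⟨v, rfl⟩ := (Finset.mem_filter.mp hu).2
          rw [Gs_unit]
      _ ≤ _ := Finset.sum_le_sum_of_subset_of_nonneg (Finset.filter_subset _ _)
          (fun _ _ _ => by positivity)
  have h2 : ((∑ u : ZMod m, ‖Gs χ (h * u)‖ ^ 2 : ℝ) : ℂ) =
      ∑ n : ZMod m, ∑ n' : ZMod m, χ n * (starRingEnd ℂ) (χ n') *
        (if (n - n') * h = 0 then (m : ℂ) else 0) := by
    have e0 : ∀ u : ZMod m, ((‖Gs χ (h * u)‖ ^ 2 : ℝ) : ℂ) =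
        ∑ n : ZMod m, ∑ n' : ZMod m, χ n * (starRingEnd ℂ) (χ n') *
          ZMod.stdAddChar (u * ((n - n') * h)) := by
      intro u
      push_cast
      rw [← Complex.mul_conj']
      unfold Gs
      rw [map_sum, Finset.sum_mul_sum]
      refine Finset.sum_congr rfl fun n _ => Finset.sum_congr rfl fun n' _ => ?_
      rw [map_mul (starRingEnd ℂ), ← AddChar.map_neg_eq_conj,
        show u * ((n - n') * h) = n * (h * u) + -(n' * (h * u)) by ring, AddChar.map_add_eq_mul]
      ring
    push_cast at e0 ⊢
    simp_rw [e0]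
    rw [Finset.sum_comm]
    refine Finset.sum_congr rfl fun n _ => ?_
    rw [Finset.sum_comm]
    refine Finset.sum_congr rfl fun n' _ => ?_
    rw [← Finset.mul_sum, AddChar.sum_mulShift _ (ZMod.isPrimitive_stdAddChar m), ZMod.card]
    push_cast
    rfl
  have h3 : ∑ u : ZMod m, ‖Gs χ (h * u)‖ ^ 2 ≤ m.totient * (m * Nat.gcd h.val m) := by
    have : ∑ u : ZMod m, ‖Gs χ (h * u)‖ ^ 2 = ‖((∑ u : ZMod m, ‖Gs χ (h * u)‖ ^ 2 : ℝ) : ℂ)‖ := by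
      rw [Complex.norm_real, Real.norm_of_nonneg (by positivity)]
    rw [this, h2]
    calc _ ≤ ∑ n : ZMod m, ∑ n' : ZMod m, (if IsUnit n then (1 : ℝ) else 0) *
          (if (n - n') * h = 0 then (m : ℝ) else 0) := by
          refine (norm_sum_le _ _).trans (Finset.sum_le_sum fun n _ => ?_)
          refine (norm_sum_le _ _).trans (Finset.sum_le_sum fun n' _ => ?_)
          rw [norm_mul, norm_mul, RCLike.norm_conj]
          have a1 := norm_char_le χ n
          have a2 := χ.norm_le_one n'
          have a3 : ‖(if (n - n') * h = 0 then (m : ℂ) else 0)‖ =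
              (if (n - n') * h = 0 then (m : ℝ) else 0) := by split_ifs <;> simp
          rw [a3]
          apply mul_le_mul_of_nonneg_right _ (by split_ifs <;> positivity)
          calc ‖χ n‖ * ‖χ n'‖ ≤ ‖χ n‖ * 1 := by gcongr
            _ ≤ _ := by rw [mul_one]; exact a1
      _ ≤ ∑ n : ZMod m, (if IsUnit n then (1 : ℝ) else 0) * (m * Nat.gcd h.val m) := by
          refine Finset.sum_le_sum fun n _ => ?_
          rw [← Finset.mul_sum]
          apply mul_le_mul_of_nonneg_left _ (by split_ifs <;> positivity)
          rw [← Equiv.sum_comp (Equiv.subLeft n)]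
          simp only [Equiv.subLeft_apply, sub_sub_cancel]
          rw [← Finset.sum_filter, Finset.sum_const, nsmul_eq_mul, mul_comm]
          gcongr
          exact card_ann h
      _ = _ := by
          rw [← Finset.sum_mul, ← Finset.sum_filter, Finset.sum_const, card_isUnit]
          simp
  have h4 : (0 : ℝ) < m.totient := by
    exact_mod_cast Nat.totient_pos.mpr (Nat.pos_of_ne_zero (NeZero.ne m))
  exact le_of_mul_le_mul_left (h1.trans h3) h4

end S17

namespace S17
open Finset

section
variable {m : ℕ} [NeZero m]

lemma stdAdd_sub_one (h : ZMod m) (hh : h ≠ 0) :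
    1 / ‖ZMod.stdAddChar h - 1‖ ≤ (m : ℝ) / 4 * (1 / h.val + 1 / (m - h.val : ℝ)) := by
  have hm : (0 : ℝ) < m := by exact_mod_cast Nat.pos_of_ne_zero (NeZero.ne m)
  have hj0 : 0 < h.val := Nat.pos_of_ne_zero (by rwa [Ne, ZMod.val_eq_zero])
  have hjm : h.val < m := ZMod.val_lt h
  set j := h.val with hj
  have hj0' : (0 : ℝ) < j := by exact_mod_cast hj0
  have hjm' : (0 : ℝ) < (m : ℝ) - j := by rw [sub_pos]; exact_mod_cast hjm
  have e1 : ‖ZMod.stdAddChar h - 1‖ = 2 * Real.sin (Real.pi * j / m) := by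
    rw [ZMod.stdAddChar_apply, ZMod.toCircle_apply]
    have : 2 * (Real.pi : ℂ) * Complex.I * (h.val : ℂ) / m =
      Complex.I * ((2 * Real.pi * j / m : ℝ) : ℂ) := by push_cast; ring
    rw [this, Complex.norm_exp_I_mul_ofReal_sub_one]
    rw [show 2 * Real.pi * j / m / 2 = Real.pi * j / m by ring]
    apply Real.norm_of_nonneg
    apply mul_nonneg (by norm_num)
    apply Real.sin_nonneg_of_nonneg_of_le_pi
    · have := Real.pi_pos; positivity
    · rw [div_le_iff₀ hm]
      apply mul_le_mul_of_nonneg_left _ Real.pi_pos.le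
      linarith
  rw [e1]
  have hpi := Real.pi_pos
  have key : ∀ t : ℝ, 0 < t → t ≤ m / 2 → 2 * t / m ≤ Real.sin (Real.pi * t / m) := by
    intro t ht htm
    have := Real.mul_le_sin (x := Real.pi * t / m) (by positivity) (by
      rw [div_le_div_iff₀ hm (by norm_num)]; nlinarith)
    refine le_trans (le_of_eq ?_) this
    field_simp
  rcases le_total (j : ℝ) (m / 2) with hc | hc
  · have k1 := key j hj0' hc
    calc 1 / (2 * Real.sin (Real.pi * j / m)) ≤ 1 / (2 * (2 * j / m)) := by gcongr
      _ = (m : ℝ) / 4 * (1 / j) := by field_simp; norm_num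
      _ ≤ _ := by
        apply mul_le_mul_of_nonneg_left _ (by positivity)
        have : 0 ≤ 1 / ((m : ℝ) - j) := by positivity
        linarith
  · have k1 := key (m - j) hjm' (by linarith)
    have : Real.sin (Real.pi * (m - j) / m) = Real.sin (Real.pi * j / m) := by
      rw [← Real.sin_pi_sub]; congr 1; field_simp; ring
    rw [this] at k1
    calc 1 / (2 * Real.sin (Real.pi * j / m)) ≤ 1 / (2 * (2 * (m - j) / m)) := by gcongr
      _ = (m : ℝ) / 4 * (1 / (m - j)) := by field_simp; norm_num
      _ ≤ _ := by
        apply mul_le_mul_of_nonneg_left _ (by positivity)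
        have : 0 ≤ 1 / (j : ℝ) := by positivity
        linarith

lemma geom_bound (h : ZMod m) (hh : h ≠ 0) (x : ℕ) :
    ‖∑ k ∈ range x, ZMod.stdAddChar (-((k : ZMod m) * h))‖ ≤
      (m : ℝ) / 2 * (1 / h.val + 1 / (m - h.val : ℝ)) := by
  set z : ℂ := ZMod.stdAddChar (-h) with hz
  have hzn : ∀ a : ZMod m, ‖(ZMod.stdAddChar a : ℂ)‖ = 1 := fun a => by
    rw [ZMod.stdAddChar_apply]; exact Circle.norm_coe _
  have e1 : ∀ k : ℕ, ZMod.stdAddChar (-((k : ZMod m) * h)) = z ^ k := by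
    intro k
    rw [hz, ← AddChar.map_nsmul_eq_pow]
    congr 1; simp
  simp_rw [e1]
  have e2 : ‖z - 1‖ = ‖ZMod.stdAddChar h - 1‖ := by
    have : ZMod.stdAddChar h * (z - 1) = -(ZMod.stdAddChar h - 1) := by
      rw [hz, mul_sub, ← AddChar.map_add_eq_mul]; simp
    have h2 := congrArg norm this
    rwa [norm_mul, hzn, one_mul, norm_neg] at h2
  have hne : ZMod.stdAddChar h - 1 ≠ 0 := by
    intro h0
    rw [sub_eq_zero, ← AddChar.map_zero_eq_one (ZMod.stdAddChar (N := m))] at h0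
    exact hh (ZMod.injective_stdAddChar h0)
  have hpos : 0 < ‖z - 1‖ := by rw [e2]; exact norm_pos_iff.mpr hne
  have e3 := congrArg norm (mul_geom_sum z x)
  rw [norm_mul] at e3
  have e4 : ‖z ^ x - 1‖ ≤ 2 := by
    refine (norm_sub_le _ _).trans ?_
    rw [norm_pow, hz, hzn]; norm_num
  have e5 : ‖∑ k ∈ range x, z ^ k‖ ≤ 2 * (1 / ‖z - 1‖) := by
    rw [mul_one_div, le_div_iff₀ hpos, mul_comm]; linarith
  refine e5.trans ?_
  rw [e2]
  have := stdAdd_sub_one h hh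
  linarith

lemma completion (χ : DirichletCharacter ℂ m) (x : ℕ) :
    (m : ℂ) * ∑ k ∈ range x, χ (k : ZMod m) =
      ∑ h : ZMod m, Gs χ h * ∑ k ∈ range x, ZMod.stdAddChar (-((k : ZMod m) * h)) := by
  unfold Gs
  have : ∀ h : ZMod m, (∑ n : ZMod m, χ n * ZMod.stdAddChar (n * h)) *
      ∑ k ∈ range x, ZMod.stdAddChar (-((k : ZMod m) * h)) =
      ∑ k ∈ range x, ∑ n : ZMod m, χ n * ZMod.stdAddChar (h * (n - (k : ZMod m))) := by
    intro h
    rw [Finset.sum_mul_sum, Finset.sum_comm]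
    refine Finset.sum_congr rfl fun k _ => Finset.sum_congr rfl fun n _ => ?_
    rw [mul_assoc, ← AddChar.map_add_eq_mul]
    congr 2; ring
  simp_rw [this]
  rw [Finset.sum_comm, Finset.mul_sum]
  refine Finset.sum_congr rfl fun k _ => ?_
  rw [Finset.sum_comm]
  simp_rw [← Finset.mul_sum, AddChar.sum_mulShift _ (ZMod.isPrimitive_stdAddChar m), ZMod.card,
    sub_eq_zero]
  simp [mul_comm]

lemma gcd_sum (m : ℕ) (hm : m ≠ 0) :
    ∑ j ∈ Ioo 0 m, (Nat.gcd j m : ℝ) / j ≤ tau m * (1 + Real.log m) := by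
  have h1 : ∑ j ∈ Ioo 0 m, (Nat.gcd j m : ℝ) / j ≤
      ∑ g ∈ m.divisors, ∑ i ∈ Icc 1 m, (1 : ℝ) / i := by
    rw [← Finset.sum_product']
    have h0 : ∀ j ∈ Ioo 0 m, (Nat.gcd j m : ℝ) / j = 1 / ((j / Nat.gcd j m : ℕ) : ℝ) := by
      intro j hj
      have hg : 0 < Nat.gcd j m := Nat.gcd_pos_of_pos_right _ (Nat.pos_of_ne_zero hm)
      rw [Nat.cast_div (Nat.gcd_dvd_left _ _) (by positivity)]
      field_simp
    rw [Finset.sum_congr rfl h0]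
    have := Finset.sum_image (s := Ioo 0 m) (g := fun j => (Nat.gcd j m, j / Nat.gcd j m))
      (f := fun q : ℕ × ℕ => (1 : ℝ) / (q.2 : ℝ)) (by
        intro a _ b _ hab
        simp only [Prod.mk.injEq] at hab
        have ha := Nat.div_mul_cancel (Nat.gcd_dvd_left a m)
        have hb := Nat.div_mul_cancel (Nat.gcd_dvd_left b m)
        rw [← ha, ← hb, hab.2, hab.1])
    rw [← this]
    apply Finset.sum_le_sum_of_subset_of_nonneg
    · intro q hq
      simp only [mem_image, mem_Ioo] at hq
      obtain ⟨j, ⟨hj0, hjm⟩, rfl⟩ := hq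
      simp only [mem_product, Nat.mem_divisors, mem_Icc]
      refine ⟨⟨Nat.gcd_dvd_right _ _, hm⟩, ?_, ?_⟩
      · exact Nat.div_pos (Nat.gcd_le_left _ hj0) (Nat.gcd_pos_of_pos_left _ hj0)
      · exact (Nat.div_le_self _ _).trans hjm.le
    · intros; positivity
  refine h1.trans ?_
  rw [Finset.sum_const, nsmul_eq_mul]
  apply mul_le_mul_of_nonneg_left _ (by positivity)
  have := harmonic_le_one_add_log m
  rw [harmonic_eq_sum_Icc] at this
  push_cast at this
  simpa using this

/-- Polya–Vinogradov. -/
lemma polya_vinogradov (χ : DirichletCharacter ℂ m) (hχ : χ ≠ 1) (x : ℕ) :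
    ‖∑ k ∈ range x, χ (k : ZMod m)‖ ≤ Real.sqrt m * (tau m * (1 + Real.log m)) := by
  have hm0 : m ≠ 0 := NeZero.ne m
  have hm : (0 : ℝ) < m := by exact_mod_cast Nat.pos_of_ne_zero hm0
  have hG0 : Gs χ 0 = 0 := by
    unfold Gs
    simpa using MulChar.sum_eq_zero_of_ne_one hχ
  have h1 : (m : ℝ) * ‖∑ k ∈ range x, χ (k : ZMod m)‖ ≤
      ∑ h ∈ (univ : Finset (ZMod m)).erase 0, (Real.sqrt m * Nat.gcd h.val m) *
        ((m : ℝ) / 2 * (1 / h.val + 1 / (m - h.val : ℝ))) := by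
    have := congrArg norm (completion χ x)
    rw [norm_mul, Complex.norm_natCast] at this
    rw [this, ← Finset.add_sum_erase _ _ (mem_univ (0 : ZMod m)), hG0, zero_mul, zero_add]
    refine (norm_sum_le _ _).trans (Finset.sum_le_sum fun h hh => ?_)
    rw [norm_mul]
    have hh0 := Finset.ne_of_mem_erase hh
    have hb := Gs_bound χ h
    have hg1 : (1 : ℝ) ≤ Nat.gcd h.val m := by
      exact_mod_cast Nat.gcd_pos_of_pos_right _ (Nat.pos_of_ne_zero hm0)
    have hb' : ‖Gs χ h‖ ≤ Real.sqrt m * Nat.gcd h.val m := by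
      apply abs_le_of_sq_le_sq' _ (by positivity) |>.2
      rw [mul_pow, Real.sq_sqrt hm.le]
      refine hb.trans ?_
      apply mul_le_mul_of_nonneg_left _ hm.le
      nlinarith
    exact mul_le_mul hb' (geom_bound h hh0 x) (norm_nonneg _) (by positivity)
  have h2 : ∑ h ∈ (univ : Finset (ZMod m)).erase 0, (Real.sqrt m * Nat.gcd h.val m) *
        ((m : ℝ) / 2 * (1 / h.val + 1 / (m - h.val : ℝ))) =
      ∑ j ∈ Ioo 0 m, (Real.sqrt m * Nat.gcd j m) * ((m : ℝ) / 2 * (1 / j + 1 / (m - j : ℝ))) := by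
    refine Finset.sum_bij (fun h _ => h.val) ?_ ?_ ?_ ?_
    · intro h hh
      simp only [mem_Ioo]
      refine ⟨Nat.pos_of_ne_zero ?_, ZMod.val_lt h⟩
      rw [Ne, ZMod.val_eq_zero]; exact Finset.ne_of_mem_erase hh
    · intro a _ b _ hab; exact ZMod.val_injective m hab
    · intro j hj
      rw [mem_Ioo] at hj
      have hv : ((j : ZMod m)).val = j := ZMod.val_cast_of_lt hj.2
      refine ⟨(j : ZMod m), ?_, hv⟩
      simp only [mem_erase, mem_univ, and_true]
      intro h0
      rw [h0, ZMod.val_zero] at hv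
      omega
    · intros; rfl
  have h3 : ∑ j ∈ Ioo 0 m, (Real.sqrt m * Nat.gcd j m) * ((m : ℝ) / 2 * (1 / j + 1 / (m - j : ℝ)))
      = m * (Real.sqrt m * ∑ j ∈ Ioo 0 m, (Nat.gcd j m : ℝ) / j) := by
    have hrefl : ∑ j ∈ Ioo 0 m, (Nat.gcd j m : ℝ) / (m - j : ℝ) =
        ∑ j ∈ Ioo 0 m, (Nat.gcd j m : ℝ) / j := by
      refine Finset.sum_bij (fun j _ => m - j) ?_ ?_ ?_ ?_
      · intro j hj; rw [mem_Ioo] at *; omega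
      · intro a ha b hb hab; rw [mem_Ioo] at *; omega
      · intro j hj; rw [mem_Ioo] at hj
        exact ⟨m - j, by rw [mem_Ioo]; omega, by omega⟩
      · intro j hj
        rw [mem_Ioo] at hj
        rw [Nat.cast_sub hj.2.le, Nat.gcd_comm (m - j), Nat.gcd_self_sub_right hj.2.le,
          Nat.gcd_comm m j]
    have : ∀ j ∈ Ioo 0 m, (Real.sqrt m * Nat.gcd j m) * ((m : ℝ) / 2 * (1 / j + 1 / (m - j : ℝ)))
        = m * Real.sqrt m / 2 * ((Nat.gcd j m : ℝ) / j) +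
          m * Real.sqrt m / 2 * ((Nat.gcd j m : ℝ) / (m - j : ℝ)) := by
      intro j _; ring
    rw [Finset.sum_congr rfl this, Finset.sum_add_distrib, ← Finset.mul_sum, ← Finset.mul_sum,
      hrefl]
    ring
  rw [h2, h3] at h1
  have h4 := le_of_mul_le_mul_left h1 hm
  refine h4.trans ?_
  exact mul_le_mul_of_nonneg_left (gcd_sum m hm0) (Real.sqrt_nonneg _)

end
end S17

namespace S17
open Finset

lemma sum_dvd_ite {E : Type*} [AddCommMonoid E] (q x : ℕ) (hq : 0 < q) (f : ℕ → E) :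
    ∑ n ∈ Ioc 0 x, (if q ∣ n then f n else 0) = ∑ k ∈ Ioc 0 (x / q), f (q * k) := by
  rw [← Finset.sum_filter]
  symm
  refine Finset.sum_bij (fun k _ => q * k) ?_ ?_ ?_ ?_
  · intro k hk
    simp only [mem_filter, mem_Ioc] at *
    refine ⟨⟨Nat.mul_pos hq hk.1, ?_⟩, dvd_mul_right _ _⟩
    rw [mul_comm]; exact (Nat.le_div_iff_mul_le hq).mp hk.2
  · intro a _ b _ h; exact Nat.eq_of_mul_eq_mul_left hq h
  · intro n hn
    simp only [mem_filter, mem_Ioc] at hn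
    obtain ⟨⟨h0, hx⟩, k, rfl⟩ := hn
    refine ⟨k, ?_, rfl⟩
    rw [mem_Ioc]
    refine ⟨Nat.pos_of_mul_pos_left h0, ?_⟩
    rw [Nat.le_div_iff_mul_le hq, mul_comm]; exact hx
  · intros; rfl

lemma moebius_coprime (n m : ℕ) (hm : m ≠ 0) :
    ∑ d ∈ m.divisors, (if d ∣ n then ArithmeticFunction.moebius d else 0) =
      if Nat.Coprime n m then (1 : ℤ) else 0 := by
  have hg : Nat.gcd n m ≠ 0 := Nat.gcd_ne_zero_right hm
  have h1 : ∑ d ∈ m.divisors, (if d ∣ n then ArithmeticFunction.moebius d else 0) =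
      ∑ d ∈ (Nat.gcd n m).divisors, ArithmeticFunction.moebius d := by
    rw [← Finset.sum_filter]
    apply Finset.sum_congr _ (fun _ _ => rfl)
    ext d
    simp only [mem_filter, Nat.mem_divisors, Nat.dvd_gcd_iff]
    tauto
  rw [h1]
  have h2 := congrArg (fun f => f (Nat.gcd n m)) ArithmeticFunction.moebius_mul_coe_zeta
  rw [ArithmeticFunction.coe_mul_zeta_apply, ArithmeticFunction.one_apply] at h2
  rw [h2]

lemma count_coprime_eq (m x : ℕ) (hm : m ≠ 0) :
    ((((Ioc 0 x).filter (fun n => Nat.Coprime n m)).card : ℤ) : ℤ) =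
      ∑ d ∈ m.divisors, ArithmeticFunction.moebius d * ((x / d : ℕ) : ℤ) := by
  rw [Finset.card_filter]
  push_cast
  simp_rw [← moebius_coprime _ m hm]
  rw [Finset.sum_comm]
  refine Finset.sum_congr rfl fun d hd => ?_
  have hd0 : 0 < d := Nat.pos_of_mem_divisors hd
  rw [sum_dvd_ite d x hd0]
  simp [mul_comm]

/-- The density of integers coprime to `m`. -/
noncomputable def gam (m : ℕ) : ℝ := (m.totient : ℝ) / m

lemma gam_pos {m : ℕ} (hm : m ≠ 0) : 0 < gam m := by
  have : 0 < m.totient := Nat.totient_pos.mpr (Nat.pos_of_ne_zero hm)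
  unfold gam; positivity

lemma gam_le_one (m : ℕ) : gam m ≤ 1 := by
  unfold gam
  apply div_le_one_of_le₀ _ (by positivity)
  exact_mod_cast Nat.totient_le m

lemma totient_card_Ioc (m : ℕ) :
    m.totient = ((Ioc 0 m).filter (fun n => Nat.Coprime n m)).card := by
  rw [← Nat.filter_coprime_Ico_eq_totient m 1]
  congr 1
  ext n
  simp only [mem_filter, mem_Ico, mem_Ioc, Nat.coprime_comm (n := m)]
  constructor <;> rintro ⟨h1, h2⟩ <;> exact ⟨by omega, h2⟩

lemma gam_eq (m : ℕ) (hm : m ≠ 0) :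
    gam m = ∑ d ∈ m.divisors, (ArithmeticFunction.moebius d : ℝ) / d := by
  have h := count_coprime_eq m m hm
  rw [← totient_card_Ioc] at h
  have hm' : (m : ℝ) ≠ 0 := by exact_mod_cast hm
  unfold gam
  rw [div_eq_iff hm', Finset.sum_mul]
  have h' : (m.totient : ℝ) = ∑ d ∈ m.divisors, (ArithmeticFunction.moebius d : ℝ) * ((m / d : ℕ) : ℝ) := by
    have h2 := congrArg (fun z : ℤ => (z : ℝ)) h
    push_cast at h2
    exact h2
  rw [h']
  refine Finset.sum_congr rfl fun d hd => ?_
  have hd0 : (d : ℝ) ≠ 0 := by exact_mod_cast (Nat.pos_of_mem_divisors hd).ne'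
  rw [Nat.cast_div (Nat.dvd_of_mem_divisors hd) hd0]
  field_simp

lemma count_coprime (m x : ℕ) (hm : m ≠ 0) :
    |((((Ioc 0 x).filter (fun n => Nat.Coprime n m)).card : ℕ) : ℝ) - gam m * x| ≤ tau m := by
  have h : ((((Ioc 0 x).filter (fun n => Nat.Coprime n m)).card : ℕ) : ℝ) =
      ∑ d ∈ m.divisors, (ArithmeticFunction.moebius d : ℝ) * ((x / d : ℕ) : ℝ) := by
    have h2 := congrArg (fun z : ℤ => (z : ℝ)) (count_coprime_eq m x hm)
    push_cast at h2
    exact h2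
  rw [h, gam_eq m hm, Finset.sum_mul, ← Finset.sum_sub_distrib]
  refine (Finset.abs_sum_le_sum_abs _ _).trans ?_
  unfold tau
  rw [← mul_one (Finset.card _ : ℝ), ← nsmul_eq_mul, ← Finset.sum_const]
  refine Finset.sum_le_sum fun d hd => ?_
  have hd0 : (0 : ℝ) < d := by exact_mod_cast Nat.pos_of_mem_divisors hd
  have e : (ArithmeticFunction.moebius d : ℝ) * ((x / d : ℕ) : ℝ) - ArithmeticFunction.moebius d / d * x
      = ArithmeticFunction.moebius d * (((x / d : ℕ) : ℝ) - x / d) := by ring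
  rw [e, abs_mul]
  have h1 : |(ArithmeticFunction.moebius d : ℝ)| ≤ 1 := by
    exact_mod_cast ArithmeticFunction.abs_moebius_le_one (n := d)
  have h2 : |((x / d : ℕ) : ℝ) - x / d| ≤ 1 := by
    rw [abs_le]
    have a1 := Nat.cast_div_le (α := ℝ) (m := x) (n := d)
    have a2 : (x : ℝ) / d < (x / d : ℕ) + 1 := by
      rw [div_lt_iff₀ hd0]
      have := Nat.lt_mul_div_succ x (Nat.pos_of_mem_divisors hd)
      rw [mul_comm]
      exact_mod_cast this
    constructor <;> linarith
  calc _ ≤ (1 : ℝ) * 1 := mul_le_mul h1 h2 (abs_nonneg _) (by norm_num)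
    _ = 1 := by ring

end S17

namespace S17
open Finset

/-- Divisor-sum with weights `lam`, level `D`. -/
noncomputable def LamD (lam : ℕ → ℝ) (D n : ℕ) : ℝ :=
  ∑ d ∈ Icc 1 D, if d ∣ n then lam d else 0

lemma quad_expand (lam : ℕ → ℝ) (D : ℕ) (W : Finset ℕ) (g : ℕ → ℂ) :
    ∑ n ∈ W, g n / n * ((LamD lam D n ^ 2 : ℝ) : ℂ) =
      ∑ d ∈ Icc 1 D, ∑ e ∈ Icc 1 D, ((lam d * lam e : ℝ) : ℂ) *
        ∑ n ∈ W, (if Nat.lcm d e ∣ n then g n else 0) / n := by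
  have h1 : ∀ n, ((LamD lam D n ^ 2 : ℝ) : ℂ) = ∑ d ∈ Icc 1 D, ∑ e ∈ Icc 1 D,
      ((lam d * lam e : ℝ) : ℂ) * (if Nat.lcm d e ∣ n then 1 else 0) := by
    intro n
    rw [pow_two]
    unfold LamD
    rw [Finset.sum_mul_sum]
    push_cast
    refine Finset.sum_congr rfl fun d _ => Finset.sum_congr rfl fun e _ => ?_
    by_cases hd : d ∣ n <;> by_cases he : e ∣ n <;> simp [hd, he, Nat.lcm_dvd_iff]
  simp_rw [h1, Finset.mul_sum]
  rw [Finset.sum_comm]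
  refine Finset.sum_congr rfl fun d _ => ?_
  rw [Finset.sum_comm]
  refine Finset.sum_congr rfl fun e _ => Finset.sum_congr rfl fun n _ => ?_
  split_ifs <;> ring

lemma quad_bound (lam : ℕ → ℝ) (D a b : ℕ) (ha : 1 ≤ a) (hab : a ≤ b) (g : ℕ → ℂ) (B : ℝ)
    (hB : ∀ q x : ℕ, 0 < q → ‖∑ n ∈ Ioc 0 x, (if q ∣ n then g n else 0)‖ ≤ B) :
    ‖∑ n ∈ Ioc a b, g n / n * ((LamD lam D n ^ 2 : ℝ) : ℂ)‖ ≤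
      (∑ d ∈ Icc 1 D, |lam d|) ^ 2 * (2 * B / a) := by
  rw [quad_expand, pow_two, Finset.sum_mul_sum, Finset.sum_mul]
  refine (norm_sum_le _ _).trans (Finset.sum_le_sum fun d hd => ?_)
  rw [Finset.sum_mul]
  refine (norm_sum_le _ _).trans (Finset.sum_le_sum fun e he => ?_)
  rw [norm_mul, Complex.norm_real, Real.norm_eq_abs, abs_mul]
  rw [mem_Icc] at hd he
  apply mul_le_mul_of_nonneg_left _ (by positivity)
  exact abel_bound _ B a b ha hab (fun x => hB _ x (Nat.lcm_pos (by omega) (by omega)))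

section
variable {m : ℕ} [NeZero m]

/-- The bound in Polya–Vinogradov. -/
noncomputable def PV (m : ℕ) : ℝ := Real.sqrt m * (tau m * (1 + Real.log m))

lemma PV_nonneg (m : ℕ) : 0 ≤ PV m := by
  unfold PV
  rcases Nat.eq_zero_or_pos m with rfl | h
  · simp
  · have : 0 ≤ Real.log m := Real.log_natCast_nonneg m
    have := tau_nonneg m
    positivity

lemma char_sum_dvd (χ : DirichletCharacter ℂ m) (hχ : χ ≠ 1) (q x : ℕ) (hq : 0 < q) :
    ‖∑ n ∈ Ioc 0 x, (if q ∣ n then χ (n : ZMod m) else 0)‖ ≤ PV m := by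
  rw [sum_dvd_ite q x hq (fun n => χ (n : ZMod m))]
  have hm1 : m ≠ 1 := by
    rintro rfl
    exact hχ (DirichletCharacter.level_one χ)
  have : Nontrivial (ZMod m) := ZMod.nontrivial_iff.mpr hm1
  have e : ∑ k ∈ Ioc 0 (x / q), χ ((q * k : ℕ) : ZMod m) =
      χ (q : ZMod m) * ∑ k ∈ range (x / q + 1), χ (k : ZMod m) := by
    have h0 : range (x / q + 1) = insert 0 (Ioc 0 (x / q)) := by
      generalize x / q = y
      ext k; simp only [mem_range, mem_insert, mem_Ioc]; omega
    rw [h0, Finset.sum_insert (by simp), Nat.cast_zero, MulChar.map_zero, zero_add, Finset.mul_sum]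
    refine Finset.sum_congr rfl fun k _ => ?_
    rw [Nat.cast_mul, map_mul]
  rw [e, norm_mul]
  calc _ ≤ 1 * ‖∑ k ∈ range (x / q + 1), χ (k : ZMod m)‖ := by
        gcongr; exact χ.norm_le_one _
    _ ≤ _ := by rw [one_mul]; exact polya_vinogradov χ hχ _

lemma quad_char (lam : ℕ → ℝ) (D a b : ℕ) (ha : 1 ≤ a) (hab : a ≤ b)
    (χ : DirichletCharacter ℂ m) (hχ : χ ≠ 1) :
    ‖∑ n ∈ Ioc a b, χ (n : ZMod m) / n * ((LamD lam D n ^ 2 : ℝ) : ℂ)‖ ≤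
      (∑ d ∈ Icc 1 D, |lam d|) ^ 2 * (2 * PV m / a) :=
  quad_bound lam D a b ha hab _ _ (fun q x hq => char_sum_dvd χ hχ q x hq)

end

lemma coprime_dvd_sum (m q x : ℕ) (hm : m ≠ 0) (hq : 0 < q) (hqm : Nat.Coprime q m) :
    |∑ n ∈ Ioc 0 x, ((if q ∣ n then (if Nat.Coprime n m then (1 : ℝ) else 0) else 0) - gam m / q)|
      ≤ 2 * tau m := by
  rw [Finset.sum_sub_distrib, sum_dvd_ite q x hq (fun n => if Nat.Coprime n m then (1 : ℝ) else 0)]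
  have e1 : ∑ k ∈ Ioc 0 (x / q), (if Nat.Coprime (q * k) m then (1 : ℝ) else 0) =
      (((Ioc 0 (x / q)).filter (fun n => Nat.Coprime n m)).card : ℕ) := by
    rw [Finset.card_filter]
    push_cast
    refine Finset.sum_congr rfl fun k _ => ?_
    exact if_congr (Nat.coprime_mul_iff_left.trans (and_iff_right hqm)) rfl rfl
  rw [e1]
  have h1 := count_coprime m (x / q) hm
  have hq' : (0 : ℝ) < q := by exact_mod_cast hq
  have h2 : |((x / q : ℕ) : ℝ) - x / q| ≤ 1 := by
    rw [abs_le]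
    have a1 := Nat.cast_div_le (α := ℝ) (m := x) (n := q)
    have a2 : (x : ℝ) / q < (x / q : ℕ) + 1 := by
      rw [div_lt_iff₀ hq']
      have := Nat.lt_mul_div_succ x hq
      rw [mul_comm]
      exact_mod_cast this
    constructor <;> linarith
  have h3 : |gam m * (((x / q : ℕ) : ℝ) - x / q)| ≤ 1 := by
    rw [abs_mul, abs_of_pos (gam_pos hm)]
    calc _ ≤ (1 : ℝ) * 1 := mul_le_mul (gam_le_one m) h2 (abs_nonneg _) (by norm_num)
      _ = 1 := by ring
  have h4 := one_le_tau hm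
  rw [Finset.sum_const, Nat.card_Ioc, nsmul_eq_mul]
  have e : ((((Ioc 0 (x / q)).filter (fun n => Nat.Coprime n m)).card : ℕ) : ℝ) -
      ((x - 0 : ℕ) : ℝ) * (gam m / q) =
      (((((Ioc 0 (x / q)).filter (fun n => Nat.Coprime n m)).card : ℕ) : ℝ) - gam m * (x / q : ℕ))
      + gam m * (((x / q : ℕ) : ℝ) - x / q) := by
    simp only [Nat.sub_zero]; ring
  rw [e]
  refine (abs_add_le _ _).trans ?_
  linarith

lemma coprime_abel (m q a b : ℕ) (hm : m ≠ 0) (hq : 0 < q) (hqm : Nat.Coprime q m)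
    (ha : 1 ≤ a) (hab : a ≤ b) :
    |∑ n ∈ Ioc a b, (if q ∣ n then (if Nat.Coprime n m then (1 : ℝ) else 0) else 0) / n
      - gam m / q * ∑ n ∈ Ioc a b, (1 : ℝ) / n| ≤ 4 * tau m / a := by
  have := abel_bound (fun n => (((if q ∣ n then (if Nat.Coprime n m then (1 : ℝ) else 0) else 0)
    - gam m / q : ℝ) : ℂ)) (2 * tau m) a b ha hab (by
      intro x
      rw [← Complex.ofReal_sum, Complex.norm_real, Real.norm_eq_abs]
      exact coprime_dvd_sum m q x hm hq hqm)
  have e : ∑ n ∈ Ioc a b, (((if q ∣ n then (if Nat.Coprime n m then (1 : ℝ) else 0) else 0)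
    - gam m / q : ℝ) : ℂ) / n = ((∑ n ∈ Ioc a b, (if q ∣ n then (if Nat.Coprime n m then (1 : ℝ)
      else 0) else 0) / n - gam m / q * ∑ n ∈ Ioc a b, (1 : ℝ) / n : ℝ) : ℂ) := by
    rw [Finset.mul_sum, ← Finset.sum_sub_distrib, Complex.ofReal_sum]
    refine Finset.sum_congr rfl fun n _ => ?_
    push_cast; ring
  rw [e, Complex.norm_real, Real.norm_eq_abs] at this
  refine this.trans (le_of_eq ?_)
  ring

lemma quad_main (m : ℕ) (hm : m ≠ 0) (lam : ℕ → ℝ) (D a b : ℕ) (ha : 1 ≤ a) (hab : a ≤ b)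
    (hlam : ∀ d, lam d ≠ 0 → Nat.Coprime d m) :
    |∑ n ∈ (Ioc a b).filter (fun n => Nat.Coprime n m), LamD lam D n ^ 2 / n -
      gam m * (∑ n ∈ Ioc a b, (1 : ℝ) / n) *
        ∑ d ∈ Icc 1 D, ∑ e ∈ Icc 1 D, lam d * lam e / (Nat.lcm d e : ℝ)| ≤
      (∑ d ∈ Icc 1 D, |lam d|) ^ 2 * (4 * tau m / a) := by
  have h1 : ∑ n ∈ (Ioc a b).filter (fun n => Nat.Coprime n m), LamD lam D n ^ 2 / n =
      ∑ d ∈ Icc 1 D, ∑ e ∈ Icc 1 D, (lam d * lam e) *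
        ∑ n ∈ Ioc a b, (if Nat.lcm d e ∣ n then (if Nat.Coprime n m then (1 : ℝ) else 0) else 0) / n
      := by
    have := quad_expand lam D (Ioc a b) (fun n => if Nat.Coprime n m then 1 else 0)
    rw [Finset.sum_filter]
    apply Complex.ofReal_injective
    push_cast
    push_cast at this
    simp only [apply_ite Complex.ofReal, Complex.ofReal_one, Complex.ofReal_zero,
      Complex.ofReal_div, Complex.ofReal_pow, Complex.ofReal_natCast]
    rw [← this]
    refine Finset.sum_congr rfl fun n _ => ?_
    split_ifs <;> ring
  rw [h1, Finset.mul_sum, ← Finset.sum_sub_distrib, pow_two, Finset.sum_mul_sum, Finset.sum_mul]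
  refine (Finset.abs_sum_le_sum_abs _ _).trans (Finset.sum_le_sum fun d hd => ?_)
  rw [Finset.mul_sum, ← Finset.sum_sub_distrib, Finset.sum_mul]
  refine (Finset.abs_sum_le_sum_abs _ _).trans (Finset.sum_le_sum fun e he => ?_)
  rw [mem_Icc] at hd he
  by_cases h0 : lam d = 0
  · simp [h0]
  by_cases h0' : lam e = 0
  · simp [h0']
  have hc : Nat.Coprime (Nat.lcm d e) m :=
    Nat.Coprime.of_dvd_left (Nat.lcm_dvd_mul d e) ((hlam d h0).mul_left (hlam e h0'))
  have := coprime_abel m (Nat.lcm d e) a b hm (Nat.lcm_pos (by omega) (by omega)) hc ha hab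
  set X := ∑ n ∈ Ioc a b, (if Nat.lcm d e ∣ n then (if Nat.Coprime n m then (1 : ℝ) else 0) else 0) / n
  set Y := ∑ n ∈ Ioc a b, (1 : ℝ) / n
  rw [show lam d * lam e * X - gam m * Y * (lam d * lam e / (Nat.lcm d e : ℝ)) =
    lam d * lam e * (X - gam m / (Nat.lcm d e : ℝ) * Y) by ring, abs_mul, abs_mul]
  exact mul_le_mul_of_nonneg_left this (by positivity)

end S17

namespace S17
open Finset

lemma le_totient_mul_tau (n : ℕ) (hn : n ≠ 0) : (n : ℝ) ≤ n.totient * tau n := by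
  have h := Nat.sum_totient n
  have : n ≤ n.divisors.card * n.totient := by
    conv_lhs => rw [← h]
    rw [← smul_eq_mul, ← Finset.sum_const]
    refine Finset.sum_le_sum fun d hd => ?_
    exact Nat.le_of_dvd (Nat.totient_pos.mpr (Nat.pos_of_ne_zero hn))
      (Nat.totient_dvd_of_dvd (Nat.dvd_of_mem_divisors hd))
  unfold tau
  rw [mul_comm]
  exact_mod_cast this

/-- Squarefree integers up to `D` coprime to `m`. -/
noncomputable def supp (m D : ℕ) : Finset ℕ :=
  (Icc 1 D).filter (fun r => Squarefree r ∧ Nat.Coprime r m)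

lemma mem_supp {m D r : ℕ} :
    r ∈ supp m D ↔ (1 ≤ r ∧ r ≤ D) ∧ Squarefree r ∧ Nat.Coprime r m := by
  simp [supp]

noncomputable def Ysum (m D : ℕ) (y : ℕ → ℝ) (d : ℕ) : ℝ :=
  ∑ r ∈ supp m D, if d ∣ r then y r / r.totient else 0

/-- Selberg weights. -/
noncomputable def lamS (m D : ℕ) (y : ℕ → ℝ) (d : ℕ) : ℝ :=
  ArithmeticFunction.moebius d * d * Ysum m D y d

lemma lamS_coprime (m D : ℕ) (y : ℕ → ℝ) (d : ℕ) (h : lamS m D y d ≠ 0) : Nat.Coprime d m := by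
  by_contra hc
  apply h
  unfold lamS Ysum
  rw [Finset.sum_eq_zero, mul_zero]
  intro r hr
  rw [if_neg]
  intro hd
  exact hc (Nat.Coprime.of_dvd_left hd (mem_supp.mp hr).2.2)

lemma moebius_interval (D r s : ℕ) (hs : Squarefree s) (hsD : s ≤ D) :
    ∑ d ∈ Icc 1 D, (if r ∣ d then (if d ∣ s then (ArithmeticFunction.moebius d : ℝ) else 0) else 0) =
      if r = s then (ArithmeticFunction.moebius r : ℝ) else 0 := by
  have hs0 : s ≠ 0 := hs.ne_zero
  by_cases hrs : r ∣ s
  · obtain ⟨t, rfl⟩ := hrs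
    have hr0 : 0 < r := Nat.pos_of_ne_zero (by rintro rfl; simp at hs0)
    have ht0 : t ≠ 0 := by rintro rfl; simp at hs0
    have e0 : Icc 1 D = Ioc 0 D := by ext; simp; omega
    rw [e0, sum_dvd_ite r D hr0]
    have e1 : ∑ k ∈ Ioc 0 (D / r), (if r * k ∣ r * t then
        (ArithmeticFunction.moebius (r * k) : ℝ) else 0) =
        ∑ k ∈ t.divisors, (ArithmeticFunction.moebius r : ℝ) * ArithmeticFunction.moebius k := by
      rw [← Finset.sum_filter]
      apply Finset.sum_congr
      · ext k
        simp only [mem_filter, mem_Ioc, Nat.mem_divisors, Nat.mul_dvd_mul_iff_left hr0]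
        constructor
        · rintro ⟨_, h⟩; exact ⟨h, ht0⟩
        · rintro ⟨h, _⟩
          refine ⟨⟨Nat.pos_of_dvd_of_pos h (Nat.pos_of_ne_zero ht0), ?_⟩, h⟩
          rw [Nat.le_div_iff_mul_le hr0]
          have := Nat.le_of_dvd (Nat.pos_of_ne_zero ht0) h
          nlinarith
      · intro k hk
        have hk' := Nat.dvd_of_mem_divisors hk
        have hc : Nat.Coprime r k :=
          Nat.Coprime.of_dvd_right hk' (Nat.coprime_of_squarefree_mul hs)
        rw [ArithmeticFunction.isMultiplicative_moebius.map_mul_of_coprime hc]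
        push_cast; ring
    rw [e1, ← Finset.mul_sum]
    have h2 := congrArg (fun f => f t) ArithmeticFunction.moebius_mul_coe_zeta
    rw [ArithmeticFunction.coe_mul_zeta_apply, ArithmeticFunction.one_apply] at h2
    have h3 := congrArg (fun z : ℤ => (z : ℝ)) h2
    push_cast at h3
    rw [h3]
    by_cases ht : t = 1
    · simp [ht]
    · rw [if_neg ht, if_neg, mul_zero]
      intro h; apply ht
      have : r * 1 = r * t := by rw [mul_one]; exact h
      exact (Nat.eq_of_mul_eq_mul_left hr0 this).symm
  · rw [if_neg (by rintro rfl; exact hrs dvd_rfl)]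
    apply Finset.sum_eq_zero
    intro d _
    by_cases h1 : r ∣ d
    · by_cases h2 : d ∣ s
      · exact absurd (h1.trans h2) hrs
      · simp [h2]
    · simp [h1]

lemma inner_diag (m D : ℕ) (y : ℕ → ℝ) (r : ℕ) :
    ∑ d ∈ Icc 1 D, (if r ∣ d then (ArithmeticFunction.moebius d : ℝ) * Ysum m D y d else 0) =
      if r ∈ supp m D then (ArithmeticFunction.moebius r : ℝ) * (y r / r.totient) else 0 := by
  have h1 : ∀ d, (if r ∣ d then (ArithmeticFunction.moebius d : ℝ) * Ysum m D y d else 0) =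
      ∑ s ∈ supp m D, (y s / s.totient) *
        (if r ∣ d then (if d ∣ s then (ArithmeticFunction.moebius d : ℝ) else 0) else 0) := by
    intro d
    split_ifs with h
    · unfold Ysum
      rw [Finset.mul_sum]
      refine Finset.sum_congr rfl fun s _ => ?_
      split_ifs <;> ring
    · simp
  simp_rw [h1]
  rw [Finset.sum_comm]
  have h2 : ∀ s ∈ supp m D, ∑ d ∈ Icc 1 D, (y s / s.totient) *
        (if r ∣ d then (if d ∣ s then (ArithmeticFunction.moebius d : ℝ) else 0) else 0) =
      if r = s then (ArithmeticFunction.moebius r : ℝ) * (y r / r.totient) else 0 := by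
    intro s hs
    rw [mem_supp] at hs
    rw [← Finset.mul_sum, moebius_interval D r s hs.2.1 hs.1.2]
    split_ifs with h
    · subst h; ring
    · ring
  rw [Finset.sum_congr rfl h2, Finset.sum_ite_eq]

lemma selberg_diag (m D : ℕ) (y : ℕ → ℝ) :
    ∑ d ∈ Icc 1 D, ∑ e ∈ Icc 1 D, lamS m D y d * lamS m D y e / (Nat.lcm d e : ℝ) =
      ∑ r ∈ supp m D, y r ^ 2 / r.totient := by
  set w : ℕ → ℝ := fun d => ArithmeticFunction.moebius d * Ysum m D y d with hw
  have h1 : ∀ d ∈ Icc 1 D, ∀ e ∈ Icc 1 D, lamS m D y d * lamS m D y e / (Nat.lcm d e : ℝ) =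
      ∑ r ∈ Icc 1 D, (r.totient : ℝ) * ((if r ∣ d then w d else 0) * (if r ∣ e then w e else 0)) := by
    intro d hd e he
    rw [mem_Icc] at hd he
    have hd0 : (d : ℝ) ≠ 0 := by exact_mod_cast (by omega : d ≠ 0)
    have he0 : (e : ℝ) ≠ 0 := by exact_mod_cast (by omega : e ≠ 0)
    have hg : Nat.gcd d e ≠ 0 := Nat.gcd_ne_zero_left (by omega)
    have hl : (Nat.lcm d e : ℝ) ≠ 0 := by
      exact_mod_cast (Nat.lcm_pos (by omega) (by omega)).ne'
    have e1 : (Nat.gcd d e : ℝ) * Nat.lcm d e = d * e := by exact_mod_cast Nat.gcd_mul_lcm d e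
    have e2 : ∑ r ∈ Icc 1 D, (r.totient : ℝ) * ((if r ∣ d then w d else 0) *
        (if r ∣ e then w e else 0)) = (Nat.gcd d e : ℝ) * (w d * w e) := by
      have : (Nat.gcd d e : ℝ) = ∑ r ∈ (Nat.gcd d e).divisors, (r.totient : ℝ) := by
        exact_mod_cast (Nat.sum_totient (Nat.gcd d e)).symm
      rw [this, Finset.sum_mul]
      have hsub : (Nat.gcd d e).divisors ⊆ Icc 1 D := by
        intro r hr
        rw [mem_Icc]
        refine ⟨Nat.pos_of_mem_divisors hr, ?_⟩
        exact (Nat.le_of_dvd (by omega)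
          ((Nat.dvd_of_mem_divisors hr).trans (Nat.gcd_dvd_left d e))).trans hd.2
      rw [← Finset.sum_subset hsub]
      · refine Finset.sum_congr rfl fun r hr => ?_
        have hr' := Nat.dvd_of_mem_divisors hr
        rw [if_pos (hr'.trans (Nat.gcd_dvd_left _ _)), if_pos (hr'.trans (Nat.gcd_dvd_right _ _))]
      · intro r _ hr
        by_cases h1 : r ∣ d
        · by_cases h2 : r ∣ e
          · exact absurd (Nat.mem_divisors.mpr ⟨Nat.dvd_gcd h1 h2, hg⟩) hr
          · simp [h2]
        · simp [h1]
    rw [e2, div_eq_iff hl]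
    unfold lamS
    rw [hw]
    linear_combination (-(ArithmeticFunction.moebius d : ℝ) * Ysum m D y d *
      (ArithmeticFunction.moebius e * Ysum m D y e)) * e1
  rw [Finset.sum_congr rfl fun d hd => Finset.sum_congr rfl fun e he => h1 d hd e he]
  have h2 : ∑ d ∈ Icc 1 D, ∑ e ∈ Icc 1 D, ∑ r ∈ Icc 1 D, (r.totient : ℝ) *
      ((if r ∣ d then w d else 0) * (if r ∣ e then w e else 0)) =
      ∑ r ∈ Icc 1 D, (r.totient : ℝ) * (∑ d ∈ Icc 1 D, if r ∣ d then w d else 0) ^ 2 := by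
    simp_rw [pow_two, Finset.sum_mul_sum, Finset.mul_sum]
    rw [Finset.sum_congr rfl fun d _ => Finset.sum_comm]
    rw [Finset.sum_comm]
  rw [h2]
  have h3 : supp m D ⊆ Icc 1 D := Finset.filter_subset _ _
  rw [← Finset.sum_subset h3]
  · refine Finset.sum_congr rfl fun r hr => ?_
    rw [inner_diag, if_pos hr]
    rw [mem_supp] at hr
    have hmu : (ArithmeticFunction.moebius r : ℝ) ^ 2 = 1 := by
      exact_mod_cast ArithmeticFunction.moebius_sq_eq_one_of_squarefree hr.2.1
    have ht : (r.totient : ℝ) ≠ 0 := by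
      exact_mod_cast (Nat.totient_pos.mpr (by omega)).ne'
    rw [mul_pow, hmu]; field_simp
  · intro r _ hr
    rw [inner_diag, if_neg hr]; ring

lemma lamS_bound (m D : ℕ) (y : ℕ → ℝ) (Y0 Tm : ℝ) (hy : ∀ r, |y r| ≤ Y0)
    (hT : ∀ r, 1 ≤ r → r ≤ D → tau r ≤ Tm) (hT0 : 0 ≤ Tm) (d : ℕ) (hd : 1 ≤ d) :
    |lamS m D y d| ≤ Y0 * Tm * (1 + Real.log D) := by
  have hY0 : 0 ≤ Y0 := (abs_nonneg _).trans (hy 0)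
  have hd' : (0 : ℝ) < d := by exact_mod_cast hd
  have h1 : |Ysum m D y d| ≤ ∑ r ∈ Ioc 0 D, (if d ∣ r then Y0 * Tm * (1 / (r : ℝ)) else 0) := by
    unfold Ysum
    refine (Finset.abs_sum_le_sum_abs _ _).trans ?_
    have hsub : supp m D ⊆ Ioc 0 D := by
      intro r hr; rw [mem_supp] at hr; rw [mem_Ioc]; omega
    refine le_trans (Finset.sum_le_sum fun r hr => ?_)
      (Finset.sum_le_sum_of_subset_of_nonneg hsub
      (fun r _ _ => by split_ifs <;> positivity))
    rw [mem_supp] at hr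
    split_ifs with h
    · have hr0 : (0 : ℝ) < r := by exact_mod_cast hr.1.1
      have ht : (0 : ℝ) < r.totient := by
        exact_mod_cast (Nat.totient_pos.mpr (by omega))
      rw [abs_div, abs_of_pos ht, mul_assoc]
      have hle := le_totient_mul_tau r (by omega)
      have : 1 / (r.totient : ℝ) ≤ Tm * (1 / r) := by
        rw [mul_one_div, div_le_div_iff₀ ht hr0, one_mul]
        have := hT r hr.1.1 hr.1.2
        nlinarith
      rw [div_eq_mul_one_div]
      exact mul_le_mul (hy r) this (by positivity) hY0
    · simp
  rw [sum_dvd_ite d D hd] at h1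
  have h2 : ∑ k ∈ Ioc 0 (D / d), Y0 * Tm * (1 / ((d * k : ℕ) : ℝ)) ≤
      Y0 * Tm * (1 / d) * (1 + Real.log D) := by
    have : ∀ k ∈ Ioc 0 (D / d), Y0 * Tm * (1 / ((d * k : ℕ) : ℝ)) = Y0 * Tm * (1 / d) * (1 / k) := by
      intro k _; push_cast; rw [← one_div_mul_one_div]; ring
    rw [Finset.sum_congr rfl this, ← Finset.mul_sum]
    apply mul_le_mul_of_nonneg_left _ (by positivity)
    have hh := harmonic_le_one_add_log D
    rw [harmonic_eq_sum_Icc] at hh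
    push_cast at hh
    refine le_trans ?_ hh
    simp_rw [one_div]
    apply Finset.sum_le_sum_of_subset_of_nonneg
    · intro k hk; rw [mem_Ioc] at hk; rw [mem_Icc]
      exact ⟨hk.1, hk.2.trans (Nat.div_le_self _ _)⟩
    · intros; positivity
  have h3 : |(ArithmeticFunction.moebius d : ℝ)| ≤ 1 := by
    exact_mod_cast ArithmeticFunction.abs_moebius_le_one (n := d)
  unfold lamS
  rw [abs_mul, abs_mul, abs_of_pos hd']
  calc _ ≤ 1 * d * (Y0 * Tm * (1 / d) * (1 + Real.log D)) := by
        apply mul_le_mul _ (h1.trans h2) (abs_nonneg _) (by positivity)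
        gcongr
    _ = _ := by field_simp

end S17

namespace S17
open Finset

noncomputable def invHom : ℕ →* ℝ where
  toFun n := (n : ℝ)⁻¹
  map_one' := by simp
  map_mul' a b := by push_cast; rw [mul_inv]

noncomputable def invSqrtHom : ℕ →* ℝ where
  toFun n := (Real.sqrt n)⁻¹
  map_one' := by simp
  map_mul' a b := by push_cast; rw [Real.sqrt_mul (by positivity), mul_inv]

lemma tau_ge_two_pow (r : ℕ) (hr : r ≠ 0) : (2 : ℝ) ^ r.primeFactors.card ≤ tau r := by
  unfold tau
  rw [Nat.card_divisors hr]
  push_cast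
  rw [← Finset.prod_const]
  apply Finset.prod_le_prod (fun _ _ => by norm_num)
  intro p hp
  have : 1 ≤ r.factorization p := by
    have hp' := Nat.prime_of_mem_primeFactors hp
    exact hp'.factorization_pos_of_dvd hr (Nat.dvd_of_mem_primeFactors hp)
  have : (1 : ℝ) ≤ r.factorization p := by exact_mod_cast this
  linarith

lemma hasSum_inv (r : ℕ) (hr : r ≠ 0) :
    HasSum (fun l : Nat.factoredNumbers r.primeFactors => ((l : ℕ) : ℝ)⁻¹)
      ((r : ℝ) / r.totient) := by
  have h := (EulerProduct.summable_and_hasSum_factoredNumbers_prod_filter_prime_geometric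
    (f := invHom) (fun {p} hp => by
      show ‖(p : ℝ)⁻¹‖ < 1
      rw [norm_inv, Real.norm_natCast]
      exact inv_lt_one_of_one_lt₀ (by exact_mod_cast hp.one_lt)) r.primeFactors).2
  suffices key : ((r : ℝ) / r.totient) =
      ∏ p ∈ r.primeFactors with Nat.Prime p, (1 - invHom p)⁻¹ by
    rw [key]; exact h
  have hp : r.primeFactors.filter Nat.Prime = r.primeFactors :=
    Finset.filter_true_of_mem fun p hp => Nat.prime_of_mem_primeFactors hp
  rw [hp]
  have ht := Nat.totient_eq_mul_prod_factors r
  have ht' : (r.totient : ℝ) = r * ∏ p ∈ r.primeFactors, (1 - (p : ℝ)⁻¹) := by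
    have := congrArg (fun z : ℚ => (z : ℝ)) ht
    push_cast at this
    exact this
  rw [ht', Finset.prod_inv_distrib]
  have hr' : (r : ℝ) ≠ 0 := by exact_mod_cast hr
  have e : ∀ p, invHom p = (p : ℝ)⁻¹ := fun _ => rfl
  simp_rw [e]
  have hpr : ∏ p ∈ r.primeFactors, (1 - (p : ℝ)⁻¹) ≠ 0 := by
    rw [Finset.prod_ne_zero_iff]
    intro p hp
    have h1 : (1 : ℝ) < p := by exact_mod_cast (Nat.prime_of_mem_primeFactors hp).one_lt
    have := inv_lt_one_of_one_lt₀ h1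
    linarith
  field_simp

lemma sum_invSqrt_le (r : ℕ) (hr : r ≠ 0) (F : Finset (Nat.factoredNumbers r.primeFactors)) :
    ∑ l ∈ F, (Real.sqrt ((l : ℕ) : ℝ))⁻¹ ≤ tau r ^ 2 := by
  have hlt : ∀ {p : ℕ}, p.Prime → (Real.sqrt p)⁻¹ ≤ 3 / 4 := by
    intro p hp
    have h2 : (2 : ℝ) ≤ p := by exact_mod_cast hp.two_le
    have : (4 / 3 : ℝ) ≤ Real.sqrt p := by
      apply Real.le_sqrt_of_sq_le; norm_num; linarith
    calc (Real.sqrt p)⁻¹ ≤ (4 / 3 : ℝ)⁻¹ := by gcongr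
      _ = 3 / 4 := by norm_num
  have h := (EulerProduct.summable_and_hasSum_factoredNumbers_prod_filter_prime_geometric
    (f := invSqrtHom) (fun {p} hp => by
      show ‖(Real.sqrt p)⁻¹‖ < 1
      rw [Real.norm_of_nonneg (by positivity)]
      linarith [hlt hp]) r.primeFactors).2
  have h1 := sum_le_hasSum F (fun l _ => by
    show 0 ≤ (Real.sqrt ((l : ℕ) : ℝ))⁻¹; positivity) h
  refine h1.trans ?_
  calc _ ≤ ∏ p ∈ r.primeFactors, (4 : ℝ) := by
        have hp : r.primeFactors.filter Nat.Prime = r.primeFactors :=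
          Finset.filter_true_of_mem fun p hp => Nat.prime_of_mem_primeFactors hp
        rw [hp]
        apply Finset.prod_le_prod
        · intro p hp
          have := hlt (Nat.prime_of_mem_primeFactors hp)
          show 0 ≤ (1 - (Real.sqrt p)⁻¹)⁻¹
          apply inv_nonneg.mpr; linarith
        · intro p hp
          have := hlt (Nat.prime_of_mem_primeFactors hp)
          show (1 - (Real.sqrt p)⁻¹)⁻¹ ≤ 4
          rw [inv_le_comm₀ (by linarith) (by norm_num)]
          linarith
    _ = (2 ^ r.primeFactors.card) ^ 2 := by
        rw [Finset.prod_const, ← pow_mul, mul_comm, pow_mul]; norm_num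
    _ ≤ _ := by gcongr; exact tau_ge_two_pow r hr

lemma facsum_le (r : ℕ) (hr : r ≠ 0) (F : Finset ℕ)
    (hF : ∀ l ∈ F, l ∈ Nat.factoredNumbers r.primeFactors) :
    ∑ l ∈ F, (1 : ℝ) / l ≤ (r : ℝ) / r.totient := by
  have := sum_le_hasSum (F.attach.map ⟨fun l => (⟨l.1, hF l.1 l.2⟩ :
    Nat.factoredNumbers r.primeFactors), by
      intro a b h
      simp only [Subtype.mk.injEq] at h
      exact Subtype.ext h⟩) (fun l _ => by positivity) (hasSum_inv r hr)
  rw [Finset.sum_map] at this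
  have h2 : ∑ x ∈ F.attach, ((x : ℕ) : ℝ)⁻¹ ≤ (r : ℝ) / r.totient := this
  rw [Finset.sum_attach F (fun l => (l : ℝ)⁻¹)] at h2
  simpa using h2

open Classical in
lemma facsum_ge (r : ℕ) (hr : r ≠ 0) (z : ℕ) (hz : 1 ≤ z) :
    (r : ℝ) / r.totient ≤ ∑ l ∈ (Ioc 0 z).filter
      (fun l => l ∈ Nat.factoredNumbers r.primeFactors), (1 : ℝ) / l + tau r ^ 2 / Real.sqrt z := by
  refine hasSum_le_of_sum_le (hasSum_inv r hr) fun F => ?_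
  have hz' : (0 : ℝ) < Real.sqrt z := Real.sqrt_pos.mpr (by exact_mod_cast hz)
  have h1 : ∑ l ∈ F, ((l : ℕ) : ℝ)⁻¹ ≤ ∑ l ∈ F, ((if (l : ℕ) ≤ z then ((l : ℕ) : ℝ)⁻¹ else 0) +
      (Real.sqrt ((l : ℕ) : ℝ))⁻¹ / Real.sqrt z) := by
    refine Finset.sum_le_sum fun l _ => ?_
    split_ifs with h
    · have : 0 ≤ (Real.sqrt ((l : ℕ) : ℝ))⁻¹ / Real.sqrt z := by positivity
      linarith
    · push Not at h
      have hl : (0 : ℝ) < ((l : ℕ) : ℝ) := by exact_mod_cast (by omega)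
      have hs : Real.sqrt z ≤ Real.sqrt ((l : ℕ) : ℝ) := Real.sqrt_le_sqrt (by exact_mod_cast h.le)
      rw [zero_add, div_eq_mul_inv]
      have : ((l : ℕ) : ℝ)⁻¹ = (Real.sqrt ((l : ℕ) : ℝ))⁻¹ * (Real.sqrt ((l : ℕ) : ℝ))⁻¹ := by
        rw [← mul_inv, Real.mul_self_sqrt hl.le]
      rw [this]
      gcongr
  refine h1.trans ?_
  rw [Finset.sum_add_distrib]
  apply add_le_add
  · rw [← Finset.sum_filter]
    have e : ∑ l ∈ F.filter (fun l : Nat.factoredNumbers r.primeFactors => (l : ℕ) ≤ z), ((l : ℕ) : ℝ)⁻¹ =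
        ∑ l ∈ (F.filter (fun l : Nat.factoredNumbers r.primeFactors => (l : ℕ) ≤ z)).map (Function.Embedding.subtype _), (1 : ℝ) / l := by
      rw [Finset.sum_map]; simp
    rw [e]
    apply Finset.sum_le_sum_of_subset_of_nonneg
    · intro l hl
      simp only [mem_map, mem_filter, Function.Embedding.coe_subtype] at hl
      obtain ⟨l', ⟨_, hl2⟩, rfl⟩ := hl
      simp only [mem_filter, mem_Ioc]
      refine ⟨⟨Nat.pos_of_ne_zero (Nat.ne_zero_of_mem_factoredNumbers l'.2), hl2⟩, l'.2⟩
    · intros; positivity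
  · rw [← Finset.sum_div]
    gcongr
    exact sum_invSqrt_le r hr F

end S17

namespace S17
open Finset

noncomputable def Uf (m x : ℕ) : ℝ := ∑ n ∈ (Ioc 0 x).filter (fun n => Nat.Coprime n m), (1 : ℝ) / n
noncomputable def Gf (m x : ℕ) : ℝ := ∑ r ∈ supp m x, (1 : ℝ) / r.totient

lemma log_succ_sub_le (n : ℕ) (hn : 1 ≤ n) :
    Real.log ((n : ℝ) + 1) - Real.log n ≤ 1 / n := by
  have h0 : (0 : ℝ) < n := by exact_mod_cast hn
  rw [← Real.log_div (by positivity) (by positivity)]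
  have := Real.log_le_sub_one_of_pos (x := ((n : ℝ) + 1) / n) (by positivity)
  have e : ((n : ℝ) + 1) / n - 1 = 1 / n := by field_simp; ring
  linarith

lemma le_log_succ_sub (n : ℕ) (hn : 1 ≤ n) :
    1 / ((n : ℝ) + 1) ≤ Real.log ((n : ℝ) + 1) - Real.log n := by
  have h0 : (0 : ℝ) < n := by exact_mod_cast hn
  have := Real.log_le_sub_one_of_pos (x := (n : ℝ) / (n + 1)) (by positivity)
  rw [Real.log_div (by positivity) (by positivity)] at this
  have e : (n : ℝ) / (n + 1) - 1 = - (1 / ((n : ℝ) + 1)) := by field_simp; ring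
  linarith

lemma harm_window (a b : ℕ) (ha : 1 ≤ a) (hab : a ≤ b) :
    Real.log b - Real.log a - 1 / a ≤ ∑ n ∈ Ioc a b, (1 : ℝ) / n ∧
    ∑ n ∈ Ioc a b, (1 : ℝ) / n ≤ Real.log b - Real.log a := by
  have key : Real.log ((b : ℝ) + 1) - Real.log ((a : ℝ) + 1) ≤ ∑ n ∈ Ioc a b, (1 : ℝ) / n ∧
    ∑ n ∈ Ioc a b, (1 : ℝ) / n ≤ Real.log b - Real.log a := by
    induction b, hab using Nat.le_induction with
    | base => simp
    | succ n hn ih =>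
      rw [← Finset.insert_Ioc_right_eq_Ioc_add_one hn, Finset.sum_insert (by simp)]
      have h1 := log_succ_sub_le (n + 1) (by omega)
      have h2 := le_log_succ_sub n (by omega)
      push_cast at *
      constructor <;> linarith [ih.1, ih.2]
  refine ⟨?_, key.2⟩
  have h1 := log_succ_sub_le a ha
  have h2 : Real.log b ≤ Real.log ((b : ℝ) + 1) :=
    Real.log_le_log (by exact_mod_cast (by omega)) (by linarith)
  linarith [key.1]

lemma harm_le (x : ℕ) : ∑ n ∈ Ioc 0 x, (1 : ℝ) / n ≤ 1 + Real.log x := by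
  rcases Nat.eq_zero_or_pos x with rfl | hx
  · simp
  have e : Ioc 0 x = insert 1 (Ioc 1 x) := by ext; simp; omega
  rw [e, Finset.sum_insert (by simp)]
  have := (harm_window 1 x le_rfl hx).2
  simp at this ⊢
  linarith

lemma Gf_nonneg (m x : ℕ) : 0 ≤ Gf m x := Finset.sum_nonneg fun _ _ => by positivity
lemma Uf_nonneg (m x : ℕ) : 0 ≤ Uf m x := Finset.sum_nonneg fun _ _ => by positivity

lemma Uf_le (m x : ℕ) : Uf m x ≤ 1 + Real.log x :=
  le_trans (Finset.sum_le_sum_of_subset_of_nonneg (Finset.filter_subset _ _)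
    (fun _ _ _ => by positivity)) (harm_le x)

lemma Uf_le_Gf (m x : ℕ) : Uf m x ≤ Gf m x := by
  unfold Uf Gf
  have hmap : ∀ n ∈ (Ioc 0 x).filter (fun n => Nat.Coprime n m),
      UniqueFactorizationMonoid.radical n ∈ supp m x := by
    intro n hn
    simp only [mem_filter, mem_Ioc] at hn
    have hd : UniqueFactorizationMonoid.radical n ∣ n := UniqueFactorizationMonoid.radical_dvd_self
    rw [mem_supp]
    refine ⟨⟨Nat.radical_pos n, (Nat.le_of_dvd hn.1.1 hd).trans hn.1.2⟩,
      UniqueFactorizationMonoid.squarefree_radical, Nat.Coprime.of_dvd_left hd hn.2⟩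
  rw [← Finset.sum_fiberwise_of_maps_to hmap]
  refine Finset.sum_le_sum fun r hr => ?_
  obtain ⟨⟨hr1, hr2⟩, hr3, hr4⟩ := mem_supp.mp hr
  set S := ((Ioc 0 x).filter (fun n => Nat.Coprime n m)).filter
    (fun n => UniqueFactorizationMonoid.radical n = r) with hS
  have hdiv : ∀ n ∈ S, r * (n / r) = n := by
    intro n hn
    have h2 := (Finset.mem_filter.mp hn).2
    exact Nat.mul_div_cancel' (h2 ▸ UniqueFactorizationMonoid.radical_dvd_self)
  have hinj : Set.InjOn (fun n => n / r) S := by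
    intro a ha b hb hab
    rw [← hdiv a ha, ← hdiv b hb]
    simp only at hab
    rw [hab]
  have hr0 : (0 : ℝ) < r := by exact_mod_cast hr1
  have h1 : ∑ n ∈ S, (1 : ℝ) / n = (1 / r) * ∑ l ∈ S.image (fun n => n / r), (1 : ℝ) / l := by
    rw [Finset.sum_image hinj, Finset.mul_sum]
    refine Finset.sum_congr rfl fun n hn => ?_
    conv_lhs => rw [← hdiv n hn]
    push_cast
    rw [one_div_mul_one_div]
  rw [h1]
  have h2 := facsum_le r (by omega) (S.image (fun n => n / r)) (by
    intro l hl
    obtain ⟨n, hn, rfl⟩ := Finset.mem_image.mp hl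
    have hn0 : n ≠ 0 := by
      have := (Finset.mem_filter.mp (Finset.mem_filter.mp hn).1).1
      simp at this; omega
    have hnr : n / r ≠ 0 := by
      intro h
      have := hdiv n hn
      rw [h] at this; simp at this; omega
    apply Nat.mem_factoredNumbers_of_primeFactors_subset hnr
    have h3 := (Finset.mem_filter.mp hn).2
    rw [← h3, Nat.primeFactors_radical, h3]
    exact Nat.primeFactors_mono (Nat.div_dvd_of_dvd ⟨_, (hdiv n hn).symm⟩) hn0)
  calc _ ≤ (1 / (r : ℝ)) * ((r : ℝ) / r.totient) := by gcongr
    _ = _ := by field_simp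

lemma Gf_le_Uf (m x z : ℕ) (hz : 1 ≤ z) (C : ℝ) (hC : ∀ r, 1 ≤ r → r ≤ x → tau r ≤ C) :
    Gf m x ≤ Uf m (x * z) + C ^ 2 * (1 + Real.log x) / Real.sqrt z := by
  classical
  unfold Gf
  have h1 : ∀ r ∈ supp m x, (1 : ℝ) / r.totient ≤
      ∑ l ∈ (Ioc 0 z).filter (fun l => l ∈ Nat.factoredNumbers r.primeFactors),
        (1 : ℝ) / ((r * l : ℕ) : ℝ) + C ^ 2 / Real.sqrt z * (1 / r) := by
    intro r hr
    obtain ⟨⟨hr1, hr2⟩, hr3, hr4⟩ := mem_supp.mp hr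
    have hr0 : (0 : ℝ) < r := by exact_mod_cast hr1
    have h := facsum_ge r (by omega) z hz
    have e : (1 : ℝ) / r.totient = (1 / r) * ((r : ℝ) / r.totient) := by field_simp
    rw [e]
    calc _ ≤ (1 / (r : ℝ)) * (∑ l ∈ (Ioc 0 z).filter
          (fun l => l ∈ Nat.factoredNumbers r.primeFactors), (1 : ℝ) / l
          + C ^ 2 / Real.sqrt z) := by
            gcongr
            refine h.trans ?_
            gcongr
            · exact tau_nonneg r
            · exact hC r hr1 hr2
      _ = _ := by
        rw [mul_add, Finset.mul_sum]
        congr 1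
        · refine Finset.sum_congr rfl fun l _ => ?_
          push_cast; rw [one_div_mul_one_div]
        · ring
  refine (Finset.sum_le_sum h1).trans ?_
  rw [Finset.sum_add_distrib]
  apply add_le_add
  · rw [Finset.sum_sigma']
    have hrad : ∀ s ∈ (supp m x).sigma (fun r => (Ioc 0 z).filter
        (fun l => l ∈ Nat.factoredNumbers r.primeFactors)),
        UniqueFactorizationMonoid.radical (s.1 * s.2) = s.1 := by
      rintro ⟨r, l⟩ hs
      simp only [mem_sigma, mem_supp, mem_filter, mem_Ioc] at hs
      obtain ⟨⟨⟨hr1, hr2⟩, hr3, hr4⟩, hl, hl2⟩ := hs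
      show UniqueFactorizationMonoid.radical (r * l) = r
      rw [Nat.radical_eq_prod_primeFactors, Nat.primeFactors_mul (by omega) (by omega),
        Finset.union_eq_left.mpr (Nat.primeFactors_subset_of_mem_factoredNumbers hl2),
        Nat.prod_primeFactors_of_squarefree hr3]
    have hinj : Set.InjOn (fun s : (_ : ℕ) × ℕ => s.1 * s.2) ((supp m x).sigma
        (fun r => (Ioc 0 z).filter (fun l => l ∈ Nat.factoredNumbers r.primeFactors))) := by
      rintro ⟨r, l⟩ h ⟨r', l'⟩ h' e
      have e1 := hrad _ h
      have e2 := hrad _ h'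
      simp only at e e1 e2
      rw [e, e2] at e1
      subst e1
      have h0 : 0 < r' := by
        have := Finset.mem_coe.mp h
        simp only [mem_sigma, mem_supp] at this
        omega
      have := Nat.eq_of_mul_eq_mul_left h0 e
      subst this; rfl
    rw [← Finset.sum_image (g := fun s : (_ : ℕ) × ℕ => s.1 * s.2)
      (f := fun n : ℕ => (1 : ℝ) / n) hinj]
    unfold Uf
    apply Finset.sum_le_sum_of_subset_of_nonneg
    · intro n hn
      obtain ⟨⟨r, l⟩, hs, rfl⟩ := Finset.mem_image.mp hn
      simp only [mem_sigma, mem_supp, mem_filter, mem_Ioc] at hs ⊢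
      obtain ⟨⟨⟨hr1, hr2⟩, hr3, hr4⟩, hl, hl2⟩ := hs
      refine ⟨⟨Nat.mul_pos hr1 hl.1, Nat.mul_le_mul hr2 hl.2⟩, ?_⟩
      apply Nat.Coprime.mul_left hr4
      apply Nat.Coprime.symm
      apply Nat.coprime_of_dvd
      intro k hk hk1 hk2
      have := Nat.primeFactors_subset_of_mem_factoredNumbers hl2
        (Nat.mem_primeFactors.mpr ⟨hk, hk2, by omega⟩)
      have hkr := Nat.dvd_of_mem_primeFactors this
      have := Nat.dvd_gcd hkr hk1
      rw [hr4] at this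
      exact hk.one_lt.ne' (Nat.dvd_one.mp this)
    · intros; positivity
  · rw [← Finset.mul_sum]
    have : ∑ i ∈ supp m x, (1 : ℝ) / i ≤ 1 + Real.log x := by
      refine le_trans (Finset.sum_le_sum_of_subset_of_nonneg ?_ (fun _ _ _ => by positivity))
        (harm_le x)
      intro r hr
      have := mem_supp.mp hr
      simp; omega
    calc _ ≤ C ^ 2 / Real.sqrt z * (1 + Real.log x) := by gcongr
      _ = _ := by ring

lemma Uf_upper (m x z : ℕ) (hm : m ≠ 0) (hz : 1 ≤ z) :
    Uf m x * ((m : ℝ) / m.totient) ≤ 1 + Real.log ((x * z : ℕ) : ℝ) +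
      Uf m x * (tau m ^ 2 / Real.sqrt z) := by
  classical
  have h := facsum_ge m hm z hz
  calc _ ≤ Uf m x * (∑ l ∈ (Ioc 0 z).filter
          (fun l => l ∈ Nat.factoredNumbers m.primeFactors), (1 : ℝ) / l
          + tau m ^ 2 / Real.sqrt z) := mul_le_mul_of_nonneg_left h (Uf_nonneg m x)
    _ ≤ _ := by
      rw [mul_add]
      gcongr
      refine le_trans ?_ (harm_le (x * z))
      unfold Uf
      rw [Finset.sum_mul_sum, ← Finset.sum_product']
      have hco : ∀ u : ℕ, Nat.Coprime u m → ∀ l ∈ Nat.factoredNumbers m.primeFactors,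
          Nat.Coprime u l := by
        intro u hu l hl
        apply Nat.coprime_of_dvd
        intro k hk hk1 hk2
        have := Nat.primeFactors_subset_of_mem_factoredNumbers hl
          (Nat.mem_primeFactors.mpr ⟨hk, hk2, Nat.ne_zero_of_mem_factoredNumbers hl⟩)
        have := Nat.dvd_gcd hk1 (Nat.dvd_of_mem_primeFactors this)
        rw [hu] at this
        exact hk.one_lt.ne' (Nat.dvd_one.mp this)
      have hinj : Set.InjOn (fun s : ℕ × ℕ => s.1 * s.2)
          ((((Ioc 0 x).filter (fun n => Nat.Coprime n m)) ×ˢ ((Ioc 0 z).filter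
          (fun l => l ∈ Nat.factoredNumbers m.primeFactors)) : Finset (ℕ × ℕ)) : Set (ℕ × ℕ)) := by
        rintro ⟨u, l⟩ h ⟨u', l'⟩ h' e
        simp only [Finset.coe_product, Set.mem_prod, Finset.mem_coe, mem_filter, mem_Ioc] at h h' e
        have h1 : u ∣ u' := (hco u h.1.2 l' h'.2.2).dvd_of_dvd_mul_right (e ▸ Dvd.intro _ rfl)
        have h2 : u' ∣ u := (hco u' h'.1.2 l h.2.2).dvd_of_dvd_mul_right (e ▸ Dvd.intro _ rfl)
        have h3 := Nat.dvd_antisymm h1 h2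
        subst h3
        have := Nat.eq_of_mul_eq_mul_left h.1.1.1 e
        subst this; rfl
      have e : ∀ s : ℕ × ℕ, (1 : ℝ) / s.1 * (1 / s.2) = 1 / ((s.1 * s.2 : ℕ) : ℝ) := by
        intro s; push_cast; rw [one_div_mul_one_div]
      simp_rw [e]
      rw [← Finset.sum_image (g := fun s : ℕ × ℕ => s.1 * s.2)
        (f := fun n : ℕ => (1 : ℝ) / n) hinj]
      apply Finset.sum_le_sum_of_subset_of_nonneg
      · intro n hn
        obtain ⟨⟨u, l⟩, hs, rfl⟩ := Finset.mem_image.mp hn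
        simp only [mem_product, mem_filter, mem_Ioc] at hs ⊢
        exact ⟨Nat.mul_pos hs.1.1.1 hs.2.1.1, Nat.mul_le_mul hs.1.1.2 hs.2.1.2⟩
      · intros; positivity

lemma Uf_lower (m x x0 : ℕ) (hm : m ≠ 0) (h0 : 1 ≤ x0) (hx : x0 ≤ x) :
    gam m * (Real.log x - Real.log x0 - 1 / x0) - 4 * tau m / x0 ≤ Uf m x := by
  have h := coprime_abel m 1 x0 x hm (by omega) (Nat.coprime_one_left m) h0 hx
  simp only [isUnit_one, IsUnit.dvd, if_true, Nat.cast_one, div_one] at h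
  have h1 := abs_le.mp h
  have h2 : ∑ n ∈ Ioc x0 x, (if Nat.Coprime n m then (1 : ℝ) else 0) / n ≤ Uf m x := by
    unfold Uf
    rw [Finset.sum_filter]
    have e : ∀ n : ℕ, (if Nat.Coprime n m then (1 : ℝ) else 0) / n =
      if Nat.Coprime n m then (1 : ℝ) / n else 0 := by intro n; split_ifs <;> simp
    simp_rw [e]
    apply Finset.sum_le_sum_of_subset_of_nonneg
    · intro n; simp; omega
    · intros; positivity
  have h3 := mul_le_mul_of_nonneg_left (harm_window x0 x h0 hx).1 (gam_pos hm).le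
  linarith [h1.1]

end S17

namespace S17
open Finset Filter

lemma ev_rpow (δ C : ℝ) (hδ : 0 < δ) : ∀ᶠ m : ℕ in atTop, C ≤ (m : ℝ) ^ δ :=
  ((tendsto_rpow_atTop hδ).comp tendsto_natCast_atTop_atTop).eventually_ge_atTop C

lemma ev_log (δ C : ℝ) (hδ : 0 < δ) : ∀ᶠ m : ℕ in atTop, C ≤ δ * Real.log m :=
  ((Real.tendsto_log_atTop.const_mul_atTop hδ).comp
    tendsto_natCast_atTop_atTop).eventually_ge_atTop C

lemma ev_log_rpow (δ C : ℝ) (hδ : 0 < δ) :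
    ∀ᶠ m : ℕ in atTop, C * (1 + Real.log m) ≤ (m : ℝ) ^ δ := by
  have h := (isLittleO_log_rpow_atTop (half_pos hδ)).comp_tendsto
    (tendsto_natCast_atTop_atTop (R := ℝ))
  have h1 := h.bound (show (0 : ℝ) < 1 by norm_num)
  filter_upwards [h1, ev_rpow (δ / 2) (2 * |C|) (half_pos hδ), ev_rpow (δ / 2) 1 (half_pos hδ),
    eventually_ge_atTop 1] with m h1 h2 h3 h4
  have hm : (0 : ℝ) < m := by exact_mod_cast h4
  simp only [Function.comp, Real.norm_eq_abs, one_mul] at h1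
  have e : (m : ℝ) ^ δ = (m : ℝ) ^ (δ / 2) * (m : ℝ) ^ (δ / 2) := by
    rw [← Real.rpow_add hm]; ring_nf
  rw [e]
  have hp : 0 ≤ (m : ℝ) ^ (δ / 2) := by positivity
  rw [abs_of_nonneg hp] at h1
  have h5 := le_abs_self (Real.log m)
  have h6 : 0 ≤ Real.log m := Real.log_natCast_nonneg m
  calc C * (1 + Real.log m) ≤ |C| * (1 + Real.log m) := by gcongr; exact le_abs_self C
    _ ≤ |C| * ((m : ℝ) ^ (δ / 2) + (m : ℝ) ^ (δ / 2)) := by gcongr; linarith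
    _ = (2 * |C|) * (m : ℝ) ^ (δ / 2) := by ring
    _ ≤ _ := by gcongr

lemma ev_tau (δ : ℝ) (hδ : 0 < δ) :
    ∀ᶠ m : ℕ in atTop, ∀ n : ℕ, 1 ≤ n → n ≤ m ^ 4 → tau n ≤ (m : ℝ) ^ δ := by
  obtain ⟨C, hC1, hC⟩ := divisor_bound (δ / 8) (by positivity)
  filter_upwards [ev_rpow (δ / 2) C (half_pos hδ), eventually_ge_atTop 1] with m h1 h4 n hn hnm
  have hm : (0 : ℝ) < m := by exact_mod_cast h4
  refine (hC n (by omega)).trans ?_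
  have e : (m : ℝ) ^ δ = (m : ℝ) ^ (δ / 2) * (m : ℝ) ^ (δ / 2) := by
    rw [← Real.rpow_add hm]; ring_nf
  rw [e]
  have h5 : (n : ℝ) ^ (δ / 8) ≤ (m : ℝ) ^ (δ / 2) := by
    calc (n : ℝ) ^ (δ / 8) ≤ ((m : ℝ) ^ 4) ^ (δ / 8) := by
          gcongr; exact_mod_cast hnm
      _ = _ := by
        rw [← Real.rpow_natCast, ← Real.rpow_mul hm.le]; congr 1; push_cast; ring
  gcongr

lemma inv_tau_le_gam (m : ℕ) (hm : m ≠ 0) : 1 ≤ gam m * tau m := by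
  have := le_totient_mul_tau m hm
  unfold gam
  have h0 : (0 : ℝ) < m := by exact_mod_cast Nat.pos_of_ne_zero hm
  rw [div_mul_eq_mul_div, le_div_iff₀ h0]; linarith

lemma ceil_pow_bounds (A : ℝ) (hA : 1 ≤ A) (k : ℕ) :
    1 ≤ ⌈A ^ k⌉₊ ∧ A ^ k ≤ (⌈A ^ k⌉₊ : ℝ) ∧ (⌈A ^ k⌉₊ : ℝ) ≤ 2 * A ^ k ∧
    Real.log (⌈A ^ k⌉₊ : ℝ) ≤ 1 + k * Real.log A := by
  have h1 : 1 ≤ A ^ k := one_le_pow₀ hA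
  have h2 := Nat.le_ceil (A ^ k)
  have h3 := Nat.ceil_lt_add_one (a := A ^ k) (by linarith)
  have h4 : 1 ≤ ⌈A ^ k⌉₊ := Nat.one_le_ceil_iff.mpr (by linarith)
  refine ⟨h4, h2, by linarith, ?_⟩
  calc Real.log (⌈A ^ k⌉₊ : ℝ) ≤ Real.log (2 * A ^ k) :=
        Real.log_le_log (by exact_mod_cast h4) (by linarith)
    _ = Real.log 2 + k * Real.log A := by
      rw [Real.log_mul (by norm_num) (by positivity), Real.log_pow]
    _ ≤ _ := by have := Real.log_two_lt_d9; linarith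

lemma Gf_asymp (η : ℝ) (hη : 0 < η) : ∀ᶠ m : ℕ in atTop, ∀ x : ℕ, 1 ≤ x → x ≤ m →
    |Gf m x - gam m * Real.log x| ≤ η * (gam m * Real.log m) := by
  wlog hη1 : η ≤ 1 generalizing η
  · filter_upwards [this 1 (by norm_num) le_rfl, eventually_ge_atTop 1] with m h hm x h1 h2
    refine (h x h1 h2).trans ?_
    have h3 : 0 ≤ gam m := (gam_pos (by omega)).le
    have h4 : 0 ≤ Real.log m := Real.log_natCast_nonneg m
    have : 0 ≤ gam m * Real.log m := by positivity
    nlinarith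
  set δ := η / 64 with hδ
  have hδ0 : 0 < δ := by positivity
  filter_upwards [ev_tau δ hδ0, ev_log_rpow δ 4 hδ0, ev_rpow δ 4 hδ0, ev_log δ 1 hδ0,
    eventually_ge_atTop 1] with m htau hlog h4 hlog2 hm1 x hx1 hxm
  have hm : (0 : ℝ) < m := by exact_mod_cast hm1
  set A := (m : ℝ) ^ δ with hA
  have hA1 : 1 ≤ A := by linarith
  have hlA : Real.log A = δ * Real.log m := Real.log_rpow hm δ
  have hL : 0 ≤ Real.log m := Real.log_natCast_nonneg m
  have hg := gam_pos (m := m) (by omega)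
  have hgt := inv_tau_le_gam m (by omega)
  have hmm : m ≤ m ^ 4 := Nat.le_self_pow (by norm_num) m
  have htm : tau m ≤ A := htau m hm1 hmm
  have hgA : 1 ≤ gam m * A := hgt.trans (by gcongr)
  have hlx : Real.log x ≤ Real.log m :=
    Real.log_le_log (by exact_mod_cast hx1) (by exact_mod_cast hxm)
  have hlx0 : 0 ≤ Real.log x := Real.log_natCast_nonneg x
  have ht0 := tau_nonneg m
  rw [abs_le]
  constructor
  · refine le_trans ?_ (sub_le_sub_right (Uf_le_Gf m x) _)
    obtain ⟨c1, c2, c3, c4⟩ := ceil_pow_bounds A hA1 32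
    set x0 := ⌈A ^ 32⌉₊ with hx0
    rw [hlA] at c4
    push_cast at c4
    have hx0L : Real.log x0 ≤ 33 * δ * Real.log m := by linarith
    rcases le_total x x0 with h | h
    · have h5 : Real.log x ≤ Real.log x0 :=
        Real.log_le_log (by exact_mod_cast hx1) (by exact_mod_cast h)
      have := Uf_nonneg m x
      have h6 : gam m * Real.log x ≤ gam m * (η * Real.log m) := by
        gcongr; rw [hδ] at hx0L; nlinarith
      linarith
    · have h5 := Uf_lower m x x0 (by omega) c1 h
      have hx0' : (1 : ℝ) ≤ x0 := by exact_mod_cast c1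
      have h6 : 4 * tau m / x0 ≤ gam m := by
        rw [div_le_iff₀ (by linarith)]
        have h7 : A ^ 3 ≤ A ^ 32 := pow_le_pow_right₀ hA1 (by norm_num)
        calc 4 * tau m ≤ A * A := by gcongr
          _ ≤ A * A * (gam m * A) := le_mul_of_one_le_right (by positivity) hgA
          _ = gam m * A ^ 3 := by ring
          _ ≤ gam m * x0 := by gcongr; linarith
      have h7 : (1 : ℝ) / x0 ≤ 1 := by rw [div_le_one (by linarith)]; exact hx0'
      have h8 : gam m * (Real.log x0 + 1 / x0 + 1) ≤ gam m * (η * Real.log m) := by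
        gcongr
        have : η = 64 * δ := by rw [hδ]; ring
        rw [this]; linarith
      nlinarith
  · obtain ⟨c1, c2, c3, c4⟩ := ceil_pow_bounds A hA1 16
    set z := ⌈A ^ 16⌉₊ with hz
    rw [hlA] at c4
    push_cast at c4
    have hz0 : (0 : ℝ) < z := by exact_mod_cast c1
    have hsz : A ^ 8 ≤ Real.sqrt z := by
      apply Real.le_sqrt_of_sq_le
      rw [← pow_mul]; exact c2
    have hG := Gf_le_Uf m x z c1 A (fun r h1 h2 => htau r h1 ((h2.trans hxm).trans hmm))
    have hU := Uf_upper m (x * z) z (by omega) c1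
    have hUl := Uf_le m (x * z)
    have hx0 : (0 : ℝ) < x := by exact_mod_cast hx1
    have hU0 := Uf_nonneg m (x * z)
    push_cast at hU hUl
    rw [Real.log_mul (by positivity) (by positivity)] at hU hUl
    rw [Real.log_mul (by positivity) (by positivity)] at hU
    have hsz0 : 0 < Real.sqrt z := Real.sqrt_pos.mpr hz0
    have hδ1 : δ ≤ 1 / 64 := by rw [hδ]; linarith
    have hlz : Real.log z ≤ 17 * δ * Real.log m := by linarith
    have hlz2 : Real.log z ≤ Real.log m := by nlinarith
    have hUA : Uf m (x * z) ≤ A := by linarith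
    have e1 : A ^ 2 * (1 + Real.log x) / Real.sqrt z ≤ gam m := by
      rw [div_le_iff₀ hsz0]
      calc A ^ 2 * (1 + Real.log x) ≤ A ^ 2 * A := by gcongr; linarith
        _ ≤ A ^ 2 * A * (gam m * A) := le_mul_of_one_le_right (by positivity) hgA
        _ = gam m * A ^ 4 := by ring
        _ ≤ gam m * A ^ 8 := by gcongr; norm_num
        _ ≤ _ := by gcongr
    have e2 : Uf m (x * z) * (tau m ^ 2 / Real.sqrt z) ≤ 1 := by
      calc _ ≤ A * (A ^ 2 / A ^ 8) := by gcongr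
        _ = A ^ 3 / A ^ 8 := by ring
        _ ≤ 1 := by
          rw [div_le_one (by positivity)]
          exact pow_le_pow_right₀ hA1 (by norm_num)
    have hg' : (m : ℝ) / m.totient = (gam m)⁻¹ := by unfold gam; rw [inv_div]
    rw [hg', ← div_eq_mul_inv] at hU
    have e3 : Uf m (x * z) ≤ gam m * (Real.log x + 34 * δ * Real.log m + 2) := by
      rw [div_le_iff₀ hg] at hU
      refine hU.trans ?_
      rw [mul_comm]
      exact mul_le_mul_of_nonneg_left (by linarith) hg.le
    have h8 : gam m * (34 * δ * Real.log m + 3) ≤ gam m * (η * Real.log m) := by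
      gcongr
      have : η = 64 * δ := by rw [hδ]; ring
      rw [this]; linarith
    nlinarith

end S17

namespace S17
open Finset Filter

noncomputable def Mer (n : ℕ) : ℝ := ∑ p ∈ (Ioc 0 n).filter Nat.Prime, Real.log p / p

lemma log_factorial_eq (n : ℕ) : Real.log (n.factorial) =
    ∑ p ∈ (Ioc 0 n).filter Nat.Prime, ((n.factorial).factorization p : ℝ) * Real.log p := by
  rw [Real.log_nat_eq_sum_factorization, Finsupp.sum]
  apply Finset.sum_subset
  · intro p hp
    rw [Nat.support_factorization, Nat.mem_primeFactors] at hp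
    simp only [mem_filter, mem_Ioc]
    exact ⟨⟨hp.1.pos, (hp.1.dvd_factorial).mp hp.2.1⟩, hp.1⟩
  · intro p _ hp
    rw [Finsupp.notMem_support_iff.mp hp]; simp

lemma log_factorial_bounds (n : ℕ) (hn : 1 ≤ n) :
    n * Real.log n - n ≤ Real.log (n.factorial) ∧ Real.log (n.factorial) ≤ n * Real.log n := by
  constructor
  · have h := Real.pow_div_factorial_le_exp (x := (n : ℝ)) (by positivity) n
    have hn0 : (0 : ℝ) < n := by exact_mod_cast hn
    have hf : (0 : ℝ) < n.factorial := by exact_mod_cast n.factorial_pos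
    have h2 := Real.log_le_log (by positivity) h
    rw [Real.log_exp, Real.log_div (by positivity) (by positivity), Real.log_pow] at h2
    linarith
  · rw [← Real.log_pow]
    apply Real.log_le_log (by exact_mod_cast n.factorial_pos)
    exact_mod_cast Nat.factorial_le_pow n


lemma fac_val_lower (n p : ℕ) (hp : p.Prime) (hpn : p ≤ n) :
    (n : ℝ) / p - 1 ≤ ((n.factorial).factorization p : ℝ) := by
  have := Fact.mk hp
  have h : n / p ≤ (n.factorial).factorization p := by
    rw [Nat.factorization_def _ hp, padicValNat_factorial (b := Nat.log p n + 1) (by omega)]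
    have h1 : 1 ≤ Nat.log p n := Nat.log_pos hp.one_lt hpn
    have := Finset.single_le_sum (f := fun i => n / p ^ i) (s := Ico 1 (Nat.log p n + 1))
      (fun _ _ => Nat.zero_le _) (a := 1) (by rw [Finset.mem_Ico]; omega)
    simpa using this
  have h2 : ((n / p : ℕ) : ℝ) ≤ ((n.factorial).factorization p : ℝ) := by exact_mod_cast h
  have h3 := Nat.lt_floor_add_one ((n : ℝ) / p)
  rw [Nat.floor_div_eq_div] at h3
  linarith

lemma fac_val_upper (n p : ℕ) (hp : p.Prime) :
    ((n.factorial).factorization p : ℝ) ≤ (n : ℝ) * (1 / p + 2 / p ^ 2) := by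
  have := Fact.mk hp
  have h : (p - 1) * (n.factorial).factorization p ≤ n := by
    rw [Nat.factorization_def _ hp, sub_one_mul_padicValNat_factorial]
    omega
  have hp2 : (2 : ℝ) ≤ p := by exact_mod_cast hp.two_le
  have h2 : ((p : ℝ) - 1) * (n.factorial).factorization p ≤ n := by
    have : (((p - 1 : ℕ) : ℝ)) * (n.factorial).factorization p ≤ n := by exact_mod_cast h
    rwa [Nat.cast_sub hp.one_lt.le, Nat.cast_one] at this
  have h3 : ((n.factorial).factorization p : ℝ) ≤ n / (p - 1) := by
    rw [le_div_iff₀ (by linarith)]; linarith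
  refine h3.trans ?_
  rw [div_eq_mul_one_div]
  gcongr
  rw [div_add_div _ _ (by positivity) (by positivity), div_le_div_iff₀ (by linarith) (by positivity)]
  nlinarith [mul_pos (show (0 : ℝ) < p by linarith) (show (0 : ℝ) < p by linarith)]

lemma mertens_tail : ∃ C : ℝ, 0 ≤ C ∧ ∀ n : ℕ,
    ∑ p ∈ (Ioc 0 n).filter Nat.Prime, 2 / (p : ℝ) ^ 2 * Real.log p ≤ C := by
  have hs : Summable (fun n : ℕ => 4 * (1 / (n : ℝ) ^ (3 / 2 : ℝ))) :=
    (Real.summable_one_div_nat_rpow.mpr (by norm_num)).mul_left 4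
  refine ⟨∑' n : ℕ, 4 * (1 / (n : ℝ) ^ (3 / 2 : ℝ)), tsum_nonneg fun _ => by positivity, fun n => ?_⟩
  refine le_trans (Finset.sum_le_sum fun p hp => ?_)
    (hs.sum_le_tsum ((Ioc 0 n).filter Nat.Prime) (fun _ _ => by positivity))
  have hp0 : (0 : ℝ) < p := by exact_mod_cast (Finset.mem_filter.mp hp).2.pos
  have h1 := Real.log_le_rpow_div hp0.le (show (0 : ℝ) < 1 / 2 by norm_num)
  have e : (p : ℝ) ^ 2 = (p : ℝ) ^ (3 / 2 : ℝ) * (p : ℝ) ^ (1 / 2 : ℝ) := by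
    rw [← Real.rpow_add hp0, ← Real.rpow_natCast]; norm_num
  calc 2 / (p : ℝ) ^ 2 * Real.log p ≤ 2 / (p : ℝ) ^ 2 * ((p : ℝ) ^ (1 / 2 : ℝ) / (1 / 2)) := by gcongr
    _ = _ := by rw [e]; field_simp; norm_num

lemma mertens : ∃ C : ℝ, 0 ≤ C ∧ ∀ n : ℕ, 1 ≤ n → |Mer n - Real.log n| ≤ C := by
  obtain ⟨C, hC0, hC⟩ := mertens_tail
  refine ⟨C + 2, by linarith, fun n hn => ?_⟩
  have hn0 : (0 : ℝ) < n := by exact_mod_cast hn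
  obtain ⟨f1, f2⟩ := log_factorial_bounds n hn
  have hlog : ∀ p ∈ (Ioc 0 n).filter Nat.Prime, 0 ≤ Real.log (p : ℝ) :=
    fun p _ => Real.log_natCast_nonneg p
  rw [abs_le]
  constructor
  · have h1 : Real.log n.factorial ≤ n * (Mer n + C) := by
      rw [log_factorial_eq]
      calc _ ≤ ∑ p ∈ (Ioc 0 n).filter Nat.Prime, (n : ℝ) * (1 / p + 2 / p ^ 2) * Real.log p := by
            refine Finset.sum_le_sum fun p hp => ?_
            exact mul_le_mul_of_nonneg_right (fac_val_upper n p (mem_filter.mp hp).2) (hlog p hp)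
        _ = n * (Mer n + ∑ p ∈ (Ioc 0 n).filter Nat.Prime, 2 / (p : ℝ) ^ 2 * Real.log p) := by
            unfold Mer
            rw [← Finset.sum_add_distrib, Finset.mul_sum]
            refine Finset.sum_congr rfl fun p _ => by ring
        _ ≤ _ := by gcongr; exact hC n
    have h2 : (n : ℝ) * (Real.log n - 1) ≤ n * (Mer n + C) := by linarith
    have := le_of_mul_le_mul_left h2 hn0
    linarith
  · have h1 : n * Mer n - Chebyshev.theta n ≤ Real.log n.factorial := by
      rw [log_factorial_eq, Chebyshev.theta]
      unfold Mer
      rw [Nat.floor_natCast, Finset.mul_sum, ← Finset.sum_sub_distrib]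
      refine Finset.sum_le_sum fun p hp => ?_
      have hp' := mem_filter.mp hp
      have := mul_le_mul_of_nonneg_right
        (fac_val_lower n p hp'.2 (mem_Ioc.mp hp'.1).2) (hlog p hp)
      refine le_trans (le_of_eq ?_) this
      ring
    have h2 := Chebyshev.theta_le_log4_mul_x hn0.le
    have h4 : Real.log 4 ≤ 2 := by
      rw [show (4 : ℝ) = 2 ^ 2 by norm_num, Real.log_pow]
      have := Real.log_two_lt_d9
      push_cast; linarith
    have h3 : (n : ℝ) * Mer n ≤ n * (Real.log n + 2) := by nlinarith
    have := le_of_mul_le_mul_left h3 hn0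
    linarith

noncomputable def Pr (m a b : ℕ) : Finset ℕ := (Ioc a b).filter (fun p => p.Prime ∧ ¬ p ∣ m)

lemma mem_Pr {m a b p : ℕ} : p ∈ Pr m a b ↔ (a < p ∧ p ≤ b) ∧ p.Prime ∧ ¬ p ∣ m := by
  simp [Pr]

lemma prime_window (σ : ℝ) (hσ : 0 < σ) : ∃ C : ℝ, 0 ≤ C ∧ ∀ᶠ m : ℕ in atTop, ∀ a b : ℕ,
    (m : ℝ) ^ σ ≤ a → a ≤ b →
    |∑ p ∈ Pr m a b, Real.log p / p - (Real.log b - Real.log a)| ≤ C := by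
  obtain ⟨C, hC0, hC⟩ := mertens
  refine ⟨2 * C + 1, by linarith, ?_⟩
  filter_upwards [ev_tau (σ / 2) (half_pos hσ), ev_log_rpow (σ / 2) 1 (half_pos hσ),
    eventually_ge_atTop 2] with m htau hlog hm a b ha hab
  have hm0 : (0 : ℝ) < m := by exact_mod_cast (by omega)
  have ha0 : (0 : ℝ) < a := lt_of_lt_of_le (by positivity) ha
  have ha1 : 1 ≤ a := by exact_mod_cast ha0
  have e1 : Mer b - Mer a = ∑ p ∈ (Ioc a b).filter Nat.Prime, Real.log p / p := by
    unfold Mer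
    rw [sub_eq_iff_eq_add, add_comm, ← Finset.sum_union]
    · congr 1
      ext p; simp only [mem_union, mem_filter, mem_Ioc]; constructor
      · rintro ⟨h, hp⟩; rcases le_or_gt p a with h1 | h1
        · exact Or.inl ⟨⟨h.1, h1⟩, hp⟩
        · exact Or.inr ⟨⟨h1, h.2⟩, hp⟩
      · rintro (⟨h, hp⟩ | ⟨h, hp⟩)
        · exact ⟨⟨h.1, h.2.trans hab⟩, hp⟩
        · exact ⟨⟨by omega, h.2⟩, hp⟩
    · rw [Finset.disjoint_left]; intro p h1 h2
      simp only [mem_filter, mem_Ioc] at h1 h2; omega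
  have e2 : ∑ p ∈ (Ioc a b).filter Nat.Prime, Real.log p / p = ∑ p ∈ Pr m a b, Real.log p / p +
      ∑ p ∈ ((Ioc a b).filter Nat.Prime).filter (fun p => p ∣ m), Real.log p / p := by
    rw [← Finset.sum_filter_not_add_sum_filter _ (fun p => p ∣ m)]
    congr 1
    unfold Pr
    rw [Finset.filter_filter]
  have h3 : ∑ p ∈ ((Ioc a b).filter Nat.Prime).filter (fun p => p ∣ m), Real.log p / p ≤ 1 := by
    have hle : ∀ p ∈ ((Ioc a b).filter Nat.Prime).filter (fun p => p ∣ m),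
        Real.log p / p ≤ Real.log m / a := by
      intro p hp
      simp only [mem_filter, mem_Ioc] at hp
      have hp0 : (0 : ℝ) < p := by exact_mod_cast hp.1.2.pos
      have hpm : p ≤ m := Nat.le_of_dvd (by omega) hp.2
      have : (a : ℝ) ≤ p := by exact_mod_cast hp.1.1.1.le
      have hl : 0 ≤ Real.log (p : ℝ) := Real.log_natCast_nonneg p
      have hl2 : Real.log (p : ℝ) ≤ Real.log m := Real.log_le_log hp0 (by exact_mod_cast hpm)
      gcongr
    refine (Finset.sum_le_card_nsmul _ _ _ hle).trans ?_
    have hcard : ((((Ioc a b).filter Nat.Prime).filter (fun p => p ∣ m)).card : ℝ) ≤ tau m := by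
      unfold tau
      have : (((Ioc a b).filter Nat.Prime).filter (fun p => p ∣ m)) ⊆ m.divisors := by
        intro p hp
        simp only [mem_filter] at hp
        exact Nat.mem_divisors.mpr ⟨hp.2, by omega⟩
      exact_mod_cast Finset.card_le_card this
    rw [nsmul_eq_mul]
    have hL : 0 ≤ Real.log m := Real.log_natCast_nonneg m
    have htm := htau m (by omega) (Nat.le_self_pow (by norm_num) m)
    rw [← mul_div_assoc, div_le_one ha0]
    calc _ ≤ (m : ℝ) ^ (σ / 2) * (m : ℝ) ^ (σ / 2) :=
          mul_le_mul (hcard.trans htm) (by linarith) hL (by positivity)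
      _ = (m : ℝ) ^ σ := by rw [← Real.rpow_add hm0]; ring_nf
      _ ≤ _ := ha
  have h4 : 0 ≤ ∑ p ∈ ((Ioc a b).filter Nat.Prime).filter (fun p => p ∣ m), Real.log p / p :=
    Finset.sum_nonneg fun p _ => div_nonneg (Real.log_natCast_nonneg p) (by positivity)
  have ca := abs_le.mp (hC a ha1)
  have cb := abs_le.mp (hC b (by omega))
  rw [abs_le]
  constructor <;> linarith [ca.1, ca.2, cb.1, cb.2]

end S17

namespace S17
open Finset Filter

section
variable {m : ℕ} [NeZero m]

noncomputable def hat (W : Finset ℕ) (f : ℕ → ℝ) (χ : DirichletCharacter ℂ m) : ℂ :=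
  ∑ n ∈ W, (f n : ℂ) * χ (n : ZMod m)

lemma conj_char (χ : DirichletCharacter ℂ m) (a : ZMod m) (ha : IsUnit a) :
    (starRingEnd ℂ) (χ a) = χ a⁻¹ := by
  have h1 : χ a⁻¹ * χ a = 1 := by
    rw [← map_mul, ZMod.inv_mul_of_unit a ha, map_one]
  have h2 : ‖χ a‖ = 1 := by
    obtain ⟨u, rfl⟩ := ha
    exact DirichletCharacter.unit_norm_eq_one χ u
  have h3 : (starRingEnd ℂ) (χ a) * χ a = 1 := by
    rw [mul_comm, Complex.mul_conj, Complex.normSq_eq_norm_sq, h2]; simp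
  have h0 : χ a ≠ 0 := by intro h; rw [h] at h2; simp at h2
  exact mul_right_cancel₀ h0 (h3.trans h1.symm)

open Classical in
lemma orth {ι : Type*} (I : Finset ι) (F : ι → ℝ) (N : ι → ℕ) (a : ZMod m) (ha : IsUnit a) :
    ∑ χ : DirichletCharacter ℂ m, χ a⁻¹ * ∑ i ∈ I, (F i : ℂ) * χ (N i : ZMod m) =
      (m.totient : ℂ) * ((∑ i ∈ I.filter (fun i => a = (N i : ZMod m)), F i : ℝ) : ℂ) := by
  simp_rw [Finset.mul_sum]
  rw [Finset.sum_comm]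
  have : ∀ i ∈ I, ∑ χ : DirichletCharacter ℂ m, χ a⁻¹ * ((F i : ℂ) * χ (N i : ZMod m)) =
      if a = (N i : ZMod m) then (m.totient : ℂ) * F i else 0 := by
    intro i _
    have h := DirichletCharacter.sum_char_inv_mul_char_eq ℂ ha (N i : ZMod m)
    calc _ = F i * ∑ χ : DirichletCharacter ℂ m, χ a⁻¹ * χ (N i : ZMod m) := by
          rw [Finset.mul_sum]; refine Finset.sum_congr rfl fun χ _ => by ring
      _ = _ := by rw [h]; split_ifs <;> ring
  rw [Finset.sum_congr rfl this, ← Finset.sum_filter, ← Finset.mul_sum]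
  push_cast; rfl

open Classical in
lemma parseval {ι : Type*} (I : Finset ι) (F : ι → ℝ) (N : ι → ℕ)
    (hN : ∀ i ∈ I, Nat.Coprime (N i) m) :
    ∑ χ : DirichletCharacter ℂ m, ‖∑ i ∈ I, (F i : ℂ) * χ (N i : ZMod m)‖ ^ 2 =
      (m.totient : ℝ) * ∑ j ∈ I, F j *
        ∑ i ∈ I.filter (fun i => (N j : ZMod m) = (N i : ZMod m)), F i := by
  have key : ((∑ χ : DirichletCharacter ℂ m, ‖∑ i ∈ I, (F i : ℂ) * χ (N i : ZMod m)‖ ^ 2 : ℝ) : ℂ) =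
      (((m.totient : ℝ) * ∑ j ∈ I, F j *
        ∑ i ∈ I.filter (fun i => (N j : ZMod m) = (N i : ZMod m)), F i : ℝ) : ℂ) := by
    push_cast
    have h1 : ∀ χ : DirichletCharacter ℂ m,
        ((‖∑ i ∈ I, (F i : ℂ) * χ (N i : ZMod m)‖ : ℝ) : ℂ) ^ 2 =
        ∑ j ∈ I, (F j : ℂ) * (χ (N j : ZMod m)⁻¹ * ∑ i ∈ I, (F i : ℂ) * χ (N i : ZMod m)) := by
      intro χ
      rw [← Complex.ofReal_pow, ← Complex.normSq_eq_norm_sq, ← Complex.mul_conj, map_sum,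
        mul_comm, Finset.sum_mul]
      refine Finset.sum_congr rfl fun j hj => ?_
      rw [map_mul, Complex.conj_ofReal, conj_char χ _
        ((ZMod.isUnit_iff_coprime _ _).mpr (hN j hj)), mul_assoc]
    simp_rw [h1]
    rw [Finset.sum_comm, Finset.mul_sum]
    refine Finset.sum_congr rfl fun j hj => ?_
    rw [← Finset.mul_sum, orth I F N _ ((ZMod.isUnit_iff_coprime _ _).mpr (hN j hj))]
    push_cast
    ring
  exact_mod_cast key

open Classical in
lemma card_fiber (W : Finset ℕ) (N T : ℕ) (hW : ∀ n ∈ W, 1 ≤ n ∧ n ≤ N)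
    (hT : ∀ u, 1 ≤ u → u ≤ N ^ 2 → u.divisors.card ≤ T) (c : ZMod m) :
    ((W ×ˢ W).filter (fun i => c = ((i.1 * i.2 : ℕ) : ZMod m))).card ≤ T * (N ^ 2 / m + 1) := by
  set S := (W ×ˢ W).filter (fun i => c = ((i.1 * i.2 : ℕ) : ZMod m)) with hS
  have hSm : ∀ i ∈ S, (1 ≤ i.1 ∧ i.1 ≤ N) ∧ (1 ≤ i.2 ∧ i.2 ≤ N) ∧
      c = ((i.1 * i.2 : ℕ) : ZMod m) := by
    intro i hi
    rw [hS, mem_filter, mem_product] at hi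
    exact ⟨hW _ hi.1.1, hW _ hi.1.2, hi.2⟩
  have h1 := Finset.card_le_mul_card_image (f := fun i : ℕ × ℕ => i.1 * i.2) S T (by
    intro u hu
    obtain ⟨i, hi, rfl⟩ := Finset.mem_image.mp hu
    obtain ⟨⟨a1, a2⟩, ⟨b1, b2⟩, _⟩ := hSm i hi
    have hu1 : 1 ≤ i.1 * i.2 := Nat.mul_pos a1 b1
    refine le_trans ?_ (hT _ hu1 (by nlinarith))
    apply Finset.card_le_card_of_injOn Prod.fst
    · intro j hj
      have hj := Finset.mem_coe.mp hj
      rw [mem_filter] at hj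
      simp only [Finset.mem_coe, Nat.mem_divisors]
      exact ⟨hj.2 ▸ Dvd.intro _ rfl, by omega⟩
    · intro j hj k hk hjk
      have hj := Finset.mem_coe.mp hj
      have hk := Finset.mem_coe.mp hk
      rw [mem_filter] at hj hk
      have e := hj.2.trans hk.2.symm
      rw [show j.1 = k.1 from hjk] at e
      have := Nat.eq_of_mul_eq_mul_left (hSm k hk.1).1.1 e
      exact Prod.ext hjk this)
  refine h1.trans (Nat.mul_le_mul_left _ ?_)
  have hm : 0 < m := Nat.pos_of_ne_zero (NeZero.ne m)
  rw [← Finset.card_range (N ^ 2 / m + 1)]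
  apply Finset.card_le_card_of_injOn (fun u => u / m)
  · intro u hu
    obtain ⟨i, hi, rfl⟩ := Finset.mem_image.mp hu
    obtain ⟨⟨a1, a2⟩, ⟨b1, b2⟩, _⟩ := hSm i hi
    simp only [Finset.mem_coe, Finset.mem_range]
    apply Nat.lt_succ_of_le
    apply Nat.div_le_div_right
    nlinarith
  · intro u hu v hv huv
    obtain ⟨i, hi, rfl⟩ := Finset.mem_image.mp hu
    obtain ⟨j, hj, rfl⟩ := Finset.mem_image.mp hv
    have e := (hSm i hi).2.2.symm.trans (hSm j hj).2.2
    rw [ZMod.natCast_eq_natCast_iff'] at e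
    simp only at huv ⊢
    rw [← Nat.div_add_mod (i.1 * i.2) m, ← Nat.div_add_mod (j.1 * j.2) m, huv, e]

lemma moment_bound (W : Finset ℕ) (N T : ℕ) (hW : ∀ n ∈ W, 1 ≤ n ∧ n ≤ N)
    (hWm : ∀ n ∈ W, Nat.Coprime n m)
    (hT : ∀ u, 1 ≤ u → u ≤ N ^ 2 → u.divisors.card ≤ T) (f g : ℕ → ℝ) (B : ℝ)
    (hf : ∀ n ∈ W, 0 ≤ f n ∧ f n ≤ B) (hg : ∀ n ∈ W, 0 ≤ g n ∧ g n ≤ B) :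
    ∑ χ : DirichletCharacter ℂ m, ‖hat W f χ‖ ^ 2 * ‖hat W g χ‖ ^ 2 ≤
      m * (B ^ 4 * (N ^ 2 * (T * (N ^ 2 / m + 1)))) := by
  classical
  rcases W.eq_empty_or_nonempty with rfl | ⟨w0, hw0⟩
  · simp [hat]; positivity
  have hB : 0 ≤ B := (hf w0 hw0).1.trans (hf w0 hw0).2
  have h := parseval (m := m) (W ×ˢ W) (fun i => f i.1 * g i.2) (fun i => i.1 * i.2) (by
    intro i hi
    rw [mem_product] at hi
    exact Nat.Coprime.mul_left (hWm _ hi.1) (hWm _ hi.2))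
  have e : ∀ χ : DirichletCharacter ℂ m, ‖hat W f χ‖ ^ 2 * ‖hat W g χ‖ ^ 2 =
      ‖∑ i ∈ W ×ˢ W, ((f i.1 * g i.2 : ℝ) : ℂ) * χ ((i.1 * i.2 : ℕ) : ZMod m)‖ ^ 2 := by
    intro χ
    rw [← mul_pow, ← norm_mul]
    unfold hat
    rw [Finset.sum_mul_sum, Finset.sum_product]
    congr 2
    refine Finset.sum_congr (M := ℂ) rfl fun i _ => Finset.sum_congr (M := ℂ) rfl fun j _ => ?_
    push_cast
    rw [map_mul]; ring
  simp_rw [e]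
  rw [h]
  have hm : (m.totient : ℝ) ≤ m := by exact_mod_cast Nat.totient_le m
  have hm0 : (0 : ℝ) < m := by exact_mod_cast Nat.pos_of_ne_zero (NeZero.ne m)
  have hFb : ∀ i ∈ W ×ˢ W, 0 ≤ f i.1 * g i.2 ∧ f i.1 * g i.2 ≤ B ^ 2 := by
    intro i hi
    rw [mem_product] at hi
    have h1 := hf _ hi.1
    have h2 := hg _ hi.2
    refine ⟨mul_nonneg h1.1 h2.1, ?_⟩
    rw [sq]; exact mul_le_mul h1.2 h2.2 h2.1 hB
  have hinner : ∀ j ∈ W ×ˢ W, f j.1 * g j.2 * ∑ i ∈ (W ×ˢ W).filter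
      (fun i => ((j.1 * j.2 : ℕ) : ZMod m) = ((i.1 * i.2 : ℕ) : ZMod m)), f i.1 * g i.2 ≤
      B ^ 2 * (T * ((N : ℝ) ^ 2 / m + 1) * B ^ 2) := by
    intro j hj
    apply mul_le_mul (hFb j hj).2 _ _ (by positivity)
    · refine (Finset.sum_le_card_nsmul _ _ (B ^ 2) (fun i hi => (hFb i (mem_filter.mp hi).1).2)).trans ?_
      rw [nsmul_eq_mul]
      gcongr
      have h3 := card_fiber (m := m) W N T hW hT ((j.1 * j.2 : ℕ) : ZMod m)
      have h4 : ((N ^ 2 / m : ℕ) : ℝ) ≤ (N : ℝ) ^ 2 / m := by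
        have := Nat.cast_div_le (α := ℝ) (m := N ^ 2) (n := m)
        push_cast at this; exact this
      calc _ ≤ ((T * (N ^ 2 / m + 1) : ℕ) : ℝ) := by exact_mod_cast h3
        _ = T * (((N ^ 2 / m : ℕ) : ℝ) + 1) := by push_cast; ring
        _ ≤ _ := by gcongr
    · exact Finset.sum_nonneg fun i hi => (hFb i (mem_filter.mp hi).1).1
  have hcard : ((W ×ˢ W).card : ℝ) ≤ (N : ℝ) ^ 2 := by
    have : W.card ≤ N := by
      have := Finset.card_le_card (s := W) (t := Icc 1 N) (fun n hn => by
        simpa using hW n hn)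
      simpa using this
    rw [Finset.card_product]
    have h5 : W.card * W.card ≤ N ^ 2 := by nlinarith
    exact_mod_cast h5
  calc _ ≤ (m : ℝ) * ((W ×ˢ W).card • (B ^ 2 * (T * ((N : ℝ) ^ 2 / m + 1) * B ^ 2))) := by
        apply mul_le_mul hm (Finset.sum_le_card_nsmul _ _ _ hinner) _ hm0.le
        exact Finset.sum_nonneg fun j hj => mul_nonneg (hFb j hj).1
          (Finset.sum_nonneg fun i hi => (hFb i (mem_filter.mp hi).1).1)
    _ ≤ m * ((N : ℝ) ^ 2 * (B ^ 2 * (T * ((N : ℝ) ^ 2 / m + 1) * B ^ 2))) := by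
        rw [nsmul_eq_mul]; gcongr
    _ = _ := by ring

lemma hat_one (W : Finset ℕ) (hWm : ∀ n ∈ W, Nat.Coprime n m) (f : ℕ → ℝ) :
    hat W f (1 : DirichletCharacter ℂ m) = ((∑ n ∈ W, f n : ℝ) : ℂ) := by
  unfold hat
  push_cast
  refine Finset.sum_congr rfl fun n hn => ?_
  rw [MulChar.one_apply ((ZMod.isUnit_iff_coprime _ _).mpr (hWm n hn)), mul_one]

/-- five-fold weighted count in a residue class -/
noncomputable def cnt (m : ℕ) (W : Finset ℕ) (f1 f2 f3 f4 f5 : ℕ → ℝ) (a : ZMod m) : ℝ :=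
  open Classical in
  ∑ i ∈ (W ×ˢ W ×ˢ W ×ˢ W ×ˢ W).filter
    (fun i => a = ((i.1 * (i.2.1 * (i.2.2.1 * (i.2.2.2.1 * i.2.2.2.2))) : ℕ) : ZMod m)),
    f1 i.1 * (f2 i.2.1 * (f3 i.2.2.1 * (f4 i.2.2.2.1 * f5 i.2.2.2.2)))

lemma prod_hat {ι : Type*} (W : Finset ℕ) (f : ℕ → ℝ) (J : Finset ι) (F : ι → ℝ) (N : ι → ℕ)
    (χ : DirichletCharacter ℂ m) :
    hat W f χ * ∑ j ∈ J, (F j : ℂ) * χ (N j : ZMod m) =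
      ∑ i ∈ W ×ˢ J, ((f i.1 * F i.2 : ℝ) : ℂ) * χ ((i.1 * N i.2 : ℕ) : ZMod m) := by
  unfold hat
  rw [Finset.sum_mul_sum, Finset.sum_product]
  refine Finset.sum_congr (M := ℂ) rfl fun i _ => Finset.sum_congr (M := ℂ) rfl fun j _ => ?_
  push_cast
  rw [map_mul]; ring

lemma cnt_eq (W : Finset ℕ) (f1 f2 f3 f4 f5 : ℕ → ℝ) (a : ZMod m) (ha : IsUnit a) :
    ∑ χ : DirichletCharacter ℂ m, χ a⁻¹ * (hat W f1 χ * (hat W f2 χ * (hat W f3 χ *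
      (hat W f4 χ * hat W f5 χ)))) =
      (m.totient : ℂ) * ((cnt m W f1 f2 f3 f4 f5 a : ℝ) : ℂ) := by
  classical
  have h := orth (m := m) (W ×ˢ W ×ˢ W ×ˢ W ×ˢ W)
    (fun i => f1 i.1 * (f2 i.2.1 * (f3 i.2.2.1 * (f4 i.2.2.2.1 * f5 i.2.2.2.2))))
    (fun i => i.1 * (i.2.1 * (i.2.2.1 * (i.2.2.2.1 * i.2.2.2.2)))) a ha
  have e : ∀ χ : DirichletCharacter ℂ m, hat W f1 χ * (hat W f2 χ * (hat W f3 χ *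
      (hat W f4 χ * hat W f5 χ))) = ∑ i ∈ (W ×ˢ W ×ˢ W ×ˢ W ×ˢ W),
      ((f1 i.1 * (f2 i.2.1 * (f3 i.2.2.1 * (f4 i.2.2.2.1 * f5 i.2.2.2.2))) : ℝ) : ℂ) *
      χ ((i.1 * (i.2.1 * (i.2.2.1 * (i.2.2.2.1 * i.2.2.2.2))) : ℕ) : ZMod m) := by
    intro χ
    have h5 : hat W f5 χ = ∑ j ∈ W, (f5 j : ℂ) * χ ((id j : ℕ) : ZMod m) := rfl
    rw [h5, prod_hat W f4, prod_hat W f3, prod_hat W f2, prod_hat W f1]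
    rfl
  simp_rw [e]
  unfold cnt
  convert h

/-- The abstract switching argument. -/
lemma switching (W : Finset ℕ) (hWm : ∀ n ∈ W, Nat.Coprime n m) (f ν h hb : ℕ → ℝ)
    (hf : ∀ n ∈ W, 0 ≤ f n) (hfν : ∀ n ∈ W, f n ≤ ν n)
    (hb0 : ∀ n ∈ W, 0 ≤ hb n) (E Mo : ℝ) (a : ZMod m) (ha : IsUnit a)
    (hE1 : ∀ χ : DirichletCharacter ℂ m, χ ≠ 1 → ‖hat W h χ‖ ≤ E)
    (hE2 : ∀ χ : DirichletCharacter ℂ m, χ ≠ 1 → ‖hat W ν χ‖ ≤ E)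
    (hM1 : ∑ χ : DirichletCharacter ℂ m, ‖hat W f χ‖ ^ 2 * ‖hat W f χ‖ ^ 2 ≤ Mo)
    (hM2 : ∑ χ : DirichletCharacter ℂ m, ‖hat W f χ‖ ^ 2 * ‖hat W hb χ‖ ^ 2 ≤ Mo) (hE0 : 0 ≤ E)
    (hbig : 2 * (E * Mo) < (∑ n ∈ W, f n) ^ 3 * ((∑ n ∈ W, f n) * (∑ n ∈ W, h n) -
      (∑ n ∈ W, ν n) * (∑ n ∈ W, hb n))) :
    ∃ p1 ∈ W, ∃ p2 ∈ W, ∃ p3 ∈ W, ∃ p4 ∈ W, ∃ n ∈ W,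
      a = ((p1 * (p2 * (p3 * (p4 * n))) : ℕ) : ZMod m) ∧
      f p1 ≠ 0 ∧ f p2 ≠ 0 ∧ f p3 ≠ 0 ∧ f p4 ≠ 0 ∧ h n ≠ hb n := by
  classical
  by_contra hcon
  push Not at hcon
  have hone : ∀ f5 f4 : ℕ → ℝ, ∀ E' Mo' : ℝ,
      (∑ χ ∈ (univ : Finset (DirichletCharacter ℂ m)).erase 1,
        ‖hat W f χ * (hat W f χ * (hat W f χ * (hat W f4 χ * hat W f5 χ)))‖ ≤ E' * Mo') →
      |(m.totient : ℝ) * cnt m W f f f f4 f5 a -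
        (∑ n ∈ W, f n) ^ 3 * ((∑ n ∈ W, f4 n) * (∑ n ∈ W, f5 n))| ≤ E' * Mo' := by
    intro f5 f4 E' Mo' hh
    have h1 := cnt_eq (m := m) W f f f f4 f5 a ha
    rw [← Finset.add_sum_erase _ _ (Finset.mem_univ (1 : DirichletCharacter ℂ m))] at h1
    have hu : IsUnit a⁻¹ := by
      have := ZMod.inv_mul_of_unit a ha
      exact IsUnit.of_mul_eq_one a this
    rw [MulChar.one_apply hu, hat_one W hWm, hat_one W hWm, hat_one W hWm, one_mul] at h1
    have h2 : (((m.totient : ℝ) * cnt m W f f f f4 f5 a -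
        (∑ n ∈ W, f n) ^ 3 * ((∑ n ∈ W, f4 n) * (∑ n ∈ W, f5 n)) : ℝ) : ℂ) =
        ∑ χ ∈ (univ : Finset (DirichletCharacter ℂ m)).erase 1, χ a⁻¹ *
        (hat W f χ * (hat W f χ * (hat W f χ * (hat W f4 χ * hat W f5 χ)))) := by
      push_cast at h1 ⊢
      rw [← h1]; ring
    rw [← Real.norm_eq_abs, ← Complex.norm_real, h2]
    refine (norm_sum_le _ _).trans (le_trans (Finset.sum_le_sum fun χ _ => ?_) hh)
    rw [norm_mul (χ a⁻¹)]
    exact mul_le_of_le_one_left (norm_nonneg _) (DirichletCharacter.norm_le_one χ _)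
  have key : cnt m W f f f f h a ≤ cnt m W f f f ν hb a := by
    unfold cnt
    refine Finset.sum_le_sum fun i hi => ?_
    simp only [mem_filter, mem_product] at hi
    obtain ⟨⟨i1, i2, i3, i4, i5⟩, hi⟩ := hi
    have r0 : 0 ≤ f i.1 * (f i.2.1 * (f i.2.2.1 * (ν i.2.2.2.1 * hb i.2.2.2.2))) :=
      mul_nonneg (hf _ i1) (mul_nonneg (hf _ i2) (mul_nonneg (hf _ i3)
        (mul_nonneg ((hf _ i4).trans (hfν _ i4)) (hb0 _ i5))))
    by_cases z1 : f i.1 = 0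
    · rw [z1, zero_mul, zero_mul]
    by_cases z2 : f i.2.1 = 0
    · rw [z2, zero_mul, zero_mul]
    by_cases z3 : f i.2.2.1 = 0
    · rw [z3, zero_mul, zero_mul]
    by_cases z4 : f i.2.2.2.1 = 0
    · refine le_trans (le_of_eq ?_) r0
      rw [z4]; ring
    rw [hcon _ i1 _ i2 _ i3 _ i4 _ i5 hi z1 z2 z3 z4]
    have := mul_le_mul_of_nonneg_right (hfν _ i4) (hb0 _ i5)
    exact mul_le_mul_of_nonneg_left (mul_le_mul_of_nonneg_left (mul_le_mul_of_nonneg_left this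
      (hf _ i3)) (hf _ i2)) (hf _ i1)
  have t1 := hone h f E Mo (by
    calc _ ≤ ∑ χ ∈ (univ : Finset (DirichletCharacter ℂ m)).erase 1,
          E * (‖hat W f χ‖ ^ 2 * ‖hat W f χ‖ ^ 2) := by
          refine Finset.sum_le_sum fun χ hχ => ?_
          have := hE1 χ (Finset.ne_of_mem_erase hχ)
          simp only [norm_mul]
          calc _ = ‖hat W h χ‖ * (‖hat W f χ‖ ^ 2 * ‖hat W f χ‖ ^ 2) := by ring
            _ ≤ _ := by gcongr
      _ ≤ ∑ χ : DirichletCharacter ℂ m, E * (‖hat W f χ‖ ^ 2 * ‖hat W f χ‖ ^ 2) :=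
          Finset.sum_le_sum_of_subset_of_nonneg (Finset.erase_subset _ _)
            (fun _ _ _ => by positivity)
      _ ≤ _ := by rw [← Finset.mul_sum]; gcongr)
  have t2 := hone hb ν E Mo (by
    calc _ ≤ ∑ χ ∈ (univ : Finset (DirichletCharacter ℂ m)).erase 1,
          E * ((‖hat W f χ‖ ^ 2 * ‖hat W f χ‖ ^ 2 + ‖hat W f χ‖ ^ 2 * ‖hat W hb χ‖ ^ 2) / 2) := by
          refine Finset.sum_le_sum fun χ hχ => ?_
          have := hE2 χ (Finset.ne_of_mem_erase hχ)
          simp only [norm_mul]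
          calc _ = ‖hat W ν χ‖ * (‖hat W f χ‖ ^ 2 * (‖hat W f χ‖ * ‖hat W hb χ‖)) := by ring
            _ ≤ E * (‖hat W f χ‖ ^ 2 * ((‖hat W f χ‖ ^ 2 + ‖hat W hb χ‖ ^ 2) / 2)) := by
              gcongr
              nlinarith [sq_nonneg (‖hat W f χ‖ - ‖hat W hb χ‖)]
            _ = _ := by ring
      _ ≤ ∑ χ : DirichletCharacter ℂ m,
          E * ((‖hat W f χ‖ ^ 2 * ‖hat W f χ‖ ^ 2 + ‖hat W f χ‖ ^ 2 * ‖hat W hb χ‖ ^ 2) / 2) :=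
          Finset.sum_le_sum_of_subset_of_nonneg (Finset.erase_subset _ _)
            (fun _ _ _ => by positivity)
      _ ≤ _ := by
        rw [← Finset.mul_sum, ← Finset.sum_div, Finset.sum_add_distrib]; gcongr; linarith)
  have k2 : (m.totient : ℝ) * cnt m W f f f f h a ≤ m.totient * cnt m W f f f ν hb a := by gcongr
  have a1 := abs_le.mp t1
  have a2 := abs_le.mp t2
  rw [mul_sub] at hbig
  linarith [a1.1, a2.2]

end
end S17

namespace S17
open Finset Filter

lemma Gf_mono (m : ℕ) {x y : ℕ} (h : x ≤ y) : Gf m x ≤ Gf m y := by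
  unfold Gf
  apply Finset.sum_le_sum_of_subset_of_nonneg
  · intro r hr
    rw [mem_supp] at hr ⊢
    exact ⟨⟨hr.1.1, hr.1.2.trans h⟩, hr.2⟩
  · intros; positivity

/-- Factorisation of the weighted sums over multiples of `d`. -/
lemma Ysum_eq (m x d : ℕ) (hd : Squarefree d) (hdm : Nat.Coprime d m) :
    Ysum m x (fun _ => 1) d = 1 / (d.totient : ℝ) *
      ∑ t ∈ (supp m (x / d)).filter (fun t => Nat.Coprime t d), 1 / (t.totient : ℝ) := by
  have hd0 : 0 < d := Nat.pos_of_ne_zero hd.ne_zero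
  unfold Ysum
  rw [← Finset.sum_filter, Finset.mul_sum]
  symm
  apply Finset.sum_bij (fun t _ => d * t)
  · intro t ht
    rw [mem_filter, mem_supp] at ht
    rw [mem_filter, mem_supp]
    obtain ⟨⟨⟨h1, h2⟩, h3, h4⟩, h5⟩ := ht
    refine ⟨⟨⟨Nat.mul_pos hd0 h1, ?_⟩, ?_, ?_⟩, dvd_mul_right _ _⟩
    · rw [mul_comm]; exact (Nat.le_div_iff_mul_le hd0).mp h2
    · exact (Nat.squarefree_mul h5.symm).mpr ⟨hd, h3⟩
    · exact Nat.Coprime.mul_left hdm h4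
  · intro a _ b _ h
    exact Nat.eq_of_mul_eq_mul_left hd0 h
  · intro r hr
    rw [mem_filter, mem_supp] at hr
    obtain ⟨⟨⟨h1, h2⟩, h3, h4⟩, t, rfl⟩ := hr
    refine ⟨t, ?_, rfl⟩
    rw [mem_filter, mem_supp]
    have ht0 : 0 < t := Nat.pos_of_mul_pos_left h1
    refine ⟨⟨⟨ht0, ?_⟩, ?_, ?_⟩, ?_⟩
    · rw [Nat.le_div_iff_mul_le hd0, mul_comm]; exact h2
    · exact h3.squarefree_of_dvd (dvd_mul_left _ _)
    · exact Nat.Coprime.of_dvd_left (dvd_mul_left _ _) h4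
    · exact (Nat.coprime_of_squarefree_mul h3).symm
  · intro t ht
    rw [mem_filter] at ht
    rw [Nat.totient_mul ht.2.symm]
    push_cast
    rw [one_div_mul_one_div]

lemma Ysum_upper (m x d : ℕ) (hd : Squarefree d) (hdm : Nat.Coprime d m) :
    d * Ysum m x (fun _ => 1) d ≤ (d / d.totient : ℝ) * Gf m (x / d) := by
  rw [Ysum_eq m x d hd hdm, ← mul_assoc, mul_one_div]
  apply mul_le_mul_of_nonneg_left _ (by positivity)
  unfold Gf
  apply Finset.sum_le_sum_of_subset_of_nonneg (Finset.filter_subset _ _)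
  intros; positivity

lemma Ysum_lower (m x d : ℕ) (hd : Squarefree d) (hdm : Nat.Coprime d m) :
    Gf m (x / d) * (1 - ∑ q ∈ d.primeFactors, 1 / ((q : ℝ) - 1)) ≤ d * Ysum m x (fun _ => 1) d := by
  have hd0 : 0 < d := Nat.pos_of_ne_zero hd.ne_zero
  have hφ : (0 : ℝ) < d.totient := by exact_mod_cast Nat.totient_pos.mpr hd0
  have hφd : (1 : ℝ) ≤ d / d.totient := by
    rw [le_div_iff₀ hφ, one_mul]; exact_mod_cast Nat.totient_le d
  rw [Ysum_eq m x d hd hdm, ← mul_assoc, mul_one_div]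
  set z := x / d
  have h1 : Gf m z - ∑ q ∈ d.primeFactors, 1 / ((q : ℝ) - 1) * Gf m z ≤
      ∑ t ∈ (supp m z).filter (fun t => Nat.Coprime t d), 1 / (t.totient : ℝ) := by
    have hq : ∀ q ∈ d.primeFactors, ∑ t ∈ supp m z, (if q ∣ t then 1 / (t.totient : ℝ) else 0) ≤
        1 / ((q : ℝ) - 1) * Gf m z := by
      intro q hq
      have hqp := Nat.prime_of_mem_primeFactors hq
      have hqm : Nat.Coprime q m := Nat.Coprime.of_dvd_left (Nat.dvd_of_mem_primeFactors hq) hdm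
      have := Ysum_eq m z q hqp.squarefree hqm
      unfold Ysum at this
      rw [this, Nat.totient_prime hqp, Nat.cast_sub hqp.one_le, Nat.cast_one]
      have : (1 : ℝ) ≤ q := by exact_mod_cast hqp.one_le
      apply mul_le_mul_of_nonneg_left _ (by apply one_div_nonneg.mpr; linarith)
      refine le_trans ?_ (Gf_mono m (Nat.div_le_self z q))
      unfold Gf
      apply Finset.sum_le_sum_of_subset_of_nonneg (Finset.filter_subset _ _)
      intros; positivity
    have h2 : Gf m z ≤ ∑ t ∈ (supp m z).filter (fun t => Nat.Coprime t d), 1 / (t.totient : ℝ) +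
        ∑ q ∈ d.primeFactors, ∑ t ∈ supp m z, (if q ∣ t then 1 / (t.totient : ℝ) else 0) := by
      rw [Finset.sum_comm, Finset.sum_filter, ← Finset.sum_add_distrib]
      unfold Gf
      apply Finset.sum_le_sum
      intro t ht
      have hnn : ∀ q ∈ d.primeFactors, (0 : ℝ) ≤ (if q ∣ t then 1 / (t.totient : ℝ) else 0) := by
        intro q _; split_ifs <;> positivity
      by_cases hc : Nat.Coprime t d
      · rw [if_pos hc]
        have := Finset.sum_nonneg hnn
        linarith
      · rw [if_neg hc, zero_add]
        obtain ⟨q, hqp, hqt, hqd⟩ := Nat.Prime.not_coprime_iff_dvd.mp hc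
        have hmem : q ∈ d.primeFactors := Nat.mem_primeFactors.mpr ⟨hqp, hqd, hd0.ne'⟩
        have := Finset.single_le_sum hnn hmem
        rw [if_pos hqt] at this
        exact this
    have h3 := Finset.sum_le_sum hq
    linarith
  have h0 : 0 ≤ ∑ t ∈ (supp m z).filter (fun t => Nat.Coprime t d), 1 / (t.totient : ℝ) :=
    Finset.sum_nonneg fun _ _ => by positivity
  rw [← Finset.sum_mul] at h1
  nlinarith

lemma Ysum_zero (m x d : ℕ) (y : ℕ → ℝ) (h : x < d) : Ysum m x y d = 0 := by
  unfold Ysum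
  apply Finset.sum_eq_zero
  intro r hr
  rw [mem_supp] at hr
  rw [if_neg]
  intro hdr
  have := Nat.le_of_dvd hr.1.1 hdr
  omega

lemma log_div_floor (x d : ℕ) (hd : 0 < d) (h : d ≤ x) :
    Real.log x - Real.log d - 1 ≤ Real.log ((x / d : ℕ) : ℝ) ∧
    Real.log ((x / d : ℕ) : ℝ) ≤ Real.log x - Real.log d := by
  have hdr : (0 : ℝ) < d := by exact_mod_cast hd
  have hxr : (0 : ℝ) < x := by exact_mod_cast hd.trans_le h
  have h1 : 1 ≤ x / d := (Nat.one_le_div_iff hd).mpr h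
  have h1r : (0 : ℝ) < ((x / d : ℕ) : ℝ) := by exact_mod_cast h1
  rw [← Real.log_div hxr.ne' hdr.ne']
  constructor
  · have h2 : (x : ℝ) / d ≤ 2 * ((x / d : ℕ) : ℝ) := by
      rw [div_le_iff₀ hdr]
      have : x < d * (x / d + 1) := Nat.lt_mul_div_succ x hd
      have h3 : x ≤ 2 * (x / d) * d := by nlinarith
      exact_mod_cast h3
    have h3 := Real.log_le_log (by positivity) h2
    rw [Real.log_mul (by norm_num) h1r.ne'] at h3
    have := Real.log_two_lt_d9
    linarith
  · apply Real.log_le_log h1r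
    exact Nat.cast_div_le

/-- Asymptotics of the sums over multiples, uniformly for `d` almost totient-free. -/
lemma Ysum_asymp (η : ℝ) (hη : 0 < η) : ∃ δ : ℝ, 0 < δ ∧ ∀ᶠ m : ℕ in atTop, ∀ x d : ℕ, x ≤ m →
    Squarefree d → Nat.Coprime d m → (∑ q ∈ d.primeFactors, 1 / ((q : ℝ) - 1) ≤ δ) →
    ((d : ℝ) / d.totient ≤ 1 + δ) →
    |d * Ysum m x (fun _ => 1) d - gam m * max 0 (Real.log x - Real.log d)| ≤
      η * (gam m * Real.log m) := by
  have hη4 : 0 < min (η / 8) 1 := by positivity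
  refine ⟨min (η / 8) 1, hη4, ?_⟩
  filter_upwards [Gf_asymp _ hη4, ev_log (η/8) 1 (by positivity), eventually_ge_atTop 2] with
    m hG hlog hm2 x d hxm hd hdm hs hφ
  set δ := min (η / 8) 1
  have hδ1 : δ ≤ 1 := min_le_right _ _
  have hδη : δ ≤ η / 8 := min_le_left _ _
  have hd0 : 0 < d := Nat.pos_of_ne_zero hd.ne_zero
  have hg := gam_pos (m := m) (by omega)
  have hm1 : (2 : ℝ) ≤ m := by exact_mod_cast hm2
  have hL : 0 ≤ Real.log m := Real.log_nonneg (by linarith)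
  have hgL : 0 ≤ gam m * Real.log m := by positivity
  rcases lt_or_ge x d with h | h
  · rw [Ysum_zero m x d _ h, mul_zero, max_eq_left, mul_zero, sub_zero, abs_zero]
    · positivity
    · rcases Nat.eq_zero_or_pos x with rfl | hx
      · simp only [Nat.cast_zero, Real.log_zero, zero_sub, Left.neg_nonpos_iff]
        exact Real.log_nonneg (by exact_mod_cast hd0)
      · have := Real.log_le_log (by exact_mod_cast hx) (show (x : ℝ) ≤ d by exact_mod_cast h.le)
        linarith
  · have h1 : 1 ≤ x / d := (Nat.one_le_div_iff hd0).mpr h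
    have h2 := hG (x / d) h1 ((Nat.div_le_self _ _).trans hxm)
    have h3 := log_div_floor x d hd0 h
    have hup := Ysum_upper m x d hd hdm
    have hlo := Ysum_lower m x d hd hdm
    have hl := Real.log_le_log (by exact_mod_cast hd0) (show (d : ℝ) ≤ x by exact_mod_cast h)
    have hd1 : 0 ≤ Real.log d := Real.log_nonneg (by exact_mod_cast hd0)
    have hxL : Real.log x ≤ Real.log m :=
      Real.log_le_log (by exact_mod_cast hd0.trans_le h) (by exact_mod_cast hxm)
    rw [max_eq_right (by linarith)]
    set G := Gf m (x / d)
    set Y := (d : ℝ) * Ysum m x (fun _ => 1) d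
    set l := Real.log ((x / d : ℕ) : ℝ)
    have hG0 : 0 ≤ G := Gf_nonneg _ _
    have hGu : Y ≤ G + δ * G := by
      have := mul_le_mul_of_nonneg_right hφ hG0
      linarith
    have hGl : G - δ * G ≤ Y := by
      have := mul_le_mul_of_nonneg_left hs hG0
      linarith
    rw [abs_le] at h2 ⊢
    have e1 : gam m * l ≤ gam m * (Real.log x - Real.log d) :=
      mul_le_mul_of_nonneg_left h3.2 hg.le
    have e2 : gam m * (Real.log x - Real.log d - 1) ≤ gam m * l :=
      mul_le_mul_of_nonneg_left h3.1 hg.le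
    have e3 : gam m * 1 ≤ gam m * (η / 8 * Real.log m) := mul_le_mul_of_nonneg_left hlog hg.le
    have e4 : gam m * (Real.log x - Real.log d) ≤ gam m * Real.log m :=
      mul_le_mul_of_nonneg_left (by linarith) hg.le
    have e5 : δ * (gam m * Real.log m) ≤ 1 * (gam m * Real.log m) :=
      mul_le_mul_of_nonneg_right hδ1 hgL
    have e6 : δ * (gam m * Real.log m) ≤ η/8 * (gam m * Real.log m) :=
      mul_le_mul_of_nonneg_right hδη hgL
    have e7 : G ≤ 2 * (gam m * Real.log m) := by linarith
    have e8 : δ * G ≤ δ * (2 * (gam m * Real.log m)) := mul_le_mul_of_nonneg_left e7 hη4.le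
    constructor <;> nlinarith
end S17

namespace S17
open Finset Filter

noncomputable def rho : ℝ := 0.673 / 7.8
noncomputable def ell (m : ℕ) : ℝ := rho * Real.log m
/-- `⌊R ^ x⌋` where `R = m ^ rho`. -/
noncomputable def fl (m : ℕ) (x : ℝ) : ℕ := ⌊Real.exp (x * ell m)⌋₊

lemma rho_pos : 0 < rho := by unfold rho; norm_num

lemma ev_ell (C : ℝ) : ∀ᶠ m : ℕ in atTop, C ≤ ell m := by
  filter_upwards [ev_log rho C rho_pos] with m h using h

lemma fl_lt_iff (m : ℕ) (x : ℝ) (p : ℕ) : fl m x < p ↔ Real.exp (x * ell m) < p :=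
  Nat.floor_lt (Real.exp_pos _).le

lemma le_fl_iff (m : ℕ) (x : ℝ) (p : ℕ) : p ≤ fl m x ↔ (p : ℝ) ≤ Real.exp (x * ell m) :=
  Nat.le_floor_iff (Real.exp_pos _).le

lemma fl_le (m : ℕ) (x : ℝ) : (fl m x : ℝ) ≤ Real.exp (x * ell m) :=
  Nat.floor_le (Real.exp_pos _).le

lemma one_le_fl (m : ℕ) (x : ℝ) (h : 0 ≤ x * ell m) : 1 ≤ fl m x := by
  rw [le_fl_iff, Nat.cast_one]; exact Real.one_le_exp h

lemma fl_mono (m : ℕ) {x y : ℝ} (hl : 0 ≤ ell m) (h : x ≤ y) : fl m x ≤ fl m y := by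
  unfold fl
  exact Nat.floor_mono (Real.exp_le_exp.mpr (mul_le_mul_of_nonneg_right h hl))

lemma exp_le_two_fl (m : ℕ) (x : ℝ) (h : 0 ≤ x * ell m) :
    Real.exp (x * ell m) ≤ 2 * fl m x := by
  have h1 := one_le_fl m x h
  have h2 : Real.exp (x * ell m) < fl m x + 1 := Nat.lt_floor_add_one _
  have h3 : (1 : ℝ) ≤ fl m x := by exact_mod_cast h1
  linarith

lemma log_fl (m : ℕ) (x : ℝ) (h : 0 ≤ x * ell m) :
    x * ell m - 1 ≤ Real.log (fl m x) ∧ Real.log (fl m x) ≤ x * ell m := by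
  have h1 : (1 : ℝ) ≤ fl m x := by exact_mod_cast one_le_fl m x h
  constructor
  · have h2 := Real.log_le_log (Real.exp_pos _) (exp_le_two_fl m x h)
    rw [Real.log_exp, Real.log_mul (by norm_num) (by linarith)] at h2
    have := Real.log_two_lt_d9
    linarith
  · have h2 := Real.log_le_log (by linarith) (fl_le m x)
    rwa [Real.log_exp] at h2

lemma exp_ell (m : ℕ) (hm : 1 ≤ m) (x : ℝ) : Real.exp (x * ell m) = (m : ℝ) ^ (x * rho) := by
  have : (0 : ℝ) < m := by exact_mod_cast hm
  rw [Real.rpow_def_of_pos this]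
  unfold ell
  congr 1; ring

lemma fl_le_self (m : ℕ) (hm : 1 ≤ m) (x : ℝ) (hx : x * rho ≤ 1) : fl m x ≤ m := by
  have h1 : (1 : ℝ) ≤ m := by exact_mod_cast hm
  have : (fl m x : ℝ) ≤ m := by
    refine (fl_le m x).trans ?_
    rw [exp_ell m hm]
    calc (m : ℝ) ^ (x * rho) ≤ (m : ℝ) ^ (1 : ℝ) := Real.rpow_le_rpow_of_exponent_le h1 hx
      _ = m := Real.rpow_one _
  exact_mod_cast this

/-- The step weights. -/
noncomputable def yw (m r : ℕ) : ℝ :=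
  2 * (if r ≤ fl m 1 then 1 else 0) + (if r ≤ fl m (3/4) then 1 else 0) +
  (if r ≤ fl m (1/2) then 1 else 0) + (if r ≤ fl m (1/4) then 1 else 0)

lemma supp_filter (m D x : ℕ) (h : x ≤ D) : (supp m D).filter (fun r => r ≤ x) = supp m x := by
  ext r
  simp only [mem_filter, mem_supp]
  constructor
  · rintro ⟨⟨⟨a, b⟩, c⟩, d⟩; exact ⟨⟨a, d⟩, c⟩
  · rintro ⟨⟨a, d⟩, c⟩; exact ⟨⟨⟨a, d.trans h⟩, c⟩, d⟩

lemma Ysum_step (m D x d : ℕ) (h : x ≤ D) :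
    Ysum m D (fun r => if r ≤ x then 1 else 0) d = Ysum m x (fun _ => 1) d := by
  unfold Ysum
  rw [← supp_filter m D x h, Finset.sum_filter]
  apply Finset.sum_congr rfl
  intro r _
  by_cases h1 : r ≤ x <;> by_cases h2 : d ∣ r <;> simp [h1, h2]

lemma Ysum_yw (m d : ℕ) (hl : 0 ≤ ell m) :
    Ysum m (fl m 1) (yw m) d = 2 * Ysum m (fl m 1) (fun _ => 1) d +
      Ysum m (fl m (3/4)) (fun _ => 1) d + Ysum m (fl m (1/2)) (fun _ => 1) d +
      Ysum m (fl m (1/4)) (fun _ => 1) d := by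
  have e := fun x (hx : x ≤ 1) => Ysum_step m (fl m 1) (fl m x) d (fl_mono m hl hx)
  rw [← e (3/4) (by norm_num), ← e (1/2) (by norm_num), ← e (1/4) (by norm_num),
    ← e 1 le_rfl]
  unfold Ysum yw
  rw [Finset.mul_sum, ← Finset.sum_add_distrib, ← Finset.sum_add_distrib, ← Finset.sum_add_distrib]
  apply Finset.sum_congr rfl
  intro r _
  by_cases hdr : d ∣ r
  · simp only [hdr, if_true]; ring
  · simp only [hdr, if_false]; ring

/-- The limiting weight profile. -/
noncomputable def Fr (u : ℝ) : ℝ :=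
  2 * max 0 (1 - u) + max 0 (3/4 - u) + max 0 (1/2 - u) + max 0 (1/4 - u)

lemma dY_asymp (η : ℝ) (hη : 0 < η) : ∃ δ : ℝ, 0 < δ ∧ ∀ᶠ m : ℕ in atTop, ∀ d : ℕ,
    Squarefree d → Nat.Coprime d m → (∑ q ∈ d.primeFactors, 1 / ((q : ℝ) - 1) ≤ δ) →
    ((d : ℝ) / d.totient ≤ 1 + δ) →
    |d * Ysum m (fl m 1) (yw m) d - gam m * ell m * Fr (Real.log d / ell m)| ≤
      η * (gam m * ell m) := by
  have hr := rho_pos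
  obtain ⟨δ, hδ, hev⟩ := Ysum_asymp (η * rho / 10) (by positivity)
  refine ⟨δ, hδ, ?_⟩
  filter_upwards [hev, ev_ell (10 / η + 1), eventually_ge_atTop 1] with m h hell hm d h1 h2 h3 h4
  have hell0 : 0 < ell m := by have : 0 < 10 / η := by positivity
                               linarith
  have hg := gam_pos (m := m) (by omega)
  have key : ∀ x : ℝ, 0 ≤ x → x ≤ 1 →
      |d * Ysum m (fl m x) (fun _ => 1) d - gam m * ell m * max 0 (x - Real.log d / ell m)| ≤
      η / 5 * (gam m * ell m) := by
    intro x hx0 hx1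
    have hk := h (fl m x) d (fl_le_self m hm x (by
      have : rho ≤ 1 := by unfold rho; norm_num
      nlinarith)) h1 h2 h3 h4
    have hlf := log_fl m x (by positivity)
    have e1 : ell m * max 0 (x - Real.log d / ell m) = max 0 (x * ell m - Real.log d) := by
      rw [mul_max_of_nonneg _ _ hell0.le, mul_zero, mul_sub, mul_div_cancel₀ _ hell0.ne', mul_comm]
    rw [mul_assoc, e1]
    have e2 : |max 0 (Real.log (fl m x) - Real.log d) - max 0 (x * ell m - Real.log d)| ≤ 1 := by
      refine (abs_max_sub_max_le_max _ _ _ _).trans ?_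
      rw [sub_self, abs_zero]
      apply max_le (by norm_num)
      rw [abs_le]; constructor <;> linarith [hlf.1, hlf.2]
    have e3 : gam m * 1 ≤ gam m * (η / 10 * ell m) := by
      apply mul_le_mul_of_nonneg_left _ hg.le
      have : 10 / η ≤ ell m := by linarith
      rw [div_le_iff₀ hη] at this
      linarith
    have e4 : η * rho / 10 * (gam m * Real.log m) = η / 10 * (gam m * ell m) := by
      unfold ell; ring
    rw [e4] at hk
    have e5 : |gam m * max 0 (Real.log (fl m x) - Real.log d) -
        gam m * max 0 (x * ell m - Real.log d)| ≤ gam m * 1 := by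
      rw [← mul_sub, abs_mul, abs_of_pos hg]
      exact mul_le_mul_of_nonneg_left e2 hg.le
    rw [abs_le] at hk e5 ⊢
    constructor <;> linarith [hk.1, hk.2, e5.1, e5.2]
  rw [Ysum_yw m d hell0.le]
  have k1 := key 1 (by norm_num) (by norm_num)
  have k2 := key (3/4) (by norm_num) (by norm_num)
  have k3 := key (1/2) (by norm_num) (by norm_num)
  have k4 := key (1/4) (by norm_num) (by norm_num)
  unfold Fr
  rw [abs_le] at *
  constructor <;> linarith [k1.1, k1.2, k2.1, k2.2, k3.1, k3.2, k4.1, k4.2]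

/-- The sieve weight. -/
noncomputable def Lam (m n : ℕ) : ℝ := LamD (lamS m (fl m 1) (yw m)) (fl m 1) n

lemma LamD_coprime (lam : ℕ → ℝ) (D s b : ℕ) (hb : ∀ p : ℕ, p.Prime → p ∣ b → D < p) :
    LamD lam D (s * b) = LamD lam D s := by
  unfold LamD
  apply Finset.sum_congr rfl
  intro d hd
  rw [mem_Icc] at hd
  have hc : Nat.Coprime d b := by
    by_contra hc
    obtain ⟨q, hqp, hqt, hqd⟩ := Nat.Prime.not_coprime_iff_dvd.mp hc
    have := hb q hqp hqd
    have := Nat.le_of_dvd hd.1 hqt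
    omega
  have : d ∣ s * b ↔ d ∣ s := ⟨fun h => hc.dvd_of_dvd_mul_right h, fun h => h.mul_right b⟩
  simp only [this]

lemma LamD_divisors (m D : ℕ) (y : ℕ → ℝ) (s : ℕ) (hs : s ≠ 0) :
    LamD (lamS m D y) D s = ∑ d ∈ s.divisors, lamS m D y d := by
  unfold LamD
  rw [← Finset.sum_filter]
  apply Finset.sum_subset
  · intro d hd
    rw [mem_filter] at hd
    exact Nat.mem_divisors.mpr ⟨hd.2, hs⟩
  · intro d hd hnd
    rw [mem_filter, mem_Icc, not_and] at hnd
    have h1 := Nat.pos_of_mem_divisors hd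
    have h2 := Nat.dvd_of_mem_divisors hd
    have : D < d := by
      by_contra hc
      exact hnd ⟨h1, by omega⟩ h2
    unfold lamS
    rw [Ysum_zero m D d y this, mul_zero]

lemma Lam_one (m : ℕ) : Lam m 1 = (1 : ℕ) * Ysum m (fl m 1) (yw m) 1 := by
  unfold Lam
  rw [LamD_divisors _ _ _ _ one_ne_zero, Nat.divisors_one, Finset.sum_singleton]
  simp [lamS]

lemma Lam_prime (m q : ℕ) (hq : q.Prime) : Lam m q = (1 : ℕ) * Ysum m (fl m 1) (yw m) 1 -
    q * Ysum m (fl m 1) (yw m) q := by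
  unfold Lam
  rw [LamD_divisors _ _ _ _ hq.ne_zero, Nat.Prime.sum_divisors hq]
  unfold lamS
  rw [ArithmeticFunction.moebius_apply_prime hq]
  simp; ring

lemma Lam_pair (m q r : ℕ) (hq : q.Prime) (hr : r.Prime) (hqr : q ≠ r) :
    Lam m (q * r) = (1 : ℕ) * Ysum m (fl m 1) (yw m) 1 -
    q * Ysum m (fl m 1) (yw m) q - r * Ysum m (fl m 1) (yw m) r +
    (q * r : ℕ) * Ysum m (fl m 1) (yw m) (q * r) := by
  have hc : Nat.Coprime q r := (Nat.coprime_primes hq hr).mpr hqr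
  have h1qr : 1 ≠ q * r := by
    have := hq.two_le
    have := hr.two_le
    nlinarith
  have hdv : (q * r).divisors = {1, q, r, q * r} := by
    ext d
    rw [Nat.divisors_mul, Nat.Prime.divisors hq, Nat.Prime.divisors hr, Finset.mem_mul]
    simp only [mem_insert, mem_singleton]
    constructor
    · rintro ⟨a, rfl | rfl, b, rfl | rfl, rfl⟩ <;> simp
    · rintro (rfl | rfl | rfl | rfl)
      · exact ⟨1, by simp, 1, by simp, by simp⟩
      · exact ⟨d, by simp, 1, by simp, by simp⟩
      · exact ⟨1, by simp, d, by simp, by simp⟩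
      · exact ⟨q, by simp, r, by simp, by simp⟩
  unfold Lam
  rw [LamD_divisors _ _ _ _ (Nat.mul_ne_zero hq.ne_zero hr.ne_zero),
    hdv, Finset.sum_insert (by simp [hq.one_lt.ne, hr.one_lt.ne, h1qr]),
    Finset.sum_insert (by simp [hqr, hr.ne_one, hq.ne_zero]),
    Finset.sum_insert (by simp [hq.ne_one, hr.ne_zero]), Finset.sum_singleton]
  unfold lamS
  rw [ArithmeticFunction.isMultiplicative_moebius.map_mul_of_coprime hc,
    ArithmeticFunction.moebius_apply_prime hq, ArithmeticFunction.moebius_apply_prime hr]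
  simp; ring

end S17

namespace S17
open Finset Filter

lemma sf_prime {q : ℕ} (hq : q.Prime) (e : ℝ) (h : 1 / ((q : ℝ) - 1) ≤ e) :
    (q : ℝ) / q.totient ≤ 1 + e := by
  rw [Nat.totient_prime hq, Nat.cast_sub hq.one_le, Nat.cast_one]
  have : (2 : ℝ) ≤ q := by exact_mod_cast hq.two_le
  have e1 : (q : ℝ) / (q - 1) = 1 + 1 / ((q : ℝ) - 1) := by
    field_simp [show (q : ℝ) - 1 ≠ 0 by linarith]; ring
  linarith

lemma Lam_lower (η : ℝ) (hη : 0 < η) : ∀ᶠ m : ℕ in atTop,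
    (gam m * ell m * (Fr 0 - η) ≤ Lam m 1) ∧
    (∀ q : ℕ, q.Prime → ¬ q ∣ m → Real.exp (1 / 10 * ell m) < q →
      gam m * ell m * (Fr 0 - Fr (Real.log q / ell m) - η) ≤ Lam m q) ∧
    (∀ q r : ℕ, q.Prime → ¬ q ∣ m → Real.exp (1 / 10 * ell m) < q → r.Prime → ¬ r ∣ m →
      Real.exp (1 / 10 * ell m) < r → q ≠ r →
      gam m * ell m * (Fr 0 - Fr (Real.log q / ell m) - Fr (Real.log r / ell m)
        + Fr (Real.log q / ell m + Real.log r / ell m) - η) ≤ Lam m (q * r)) := by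
  obtain ⟨δ, hδ, hev⟩ := dY_asymp (η / 4) (by positivity)
  have hδ3 : 0 < min (δ / 3) 1 := by positivity
  filter_upwards [hev, ev_ell (10 * (1 / min (δ / 3) 1)), ev_ell 1, eventually_ge_atTop 1] with
    m h hell hell1 hm
  set e := min (δ / 3) 1
  have he1 : e ≤ 1 := min_le_right _ _
  have heδ : 3 * e ≤ δ := by have : e ≤ δ / 3 := min_le_left _ _
                             linarith
  have hbig : ∀ q : ℕ, Real.exp (1 / 10 * ell m) < q → 1 / ((q : ℝ) - 1) ≤ e := by
    intro q hq
    have h1 := Real.add_one_le_exp (1 / 10 * ell m)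
    have h2 : 1 / e ≤ (q : ℝ) - 1 := by linarith
    rw [div_le_iff₀ (by have : 0 < 1 / e := by positivity
                        linarith)]
    rw [div_le_iff₀ hδ3] at h2
    linarith
  have hY1 := h 1 squarefree_one (Nat.coprime_one_left m) (by simp [hδ.le]) (by simp [hδ.le])
  have hYq : ∀ q : ℕ, q.Prime → ¬ q ∣ m → Real.exp (1 / 10 * ell m) < q → _ := fun q h1 h2 h3 =>
    h q h1.squarefree ((Nat.Prime.coprime_iff_not_dvd h1).mpr h2) (by
      rw [Nat.Prime.primeFactors h1, Finset.sum_singleton]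
      have := hbig q h3
      linarith) (by
      have := sf_prime h1 e (hbig q h3)
      linarith)
  rw [← Lam_one, Nat.cast_one, Real.log_one, zero_div] at hY1
  have hgl : 0 ≤ gam m * ell m := mul_nonneg (gam_pos (by omega)).le (by linarith)
  refine ⟨?_, ?_, ?_⟩
  · have := (abs_le.mp hY1).1
    nlinarith
  · intro q h1 h2 h3
    have a1 := (abs_le.mp hY1).1
    have a2 := (abs_le.mp (hYq q h1 h2 h3)).2
    rw [Lam_prime m q h1, ← Lam_one]
    nlinarith
  · intro q r h1 h2 h3 g1 g2 g3 hqr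
    have a1 := (abs_le.mp hY1).1
    have a2 := (abs_le.mp (hYq q h1 h2 h3)).2
    have a3 := (abs_le.mp (hYq r g1 g2 g3)).2
    have hc : Nat.Coprime q r := (Nat.coprime_primes h1 g1).mpr hqr
    have a4 := h (q * r) ((Nat.squarefree_mul hc).mpr ⟨h1.squarefree, g1.squarefree⟩)
      (Nat.Coprime.mul_left ((Nat.Prime.coprime_iff_not_dvd h1).mpr h2)
        ((Nat.Prime.coprime_iff_not_dvd g1).mpr g2)) (by
        rw [Nat.Coprime.primeFactors_mul hc, Finset.sum_union hc.disjoint_primeFactors,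
          Nat.Prime.primeFactors h1, Nat.Prime.primeFactors g1, Finset.sum_singleton,
          Finset.sum_singleton]
        have := hbig q h3
        have := hbig r g3
        linarith) (by
        have b1 := sf_prime h1 e (hbig q h3)
        have b2 := sf_prime g1 e (hbig r g3)
        rw [Nat.totient_mul hc]
        push_cast
        rw [mul_div_mul_comm]
        have b3 : (q : ℝ) / q.totient * (r / r.totient) ≤ (1 + e) * (1 + e) :=
          mul_le_mul b1 b2 (by positivity) (by linarith)
        nlinarith)
    have a5 := (abs_le.mp a4).1
    have hlog : Real.log ((q * r : ℕ) : ℝ) / ell m = Real.log q / ell m + Real.log r / ell m := by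
      push_cast
      rw [Real.log_mul (by exact_mod_cast h1.ne_zero) (by exact_mod_cast g1.ne_zero), add_div]
    rw [hlog] at a5
    rw [Lam_pair m q r h1 g1 hqr, ← Lam_one]
    nlinarith

lemma max_anti (t u u0 : ℝ) (h : u0 ≤ u) : max 0 (t - u) ≤ max 0 (t - u0) :=
  max_le_max le_rfl (by linarith)

lemma Fr_anti (u u0 : ℝ) (h : u0 ≤ u) : Fr u ≤ Fr u0 := by
  unfold Fr
  have := max_anti 1 u u0 h
  have := max_anti (3/4) u u0 h
  have := max_anti (1/2) u u0 h
  have := max_anti (1/4) u u0 h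
  linarith

lemma max_conv (t u u0 v : ℝ) (h : u0 ≤ u) (hv : 0 ≤ v) :
    max 0 (t - u) + max 0 (t - (u0 + v)) ≤ max 0 (t - u0) + max 0 (t - (u + v)) := by
  rcases max_cases 0 (t - u) with ⟨h1, _⟩ | ⟨h1, _⟩ <;>
  rcases max_cases 0 (t - (u0 + v)) with ⟨h2, _⟩ | ⟨h2, _⟩ <;>
  rcases max_cases 0 (t - u0) with ⟨h3, _⟩ | ⟨h3, _⟩ <;>
  rcases max_cases 0 (t - (u + v)) with ⟨h4, _⟩ | ⟨h4, _⟩ <;>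
  rw [h1, h2, h3, h4] <;> linarith

lemma Fr_conv (u u0 v : ℝ) (h : u0 ≤ u) (hv : 0 ≤ v) :
    Fr u + Fr (u0 + v) ≤ Fr u0 + Fr (u + v) := by
  unfold Fr
  have := max_conv 1 u u0 v h hv
  have := max_conv (3/4) u u0 v h hv
  have := max_conv (1/2) u u0 v h hv
  have := max_conv (1/4) u u0 v h hv
  linarith

lemma Fr_pair (u u0 v v0 : ℝ) (h : u0 ≤ u) (hv : v0 ≤ v) (hu0 : 0 ≤ u0) (hv0 : 0 ≤ v0) :
    Fr (u0 + v0) - Fr u0 - Fr v0 ≤ Fr (u + v) - Fr u - Fr v := by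
  have h1 := Fr_conv u u0 v0 h hv0
  have h2 := Fr_conv v v0 u hv (hu0.trans h)
  rw [add_comm v0 u, add_comm v u] at h2
  linarith

/-- Integer form of the profile. -/
def Fn (i : ℕ) : ℕ := 2 * (60 - i) + (45 - i) + (30 - i) + (15 - i)

lemma Fr_cast (i : ℕ) : Fr ((i : ℝ) / 60) = (Fn i : ℝ) / 60 := by
  have key : ∀ t : ℕ, max 0 ((t : ℝ) / 60 - i / 60) = ((t - i : ℕ) : ℝ) / 60 := by
    intro t
    rcases le_total i t with h | h
    · rw [Nat.cast_sub h, max_eq_right, sub_div]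
      rw [← sub_div]
      have : (i : ℝ) ≤ t := by exact_mod_cast h
      apply div_nonneg <;> linarith
    · rw [Nat.sub_eq_zero_of_le h, max_eq_left]
      · simp
      · have : (t : ℝ) ≤ i := by exact_mod_cast h
        linarith
  unfold Fr Fn
  have k1 := key 60
  have k2 := key 45
  have k3 := key 30
  have k4 := key 15
  norm_num at k1 k2 k3 k4
  push_cast
  rw [show (1 : ℝ) - i/60 = 1 - i / 60 by rfl, k1, show (3:ℝ)/4 - i / 60 = 3/4 - i/60 by rfl, k2, k3, k4]
  ring

lemma Fr_zero : Fr 0 = 7 / 2 := by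
  unfold Fr; norm_num

end S17

namespace S17
open Finset Filter

/-- Double counting of pairs `(b', p)` through the products `b' * p`. -/
lemma dc {ι : Type*} (Q : Finset ι) (bb pp : ι → ℕ) (X : Finset ℕ) (g : ℕ → ℝ) (C : ℝ)
    (hinj : ∀ x ∈ Q, ∀ y ∈ Q, bb x = bb y → pp x = pp y → x = y)
    (hp : ∀ x ∈ Q, (pp x).Prime ∧ bb x * pp x ∈ X)
    (hg : ∀ b ∈ X, ∀ p ∈ b.primeFactors, 0 ≤ g p)
    (hC : ∀ b ∈ X, ∑ p ∈ b.primeFactors, g p ≤ C) (hX : ∀ b ∈ X, 1 ≤ b) :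
    ∑ x ∈ Q, 1 / (bb x : ℝ) * (g (pp x) / pp x) ≤ C * ∑ b ∈ X, 1 / (b : ℝ) := by
  classical
  have h1 : ∑ b ∈ X, ∑ p ∈ b.primeFactors, 1 / (b : ℝ) * g p ≤ C * ∑ b ∈ X, 1 / (b : ℝ) := by
    rw [Finset.mul_sum]
    apply Finset.sum_le_sum
    intro b hb
    rw [← Finset.mul_sum, mul_comm C]
    exact mul_le_mul_of_nonneg_left (hC b hb) (by positivity)
  refine le_trans ?_ h1
  rw [Finset.sum_sigma' X (fun b => b.primeFactors) (fun b p => 1 / (b : ℝ) * g p)]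
  have hi : Set.InjOn (fun x => (⟨bb x * pp x, pp x⟩ : (_ : ℕ) × ℕ)) (Q : Set ι) := by
    intro x hx y hy hxy
    simp only [Sigma.mk.injEq, heq_eq_eq] at hxy
    refine hinj x hx y hy ?_ hxy.2
    have h := hxy.1
    rw [hxy.2] at h
    exact Nat.eq_of_mul_eq_mul_right (hp y hy).1.pos h
  have h2 : ∑ x ∈ Q, 1 / (bb x : ℝ) * (g (pp x) / pp x) =
      ∑ y ∈ Q.image (fun x => (⟨bb x * pp x, pp x⟩ : (_ : ℕ) × ℕ)), 1 / (y.1 : ℝ) * g y.2 := by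
    rw [Finset.sum_image hi]
    apply Finset.sum_congr rfl
    intro x hx
    push_cast
    rw [one_div_mul_eq_div, one_div_mul_eq_div, div_div, mul_comm]
  rw [h2]
  apply Finset.sum_le_sum_of_subset_of_nonneg
  · intro y hy
    obtain ⟨x, hx, rfl⟩ := Finset.mem_image.mp hy
    obtain ⟨a1, a2⟩ := hp x hx
    rw [mem_sigma]
    refine ⟨a2, Nat.mem_primeFactors.mpr ⟨a1, dvd_mul_left _ _, ?_⟩⟩
    have := hX _ a2
    dsimp only; omega
  · intro y hy _
    rw [mem_sigma] at hy
    exact mul_nonneg (by positivity) (hg _ hy.1 _ hy.2)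

/-- All prime factors exceed `D`. -/
def Rough (D b : ℕ) : Prop := ∀ p : ℕ, p.Prime → p ∣ b → D < p

lemma Rough_mul {D b p : ℕ} (hb : Rough D b) (hp : p.Prime) (hD : D < p) : Rough D (b * p) := by
  intro q hq hqd
  rcases (Nat.Prime.dvd_mul hq).mp hqd with h | h
  · exact hb q hq h
  · rwa [(Nat.prime_dvd_prime_iff_eq hq hp).mp h]

open Classical in
noncomputable def Bk (m D k : ℕ) (Z : ℝ) : Finset ℕ := (Icc 1 ⌊Z⌋₊).filter
  (fun b => ArithmeticFunction.cardFactors b = k ∧ Nat.Coprime b m ∧ Rough D b)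

lemma mem_Bk {m D k b : ℕ} {Z : ℝ} (hZ : 0 ≤ Z) : b ∈ Bk m D k Z ↔ (1 ≤ b ∧ (b : ℝ) ≤ Z) ∧
    ArithmeticFunction.cardFactors b = k ∧ Nat.Coprime b m ∧ Rough D b := by
  unfold Bk
  classical
  rw [mem_filter, mem_Icc, Nat.le_floor_iff hZ]

noncomputable def alp (m D k : ℕ) (Z : ℝ) : ℝ := ∑ b ∈ Bk m D k Z, 1 / (b : ℝ)

lemma alp_nonneg (m D k : ℕ) (Z : ℝ) : 0 ≤ alp m D k Z :=
  Finset.sum_nonneg fun _ _ => by positivity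

lemma alp_mono (m D k : ℕ) {Z Z2 : ℝ} (hZ : 0 ≤ Z) (h : Z ≤ Z2) : alp m D k Z ≤ alp m D k Z2 := by
  unfold alp
  apply Finset.sum_le_sum_of_subset_of_nonneg
  · intro b hb
    rw [mem_Bk hZ] at hb
    rw [mem_Bk (hZ.trans h)]
    exact ⟨⟨hb.1.1, hb.1.2.trans h⟩, hb.2⟩
  · intros; positivity

lemma alp_zero (m D : ℕ) (Z : ℝ) (hZ : 1 ≤ Z) : 1 ≤ alp m D 0 Z := by
  have h1 : 1 ∈ Bk m D 0 Z := by
    rw [mem_Bk (by linarith)]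
    refine ⟨⟨le_rfl, by simpa using hZ⟩, by simp, Nat.coprime_one_left m, ?_⟩
    intro p hp h
    exact absurd (Nat.dvd_one.mp h) hp.ne_one
  have := Finset.single_le_sum (f := fun b : ℕ => 1 / (b : ℝ)) (fun b _ => by positivity) h1
  unfold alp
  simpa using this

/-- Prime cells on the logarithmic grid of mesh `1 / J`. -/
noncomputable def cl (m J j : ℕ) : Finset ℕ := Pr m (fl m ((j : ℝ) / J)) (fl m (((j : ℝ) + 1) / J))

lemma mem_cl {m J j p : ℕ} : p ∈ cl m J j ↔ (Real.exp ((j : ℝ) / J * ell m) < p ∧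
    (p : ℝ) ≤ Real.exp (((j : ℝ) + 1) / J * ell m)) ∧ p.Prime ∧ ¬ p ∣ m := by
  unfold cl
  rw [mem_Pr, fl_lt_iff, le_fl_iff]

lemma cl_disj {m J j i p : ℕ} (hJ : 0 < J) (hl : 0 < ell m) (h1 : p ∈ cl m J j)
    (h2 : p ∈ cl m J i) : j = i := by
  have key : ∀ a b : ℕ, p ∈ cl m J a → p ∈ cl m J b → a ≤ b := by
    intro a b ha hb
    rw [mem_cl] at ha hb
    have h3 := Real.exp_lt_exp.mp (ha.1.1.trans_le hb.1.2)
    have h4 := lt_of_mul_lt_mul_right h3 hl.le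
    have hJr : (0 : ℝ) < J := by exact_mod_cast hJ
    rw [div_lt_div_iff_of_pos_right hJr] at h4
    have : a < b + 1 := by exact_mod_cast h4
    omega
  exact le_antisymm (key _ _ h1 h2) (key _ _ h2 h1)

lemma cell_one (J : ℕ) (hJ : 0 < J) (η : ℝ) (hη : 0 < η) : ∀ᶠ m : ℕ in atTop, ∀ j : ℕ,
    J ≤ 20 * j → (1 - η) / ((j : ℝ) + 1) ≤ ∑ p ∈ cl m J j, 1 / (p : ℝ) := by
  have hr := rho_pos
  obtain ⟨C, hC, hev⟩ := prime_window (rho / 40) (by positivity)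
  filter_upwards [hev, ev_ell 40, ev_ell ((C + 1) * J / η), eventually_ge_atTop 1]
    with m h hell hell2 hm j hj
  have hJr : (0 : ℝ) < J := by exact_mod_cast hJ
  have hl : 0 < ell m := by linarith
  have hj0 : (0 : ℝ) ≤ (j : ℝ) / J * ell m := by positivity
  have hj1 : (0 : ℝ) ≤ ((j : ℝ) + 1) / J * ell m := by positivity
  have hjJ : 1 / 20 ≤ (j : ℝ) / J := by
    rw [le_div_iff₀ hJr]
    have : (J : ℝ) ≤ 20 * j := by exact_mod_cast hj
    linarith
  have hw := h (fl m ((j : ℝ) / J)) (fl m (((j : ℝ) + 1) / J)) (by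
    have e1 := exp_le_two_fl m _ hj0
    have e2 : (m : ℝ) ^ (rho / 40) = Real.exp (1 / 40 * ell m) := by
      rw [exp_ell m hm]; congr 1; ring
    rw [e2]
    have e3 : Real.exp (1 / 40 * ell m) * Real.exp (1 / 40 * ell m) ≤
        Real.exp ((j : ℝ) / J * ell m) := by
      rw [← Real.exp_add]
      apply Real.exp_le_exp.mpr
      nlinarith
    have e4 := Real.add_one_le_exp (1 / 40 * ell m)
    nlinarith) (fl_mono m hl.le (by gcongr; linarith))
  have l1 := log_fl m _ hj0
  have l2 := log_fl m _ hj1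
  have hlow := (abs_le.mp hw).1
  have hup : ∑ p ∈ cl m J j, Real.log p / p ≤
      (((j : ℝ) + 1) / J * ell m) * ∑ p ∈ cl m J j, 1 / (p : ℝ) := by
    rw [Finset.mul_sum]
    apply Finset.sum_le_sum
    intro p hp
    rw [mem_cl] at hp
    rw [mul_one_div]
    apply div_le_div_of_nonneg_right _ (by positivity)
    have := Real.log_le_log (by exact_mod_cast hp.2.1.pos) hp.1.2
    rwa [Real.log_exp] at this
  change _ ≤ ∑ p ∈ cl m J j, Real.log p / p - _ at hlow
  set Sg := ∑ p ∈ cl m J j, 1 / (p : ℝ)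
  have e1 : ((j : ℝ) + 1) / J * ell m - j / J * ell m = ell m / J := by ring
  have e2 : ell m / J - C - 1 ≤ ((j : ℝ) + 1) / J * ell m * Sg := by linarith
  have e3 : C + 1 ≤ η * (ell m / J) := by
    rw [div_le_iff₀ hη] at hell2
    rw [← mul_div_assoc, le_div_iff₀ hJr]; linarith
  rw [div_le_iff₀ (by positivity)]
  have e4 : (1 - η) * (ell m / J) ≤ (Sg * (j + 1)) * (ell m / J) := by
    have : ((j : ℝ) + 1) / J * ell m * Sg = (Sg * (j + 1)) * (ell m / J) := by ring
    linarith
  exact le_of_mul_le_mul_right e4 (by positivity)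

/-- Scaled lower bounds for the reciprocal mass of a cell. -/
def wN (j : ℕ) : ℕ := ∑ t ∈ range 10, 10 ^ 7 / (10 * j + t + 1)

lemma cell_sum (J : ℕ) (hJ : 0 < J) (η : ℝ) (hη : 0 < η) (hη1 : η < 1) :
    ∀ᶠ m : ℕ in atTop, ∀ j : ℕ,
    J ≤ 10 * j → (1 - η) * ((wN j : ℝ) / 10 ^ 7) ≤ ∑ p ∈ cl m J j, 1 / (p : ℝ) := by
  filter_upwards [cell_one (10 * J) (by omega) η hη, ev_ell 1] with m h hell j hj
  have hl : 0 < ell m := by linarith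
  have hJr : (0 : ℝ) < J := by exact_mod_cast hJ
  have h1 : ∑ t ∈ range 10, ∑ p ∈ cl m (10 * J) (10 * j + t), 1 / (p : ℝ) ≤
      ∑ p ∈ cl m J j, 1 / (p : ℝ) := by
    rw [← Finset.sum_biUnion]
    · apply Finset.sum_le_sum_of_subset_of_nonneg
      · intro p hp
        rw [mem_biUnion] at hp
        obtain ⟨t, ht, hp⟩ := hp
        rw [mem_cl] at hp ⊢
        rw [mem_range] at ht
        have htr : (t : ℝ) + 1 ≤ 10 := by exact_mod_cast ht
        push_cast at hp
        refine ⟨⟨lt_of_le_of_lt ?_ hp.1.1, hp.1.2.trans ?_⟩, hp.2⟩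
        · apply Real.exp_le_exp.mpr
          apply mul_le_mul_of_nonneg_right _ hl.le
          rw [div_le_div_iff₀ hJr (by positivity)]
          have : (0 : ℝ) ≤ t := by positivity
          nlinarith
        · apply Real.exp_le_exp.mpr
          apply mul_le_mul_of_nonneg_right _ hl.le
          rw [div_le_div_iff₀ (by positivity) hJr]
          nlinarith
      · intros; positivity
    · intro a _ b _ hab
      rw [Function.onFun, Finset.disjoint_left]
      intro p hp hq
      have := cl_disj (by omega) hl hp hq
      omega
  refine le_trans ?_ h1
  unfold wN
  push_cast
  rw [Finset.sum_div, Finset.mul_sum]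
  apply Finset.sum_le_sum
  intro t _
  refine le_trans ?_ (h (10 * j + t) (by omega))
  have e1 : ((10 ^ 7 / (10 * j + t + 1) : ℕ) : ℝ) ≤ (10 : ℝ) ^ 7 / ((10 * j + t : ℕ) + 1) := by
    have := Nat.cast_div_le (α := ℝ) (m := 10 ^ 7) (n := 10 * j + t + 1)
    push_cast at this ⊢
    norm_num at this ⊢
    exact this
  rw [mul_div_assoc', div_le_div_iff₀ (by norm_num) (by positivity)]
  rw [le_div_iff₀ (by positivity)] at e1
  nlinarith

lemma dp (m : ℕ) (hl : 0 < ell m) (θ : ℝ) (hθ : 0 ≤ θ)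
    (hc : ∀ j : ℕ, 12 ≤ j → θ * ((wN j : ℝ) / 10 ^ 7) ≤ ∑ p ∈ cl m 12 j, 1 / (p : ℝ))
    (aT : ℕ → ℕ → ℕ) (Zm : ℕ) (h0 : ∀ z ≤ Zm, aT 0 z ≤ 10 ^ 6)
    (hs : ∀ k < 3, ∀ z ≤ Zm, (k + 1) * 10 ^ 7 * aT (k + 1) z ≤
      ∑ j ∈ Ico 12 z, wN j * aT k (z - j - 1)) :
    ∀ k ≤ 3, ∀ z ≤ Zm, θ ^ k * ((aT k z : ℝ) / 10 ^ 6) ≤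
      alp m (fl m 1) k (Real.exp ((z : ℝ) / 12 * ell m)) := by
  intro k
  induction k with
  | zero =>
    intro _ z hz
    have h1 := alp_zero m (fl m 1) (Real.exp ((z : ℝ) / 12 * ell m))
      (Real.one_le_exp (by positivity))
    have h2 : (aT 0 z : ℝ) ≤ 10 ^ 6 := by exact_mod_cast h0 z hz
    rw [pow_zero, one_mul]
    refine le_trans ?_ h1
    rw [div_le_one (by norm_num)]; exact h2
  | succ k ih =>
    intro hk z hz
    set D := fl m 1
    set Z := Real.exp ((z : ℝ) / 12 * ell m) with hZ
    have hZ0 : 0 ≤ Z := (Real.exp_pos _).le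
    let Q : Finset ((_ : ℕ) × ((_ : ℕ) × ℕ)) := (Ico 12 z).sigma fun j => (cl m 12 j).sigma fun _ =>
      Bk m D k (Real.exp (((z - j - 1 : ℕ) : ℝ) / 12 * ell m))
    have hdc := dc Q (fun x => x.2.2) (fun x => x.2.1) (Bk m D (k + 1) Z) (fun _ => 1) (k + 1)
      (by
        rintro ⟨j, p, b⟩ hx ⟨j2, p2, b2⟩ hy h1 h2
        simp only [Q, mem_sigma] at hx hy
        simp only at h1 h2
        subst h1 h2
        have := cl_disj (by norm_num) hl hx.2.1 hy.2.1
        subst this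
        rfl)
      (by
        rintro ⟨j, p, b⟩ hx
        simp only [Q, mem_sigma, mem_Ico] at hx
        obtain ⟨⟨hj1, hj2⟩, hp, hb⟩ := hx
        rw [mem_Bk (Real.exp_pos _).le] at hb
        rw [mem_cl] at hp
        refine ⟨hp.2.1, ?_⟩
        rw [mem_Bk hZ0]
        dsimp only
        have hDp : D < p := by
          rw [fl_lt_iff]
          refine lt_of_le_of_lt ?_ hp.1.1
          apply Real.exp_le_exp.mpr
          apply mul_le_mul_of_nonneg_right _ hl.le
          rw [le_div_iff₀ (by norm_num)]
          have : (12 : ℝ) ≤ j := by exact_mod_cast hj1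
          push_cast
          linarith
        refine ⟨⟨Nat.mul_pos hb.1.1 hp.2.1.pos, ?_⟩, ?_, ?_, ?_⟩
        · push_cast
          calc (b : ℝ) * p ≤ _ := mul_le_mul hb.1.2 hp.1.2 (by positivity) (Real.exp_pos _).le
            _ = Z := by
              rw [hZ, ← Real.exp_add, Nat.cast_sub (by omega), Nat.cast_sub (by omega)]
              congr 1
              push_cast
              ring
        · rw [ArithmeticFunction.cardFactors_mul (by omega) hp.2.1.ne_zero, hb.2.1,
            ArithmeticFunction.cardFactors_apply_prime hp.2.1]
        · exact Nat.Coprime.mul_left hb.2.2.1 ((Nat.Prime.coprime_iff_not_dvd hp.2.1).mpr hp.2.2)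
        · exact Rough_mul hb.2.2.2 hp.2.1 hDp)
      (by intros; norm_num)
      (by
        intro b hb
        rw [mem_Bk hZ0] at hb
        simp only [Finset.sum_const, nsmul_eq_mul, mul_one]
        have h1 : b.primeFactors.card ≤ k + 1 := by
          rw [← hb.2.1]
          exact List.toFinset_card_le _
        exact_mod_cast h1)
      (by
        intro b hb
        rw [mem_Bk hZ0] at hb
        exact hb.1.1)
    have hQ : ∑ x ∈ Q, 1 / (x.2.2 : ℝ) * (1 / (x.2.1 : ℝ)) =
        ∑ j ∈ Ico 12 z, (∑ p ∈ cl m 12 j, 1 / (p : ℝ)) *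
          alp m D k (Real.exp (((z - j - 1 : ℕ) : ℝ) / 12 * ell m)) := by
      rw [Finset.sum_sigma]
      apply Finset.sum_congr rfl
      intro j _
      rw [Finset.sum_sigma, Finset.sum_mul]
      apply Finset.sum_congr rfl
      intro p _
      unfold alp
      rw [Finset.mul_sum]
      apply Finset.sum_congr rfl
      intro b _
      ring
    rw [hQ] at hdc
    have hlow : θ ^ (k + 1) * ((∑ j ∈ Ico 12 z, wN j * aT k (z - j - 1) : ℕ) : ℝ) / 10 ^ 13 ≤
        ∑ j ∈ Ico 12 z, (∑ p ∈ cl m 12 j, 1 / (p : ℝ)) *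
          alp m D k (Real.exp (((z - j - 1 : ℕ) : ℝ) / 12 * ell m)) := by
      push_cast
      rw [Finset.mul_sum, Finset.sum_div]
      apply Finset.sum_le_sum
      intro j hj
      rw [mem_Ico] at hj
      have i1 := ih (by omega) (z - j - 1) (by omega)
      have i2 := hc j hj.1
      calc θ ^ (k + 1) * ((wN j : ℝ) * aT k (z - j - 1)) / 10 ^ 13 =
          (θ * ((wN j : ℝ) / 10 ^ 7)) * (θ ^ k * ((aT k (z - j - 1) : ℝ) / 10 ^ 6)) := by
            rw [pow_succ]; ring
        _ ≤ _ := mul_le_mul i2 i1 (by positivity) (Finset.sum_nonneg fun _ _ => by positivity)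
    have hsz : ((k : ℝ) + 1) * 10 ^ 7 * aT (k + 1) z ≤
        ((∑ j ∈ Ico 12 z, wN j * aT k (z - j - 1) : ℕ) : ℝ) := by
      exact_mod_cast hs k (by omega) z hz
    have h3 := mul_le_mul_of_nonneg_left hsz (pow_nonneg hθ (k + 1))
    have h4 : ((k : ℝ) + 1) * (θ ^ (k + 1) * ((aT (k + 1) z : ℝ) / 10 ^ 6)) ≤
        ((k : ℝ) + 1) * alp m D (k + 1) Z := by
      refine le_trans ?_ (hlow.trans hdc)
      rw [le_div_iff₀ (by norm_num)]
      calc _ = θ ^ (k + 1) * (((k : ℝ) + 1) * 10 ^ 7 * aT (k + 1) z) := by ring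
        _ ≤ _ := h3
    exact le_of_mul_le_mul_left h4 (by positivity)

end S17

namespace S17
open Finset Filter

open Classical in
noncomputable def Bw (m D k N1 N s : ℕ) : Finset ℕ := (Icc 1 N).filter
  (fun b => ArithmeticFunction.cardFactors b = k ∧ Nat.Coprime b m ∧ Rough D b ∧
    N1 < s * b ∧ s * b ≤ N)

lemma mem_Bw {m D k N1 N s b : ℕ} : b ∈ Bw m D k N1 N s ↔ (1 ≤ b ∧ b ≤ N) ∧
    ArithmeticFunction.cardFactors b = k ∧ Nat.Coprime b m ∧ Rough D b ∧
    N1 < s * b ∧ s * b ≤ N := by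
  unfold Bw
  classical
  rw [mem_filter, mem_Icc]

lemma sum_log_primeFactors (b : ℕ) (hb : 1 ≤ b) :
    ∑ p ∈ b.primeFactors, Real.log p ≤ Real.log b := by
  have h0 : ∀ p ∈ b.primeFactors, (p : ℝ) ≠ 0 := fun p hp => by
    exact_mod_cast (Nat.prime_of_mem_primeFactors hp).ne_zero
  rw [← Real.log_prod h0]
  apply Real.log_le_log
  · exact Finset.prod_pos fun p hp => by
      exact_mod_cast (Nat.prime_of_mem_primeFactors hp).pos
  · have := Nat.le_of_dvd hb (Nat.prod_primeFactors_dvd b)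
    rw [← Nat.cast_prod]
    exact_mod_cast this

lemma beta_lower (m D k N1 N s : ℕ) (hs : 1 ≤ s) (hD : 1 ≤ D) (K Cl : ℝ)
    (hCl : Real.log N - Real.log s ≤ Cl)
    (hwin : ∀ b : ℕ, 1 ≤ b → s * b * D ≤ N1 →
      K ≤ ∑ p ∈ Pr m (N1 / (s * b)) (N / (s * b)), Real.log p / p) :
    K * alp m D k ((N1 : ℝ) / (s * D)) ≤ Cl * ∑ b ∈ Bw m D (k + 1) N1 N s, 1 / (b : ℝ) := by
  have hZ0 : (0 : ℝ) ≤ (N1 : ℝ) / (s * D) := by positivity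
  have hsr : (0 : ℝ) < s := by exact_mod_cast hs
  have hDr : (0 : ℝ) < D := by exact_mod_cast hD
  let Q : Finset ((_ : ℕ) × ℕ) := (Bk m D k ((N1 : ℝ) / (s * D))).sigma fun b =>
    Pr m (N1 / (s * b)) (N / (s * b))
  have hB : ∀ b ∈ Bk m D k ((N1 : ℝ) / (s * D)), 1 ≤ b ∧ s * b * D ≤ N1 := by
    intro b hb
    rw [mem_Bk hZ0] at hb
    refine ⟨hb.1.1, ?_⟩
    have := hb.1.2
    rw [le_div_iff₀ (by positivity)] at this
    have h2 : ((s * b * D : ℕ) : ℝ) ≤ N1 := by push_cast; linarith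
    exact_mod_cast h2
  have hdc := dc Q (fun x => x.1) (fun x => x.2) (Bw m D (k + 1) N1 N s) (fun p => Real.log p) Cl
    (by
      rintro ⟨b, p⟩ _ ⟨b2, p2⟩ _ h1 h2
      simp only at h1 h2
      subst h1 h2
      rfl)
    (by
      rintro ⟨b, p⟩ hx
      simp only [Q, mem_sigma] at hx
      obtain ⟨hb, hp⟩ := hx
      obtain ⟨hb1, hbD⟩ := hB b hb
      rw [mem_Bk hZ0] at hb
      rw [mem_Pr] at hp
      refine ⟨hp.2.1, ?_⟩
      rw [mem_Bw]
      dsimp only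
      have hsb : 0 < s * b := Nat.mul_pos hs hb1
      have hle := hp.1.2
      have hlt := hp.1.1
      have hDp : D < p := lt_of_le_of_lt (by
        rw [Nat.le_div_iff_mul_le hsb, mul_comm]; exact hbD) hlt
      rw [Nat.le_div_iff_mul_le hsb] at hle
      rw [Nat.div_lt_iff_lt_mul hsb] at hlt
      have hbp : 1 ≤ b * p := Nat.mul_pos hb1 hp.2.1.pos
      refine ⟨⟨hbp, ?_⟩, ?_, ?_, Rough_mul hb.2.2.2 hp.2.1 hDp, ?_, ?_⟩
      · nlinarith
      · rw [ArithmeticFunction.cardFactors_mul (by omega) hp.2.1.ne_zero, hb.2.1,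
            ArithmeticFunction.cardFactors_apply_prime hp.2.1]
      · exact Nat.Coprime.mul_left hb.2.2.1 ((Nat.Prime.coprime_iff_not_dvd hp.2.1).mpr hp.2.2)
      · calc N1 < p * (s * b) := hlt
          _ = s * (b * p) := by ring
      · calc s * (b * p) = p * (s * b) := by ring
          _ ≤ N := hle)
    (by
      intro b hb p hp
      exact Real.log_nonneg (by exact_mod_cast (Nat.prime_of_mem_primeFactors hp).one_le))
    (by
      intro b hb
      rw [mem_Bw] at hb
      refine (sum_log_primeFactors b hb.1.1).trans ?_
      refine le_trans ?_ hCl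
      have hbr : (0 : ℝ) < b := by exact_mod_cast hb.1.1
      have h1 : (s : ℝ) * b ≤ N := by exact_mod_cast hb.2.2.2.2.2
      have h2 := Real.log_le_log (by positivity) h1
      rw [Real.log_mul hsr.ne' hbr.ne'] at h2
      linarith)
    (by
      intro b hb
      rw [mem_Bw] at hb
      exact hb.1.1)
  refine le_trans ?_ hdc
  rw [Finset.sum_sigma]
  unfold alp
  rw [Finset.mul_sum]
  apply Finset.sum_le_sum
  intro b hb
  obtain ⟨hb1, hbD⟩ := hB b hb
  dsimp only
  rw [← Finset.mul_sum, mul_comm K]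
  exact mul_le_mul_of_nonneg_left (hwin b hb1 hbD) (by positivity)

end S17

namespace S17
open Finset Filter

/-- Scaled tables of lower bounds for the weighted counts of rough numbers. -/
def T1 : List ℕ :=
  [0, 0, 0, 0, 0, 0, 0, 0, 0, 0, 0, 0, 0, 79722, 153556, 222311, 286641, 347082, 404076, 457997,
   509159, 557830, 604241, 648594, 691062, 731801, 770944, 808613, 844914, 879943, 913787,
   946523, 978221, 1008944, 1038752, 1067697, 1095828, 1123189, 1149821, 1175763, 1201048,
   1225710, 1249778, 1273280, 1296243, 1318690, 1340644, 1362127, 1383157, 1403755, 1423937,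
   1443719, 1463118, 1482148, 1500822, 1519153, 1537155, 1554839, 1572215, 1589294, 1606087,
   1622602, 1638849, 1654836, 1670571, 1686063, 1701318, 1716344, 1731148, 1745735, 1760113,
   1774288, 1788264, 1802047, 1815643, 1829056, 1842292, 1855355, 1868250, 1880980, 1893551,
   1905965]

def T2 : List ℕ :=
  [0, 0, 0, 0, 0, 0, 0, 0, 0, 0, 0, 0, 0, 0, 0, 0, 0, 0, 0, 0, 0, 0, 0, 0, 0, 0, 3177, 9064,
   17271, 27476, 39407, 52837, 67568, 83435, 100293, 118018, 136501, 155649, 175379, 195618,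
   216303, 237378, 258792, 280501, 302466, 324652, 347027, 369563, 392235, 415021, 437900,
   460853, 483865, 506921, 530007, 553111, 576222, 599330, 622427, 645504, 668554, 691570,
   714547, 737479, 760360, 783188, 805957, 828664, 851305, 873879, 896382, 918811, 941166,
   963443, 985641, 1007759, 1029795, 1051749, 1073618, 1095403, 1117102, 1138716]

def T3 : List ℕ :=
  [0, 0, 0, 0, 0, 0, 0, 0, 0, 0, 0, 0, 0, 0, 0, 0, 0, 0, 0, 0, 0, 0, 0, 0, 0, 0, 0, 0, 0, 0, 0, 0,
   0, 0, 0, 0, 0, 0, 0, 84, 319, 754, 1431, 2377, 3616, 5165, 7034, 9232, 11763, 14628, 17829,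
   21362, 25226, 29415, 33924, 38749, 43883, 49320, 55052, 61073, 67376, 73953, 80797, 87901,
   95259, 102862, 110705, 118779, 127080, 135599, 144330, 153268, 162406, 171739, 181259, 190963,
   200843, 210896, 221115, 231495, 242033, 252722]

def aT : ℕ → ℕ → ℕ
  | 0, _ => 10 ^ 6
  | 1, z => T1.getD z 0
  | 2, z => T2.getD z 0
  | 3, z => T3.getD z 0
  | _, _ => 0

set_option maxRecDepth 100000 in
lemma aT_rec : ∀ k < 3, ∀ z ≤ 81, (k + 1) * 10 ^ 7 * aT (k + 1) z ≤
      ∑ j ∈ Ico 12 z, wN j * aT k (z - j - 1) := by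
  decide +kernel

/-- Integer lower bounds for the sieve weight on a class. -/
def Lc (i j : ℕ) : ℕ :=
  if i = 0 then (if j = 0 then 210 else 210 - Fn j) else 210 + Fn (i + j) - Fn i - Fn j

def lamN (i j : ℕ) : ℕ := 1000 * Lc i j - 60

/-- Upper end of the class on the grid of mesh `1 / 60`. -/
def uc (i j : ℕ) : ℕ := if j = 0 then 0 else (if i = 0 then j + 1 else i + j + 2)

/-- Number of prime factors of the smooth part. -/
def oc (i j : ℕ) : ℕ := if j = 0 then 0 else (if i = 0 then 1 else 2)

def zc (i j : ℕ) : ℕ := (407 - uc i j) / 5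

def Ac (i j : ℕ) : ℕ := ∑ k ∈ range (4 - oc i j), aT k (zc i j)

def wc (i : ℕ) : ℕ := if i = 0 then 10 ^ 7 else wN i

def conN (i j : ℕ) : ℕ := (wc i * wc j * lamN i j ^ 2 * 468 * Ac i j) / (468 - i - j)

/-- The classes of smooth parts. -/
def Cls : Finset (ℕ × ℕ) := ((range 60) ×ˢ (range 60)).filter
  (fun c => (c.1 = 0 ∧ c.2 = 0) ∨ (c.1 = 0 ∧ 6 ≤ c.2) ∨ (6 ≤ c.1 ∧ c.1 < c.2))

set_option maxRecDepth 100000 in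
lemma certificate : 9296 * (36 * 10 ^ 26) ≤ ∑ c ∈ Cls, conN c.1 c.2 := by
  decide +kernel

lemma mem_Cls {c : ℕ × ℕ} : c ∈ Cls ↔ (c.1 < 60 ∧ c.2 < 60) ∧
    ((c.1 = 0 ∧ c.2 = 0) ∨ (c.1 = 0 ∧ 6 ≤ c.2) ∨ (6 ≤ c.1 ∧ c.1 < c.2)) := by
  unfold Cls
  rw [mem_filter, mem_product, mem_range, mem_range]

attribute [irreducible] Cls

end S17

namespace S17
open Finset Filter

lemma pair_inj {q r q2 r2 : ℕ} (hq : q = 1 ∨ q.Prime) (hr : r = 1 ∨ r.Prime)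
    (hlt : q < r ∨ (q = 1 ∧ r = 1)) (hq2 : q2 = 1 ∨ q2.Prime) (hr2 : r2 = 1 ∨ r2.Prime)
    (hlt2 : q2 < r2 ∨ (q2 = 1 ∧ r2 = 1)) (h : q * r = q2 * r2) : q = q2 ∧ r = r2 := by
  have h1 : ∀ a : ℕ, (a = 1 ∨ a.Prime) → 1 ≤ a := by
    rintro a (rfl | h)
    · exact le_rfl
    · exact h.one_le
  have hq1 := h1 q hq
  have hr1 := h1 r hr
  have hq21 := h1 q2 hq2
  have hr21 := h1 r2 hr2
  have key : ∀ a b : ℕ, a.Prime → (b = 1 ∨ b.Prime) → a ∣ b → a = b := by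
    rintro a b ha (rfl | hb) hab
    · exact absurd (Nat.dvd_one.mp hab) ha.ne_one
    · exact (Nat.prime_dvd_prime_iff_eq ha hb).mp hab
  have hrr : r = r2 := by
    rcases hr with rfl | hrp
    · have hq1 : q = 1 := by omega
      subst hq1
      have := Nat.eq_one_of_mul_eq_one_left (h.symm.trans (by norm_num) : q2 * r2 = 1)
      exact this.symm
    · rcases hr2 with rfl | hr2p
      · have hq1 : q2 = 1 := by omega
        subst hq1
        exact Nat.eq_one_of_mul_eq_one_left (h.trans (by norm_num) : q * r = 1)
      · have d1 : r ∣ q2 * r2 := h ▸ dvd_mul_left r q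
        have d2 : r2 ∣ q * r := h ▸ dvd_mul_left r2 q2
        rcases (Nat.Prime.dvd_mul hrp).mp d1 with d | d
        · have e1 := key r q2 hrp hq2 d
          rcases (Nat.Prime.dvd_mul hr2p).mp d2 with d3 | d3
          · have e2 := key r2 q hr2p hq d3
            have := hrp.two_le
            have := hr2p.two_le
            omega
          · exact (key r2 r hr2p (Or.inr hrp) d3).symm
        · exact key r r2 hrp (Or.inr hr2p) d
  subst hrr
  exact ⟨Nat.eq_of_mul_eq_mul_right (by omega) h, rfl⟩

/-- All prime factors are at most `D`. -/
def Smooth (D s : ℕ) : Prop := ∀ p : ℕ, p.Prime → p ∣ s → p ≤ D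

lemma smooth_rough_coprime {D s b : ℕ} (hs : Smooth D s) (hb : Rough D b) : Nat.Coprime s b := by
  by_contra hc
  obtain ⟨q, hqp, hqt, hqd⟩ := Nat.Prime.not_coprime_iff_dvd.mp hc
  have := hs q hqp hqt
  have := hb q hqp hqd
  omega

lemma smooth_rough_inj {D s b s2 b2 : ℕ} (hs : Smooth D s) (hb : Rough D b) (hs2 : Smooth D s2)
    (hb2 : Rough D b2) (hpos : 1 ≤ s) (h : s * b = s2 * b2) : s = s2 ∧ b = b2 := by
  have h1 : s ∣ s2 := (smooth_rough_coprime hs hb2).dvd_of_dvd_mul_right (h ▸ dvd_mul_right s b)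
  have h2 : s2 ∣ s := (smooth_rough_coprime hs2 hb).dvd_of_dvd_mul_right (h ▸ dvd_mul_right s2 b2)
  have h3 := Nat.dvd_antisymm h1 h2
  subst h3
  exact ⟨rfl, Nat.eq_of_mul_eq_mul_left hpos h⟩

noncomputable def C0 (m i : ℕ) : Finset ℕ := if i = 0 then {1} else cl m 60 i

lemma mem_C0_zero {m q : ℕ} : q ∈ C0 m 0 ↔ q = 1 := by simp [C0]

lemma C0_prime {m i q : ℕ} (h : q ∈ C0 m i) : q = 1 ∨ q.Prime := by
  unfold C0 at h
  split_ifs at h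
  · left; simpa using h
  · right; exact (mem_cl.mp h).2.1

lemma C0_pos {m i q : ℕ} (h : q ∈ C0 m i) : 1 ≤ q := by
  rcases C0_prime h with rfl | h
  · exact le_rfl
  · exact h.one_le

lemma C0_disj {m i j q : ℕ} (hl : 0 < ell m) (h1 : q ∈ C0 m i) (h2 : q ∈ C0 m j) : i = j := by
  have h0 : ∀ a : ℕ, a ≠ 0 → q ∈ C0 m a → q.Prime ∧ q ∈ cl m 60 a := by
    intro a ha hq
    unfold C0 at hq
    rw [if_neg ha] at hq
    exact ⟨(mem_cl.mp hq).2.1, hq⟩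
  by_cases hi : i = 0
  · by_cases hj : j = 0
    · omega
    · subst hi
      rw [mem_C0_zero] at h1
      have := (h0 j hj h2).1
      rw [h1] at this
      exact absurd this Nat.not_prime_one
  · by_cases hj : j = 0
    · subst hj
      rw [mem_C0_zero] at h2
      have := (h0 i hi h1).1
      rw [h2] at this
      exact absurd this Nat.not_prime_one
    · exact cl_disj (by norm_num) hl (h0 i hi h1).2 (h0 j hj h2).2

lemma C0_log_lower {m i q : ℕ} (h : q ∈ C0 m i) : (i : ℝ) / 60 * ell m ≤ Real.log q := by
  unfold C0 at h
  split_ifs at h with hi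
  · subst hi
    have : q = 1 := by simpa using h
    simp [this]
  · rw [mem_cl] at h
    have := Real.log_le_log (Real.exp_pos _) h.1.1.le
    rw [Real.log_exp] at this
    exact_mod_cast this

lemma C0_log_upper {m i q : ℕ} (hi : i ≠ 0) (h : q ∈ C0 m i) :
    Real.log q ≤ ((i : ℝ) + 1) / 60 * ell m := by
  unfold C0 at h
  rw [if_neg hi, mem_cl] at h
  have := Real.log_le_log (by exact_mod_cast h.2.1.pos) h.1.2
  rw [Real.log_exp] at this
  exact_mod_cast this

lemma C0_coprime {m i q : ℕ} (h : q ∈ C0 m i) : Nat.Coprime q m := by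
  unfold C0 at h
  split_ifs at h with hi
  · have : q = 1 := by simpa using h
    simp [this]
  · rw [mem_cl] at h
    exact (Nat.Prime.coprime_iff_not_dvd h.2.1).mpr h.2.2

lemma C0_smooth {m i q : ℕ} (hl : 0 < ell m) (hi : i < 60) (h : q ∈ C0 m i) :
    Smooth (fl m 1) q := by
  intro p hp hpq
  rcases C0_prime h with rfl | hq
  · exact absurd (Nat.dvd_one.mp hpq) hp.ne_one
  · have := (Nat.prime_dvd_prime_iff_eq hp hq).mp hpq
    subst this
    unfold C0 at h
    split_ifs at h with h0
    · have : p = 1 := by simpa using h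
      exact absurd this hp.ne_one
    · rw [mem_cl] at h
      rw [le_fl_iff]
      refine h.1.2.trans (Real.exp_le_exp.mpr (mul_le_mul_of_nonneg_right ?_ hl.le))
      have : (i : ℝ) + 1 ≤ 60 := by exact_mod_cast hi
      push_cast
      rw [div_le_one (by norm_num)]
      exact this

lemma C0_lt {m i j q r : ℕ} (hl : 0 < ell m) (hij : i < j) (hq : q ∈ C0 m i) (hr : r ∈ C0 m j) :
    q < r := by
  have hj : j ≠ 0 := by omega
  unfold C0 at hr
  rw [if_neg hj] at hr
  have hrp := (mem_cl.mp hr).2.1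
  by_cases hi : i = 0
  · subst hi
    rw [mem_C0_zero] at hq
    have := hrp.two_le
    omega
  · unfold C0 at hq
    rw [if_neg hi] at hq
    rw [mem_cl] at hq hr
    have : (q : ℝ) < r := by
      refine lt_of_le_of_lt (hq.1.2.trans ?_) hr.1.1
      apply Real.exp_le_exp.mpr (mul_le_mul_of_nonneg_right _ hl.le)
      have : (i : ℝ) + 1 ≤ j := by exact_mod_cast hij
      gcongr
    exact_mod_cast this

/-- Lower bound for the sieve weight on a class. -/
lemma Lam_class (η : ℝ) (hη : η = 1 / 1000) (m : ℕ) (hl : 0 < ell m) (hg : 0 < gam m)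
    (hLam : (gam m * ell m * (Fr 0 - η) ≤ Lam m 1) ∧
    (∀ q : ℕ, q.Prime → ¬ q ∣ m → Real.exp (1 / 10 * ell m) < q →
      gam m * ell m * (Fr 0 - Fr (Real.log q / ell m) - η) ≤ Lam m q) ∧
    (∀ q r : ℕ, q.Prime → ¬ q ∣ m → Real.exp (1 / 10 * ell m) < q → r.Prime → ¬ r ∣ m →
      Real.exp (1 / 10 * ell m) < r → q ≠ r →
      gam m * ell m * (Fr 0 - Fr (Real.log q / ell m) - Fr (Real.log r / ell m)
        + Fr (Real.log q / ell m + Real.log r / ell m) - η) ≤ Lam m (q * r)))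
    (c : ℕ × ℕ) (hc : c ∈ Cls) (q r : ℕ) (hq : q ∈ C0 m c.1) (hr : r ∈ C0 m c.2) :
    (gam m * ell m * ((lamN c.1 c.2 : ℝ) / 60000)) ^ 2 ≤ Lam m (q * r) ^ 2 := by
  obtain ⟨i, j⟩ := c
  dsimp only at *
  rw [mem_Cls] at hc
  dsimp only at hc
  have hgl : 0 < gam m * ell m := mul_pos hg hl
  by_cases h0 : lamN i j = 0
  · rw [h0]; norm_num; positivity
  suffices h : gam m * ell m * ((lamN i j : ℝ) / 60000) ≤ Lam m (q * r) from
    pow_le_pow_left₀ (by positivity) h 2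
  have hlamN : (lamN i j : ℝ) / 60000 = (Lc i j : ℝ) / 60 - η := by
    unfold lamN at h0 ⊢
    rw [Nat.cast_sub (by omega), hη]; push_cast; ring
  have hbig : ∀ a p : ℕ, 6 ≤ a → p ∈ C0 m a → p.Prime ∧ ¬ p ∣ m ∧
      Real.exp (1 / 10 * ell m) < p ∧ (a : ℝ) / 60 ≤ Real.log p / ell m := by
    intro a p ha hp
    have hlo := C0_log_lower hp
    unfold C0 at hp
    rw [if_neg (by omega), mem_cl] at hp
    refine ⟨hp.2.1, hp.2.2, lt_of_le_of_lt ?_ hp.1.1, ?_⟩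
    · apply Real.exp_le_exp.mpr (mul_le_mul_of_nonneg_right _ hl.le)
      have : (6 : ℝ) ≤ a := by exact_mod_cast ha
      push_cast
      linarith
    · rw [le_div_iff₀ hl]; exact hlo
  have hF0 := Fr_zero
  rw [hlamN]
  rcases hc.2 with ⟨rfl, rfl⟩ | ⟨rfl, hj⟩ | ⟨hi, hij⟩
  · rw [mem_C0_zero] at hq hr
    subst hq hr
    refine le_trans ?_ hLam.1
    apply mul_le_mul_of_nonneg_left _ hgl.le
    rw [hF0]; unfold Lc; norm_num
  · rw [mem_C0_zero] at hq
    subst hq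
    rw [one_mul]
    obtain ⟨b1, b2, b3, b4⟩ := hbig j r hj hr
    refine le_trans ?_ (hLam.2.1 r b1 b2 b3)
    apply mul_le_mul_of_nonneg_left _ hgl.le
    have := Fr_anti _ _ b4
    rw [Fr_cast] at this
    have hFj : Fn j ≤ 210 := by unfold Fn; omega
    unfold Lc
    rw [if_pos rfl, if_neg (by omega), Nat.cast_sub hFj]
    push_cast
    linarith
  · obtain ⟨b1, b2, b3, b4⟩ := hbig j r (by omega) hr
    obtain ⟨a1, a2, a3, a4⟩ := hbig i q hi hq
    refine le_trans ?_ (hLam.2.2 q r a1 a2 a3 b1 b2 b3 (C0_lt hl hij hq hr).ne)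
    apply mul_le_mul_of_nonneg_left _ hgl.le
    have := Fr_pair _ _ _ _ a4 b4 (by positivity) (by positivity)
    rw [← add_div, ← Nat.cast_add, Fr_cast, Fr_cast, Fr_cast] at this
    have hL : 0 < Lc i j := by
      by_contra hcon
      apply h0
      unfold lamN; omega
    unfold Lc at hL ⊢
    rw [if_neg (by omega)] at hL ⊢
    rw [Nat.cast_sub (by omega), Nat.cast_sub (by omega)]
    push_cast
    linarith

end S17

namespace S17
open Finset Filter

lemma omega_class {m : ℕ} {c : ℕ × ℕ} (hc : c ∈ Cls) {q r : ℕ} (hq : q ∈ C0 m c.1)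
    (hr : r ∈ C0 m c.2) : ArithmeticFunction.cardFactors (q * r) = oc c.1 c.2 := by
  obtain ⟨i, j⟩ := c
  rw [mem_Cls] at hc
  dsimp only at *
  have hp : ∀ a p : ℕ, a ≠ 0 → p ∈ C0 m a → p.Prime := by
    intro a p ha h
    unfold C0 at h
    rw [if_neg ha] at h
    exact (mem_cl.mp h).2.1
  unfold oc
  rw [ArithmeticFunction.cardFactors_mul (by have := C0_pos hq; omega)
    (by have := C0_pos hr; omega)]
  rcases hc.2 with ⟨rfl, rfl⟩ | ⟨rfl, hj⟩ | ⟨hi, hij⟩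
  · rw [mem_C0_zero] at hq hr
    subst hq hr
    simp
  · rw [mem_C0_zero] at hq
    subst hq
    rw [ArithmeticFunction.cardFactors_apply_prime (hp j r (by omega) hr)]
    rw [if_neg (by omega)]; simp
  · rw [ArithmeticFunction.cardFactors_apply_prime (hp j r (by omega) hr),
      ArithmeticFunction.cardFactors_apply_prime (hp i q (by omega) hq),
      if_neg (by omega), if_neg (by omega)]

lemma class_lt {m : ℕ} (hl : 0 < ell m) {c : ℕ × ℕ} (hc : c ∈ Cls) {q r : ℕ} (hq : q ∈ C0 m c.1)
    (hr : r ∈ C0 m c.2) : q < r ∨ (q = 1 ∧ r = 1) := by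
  obtain ⟨i, j⟩ := c
  rw [mem_Cls] at hc
  dsimp only at *
  rcases hc.2 with ⟨rfl, rfl⟩ | ⟨rfl, hj⟩ | ⟨hi, hij⟩
  · right; exact ⟨mem_C0_zero.mp hq, mem_C0_zero.mp hr⟩
  · left; exact C0_lt hl (by omega) hq hr
  · left; exact C0_lt hl hij hq hr

lemma Smooth_mul {D s t : ℕ} (hs : Smooth D s) (ht : Smooth D t) : Smooth D (s * t) := by
  intro p hp hd
  rcases (Nat.Prime.dvd_mul hp).mp hd with h | h
  · exact hs p hp h
  · exact ht p hp h

open Classical in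
lemma Hg_comb (m N1 N : ℕ) (hl : 0 < ell m) :
    ∑ c ∈ Cls, ∑ q ∈ C0 m c.1, ∑ r ∈ C0 m c.2, ∑ k ∈ range (4 - oc c.1 c.2),
      ∑ b ∈ Bw m (fl m 1) (k + 1) N1 N (q * r), Lam m (q * r * b) ^ 2 / ((q * r * b : ℕ) : ℝ) ≤
    ∑ n ∈ (Ioc N1 N).filter (fun n => Nat.Coprime n m ∧ ArithmeticFunction.cardFactors n ≤ 4),
      Lam m n ^ 2 / (n : ℝ) := by
  simp only [Finset.sum_sigma']
  set Q := _root_.id (Finset.sigma Cls fun c : ℕ × ℕ => Finset.sigma (C0 m c.1) fun q =>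
    Finset.sigma (C0 m c.2) fun r => Finset.sigma (range (4 - oc c.1 c.2)) fun k =>
      Bw m (fl m 1) (k + 1) N1 N (q * r)) with hQ
  let F : (Σ _ : ℕ × ℕ, Σ _ : ℕ, Σ _ : ℕ, Σ _ : ℕ, ℕ) → ℕ :=
    fun x => x.2.1 * x.2.2.1 * x.2.2.2.2
  have hmem : ∀ x ∈ Q, x.1 ∈ Cls ∧ x.2.1 ∈ C0 m x.1.1 ∧ x.2.2.1 ∈ C0 m x.1.2 ∧
      x.2.2.2.1 < 4 - oc x.1.1 x.1.2 ∧
      x.2.2.2.2 ∈ Bw m (fl m 1) (x.2.2.2.1 + 1) N1 N (x.2.1 * x.2.2.1) := by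
    rintro ⟨c, q, r, k, b⟩ hx
    simp only [hQ, _root_.id, Finset.mem_sigma, mem_range] at hx
    exact hx
  have hinj : Set.InjOn F Q := by
    rintro ⟨c, q, r, k, b⟩ hx ⟨c2, q2, r2, k2, b2⟩ hx2 h
    obtain ⟨h1, h2, h3, h4, h5⟩ := hmem _ hx
    obtain ⟨g1, g2, g3, g4, g5⟩ := hmem _ hx2
    dsimp only [F] at *
    rw [mem_Bw] at h5 g5
    have hc1 := (mem_Cls.mp h1).1
    have hc2 := (mem_Cls.mp g1).1
    have s1 := Smooth_mul (C0_smooth hl hc1.1 h2) (C0_smooth hl hc1.2 h3)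
    have s2 := Smooth_mul (C0_smooth hl hc2.1 g2) (C0_smooth hl hc2.2 g3)
    obtain ⟨e1, e2⟩ := smooth_rough_inj s1 h5.2.2.2.1 s2 g5.2.2.2.1
      (Nat.mul_pos (C0_pos h2) (C0_pos h3)) h
    obtain ⟨e3, e4⟩ := pair_inj (C0_prime h2) (C0_prime h3) (class_lt hl h1 h2 h3)
      (C0_prime g2) (C0_prime g3) (class_lt hl g1 g2 g3) e1
    subst e2 e3 e4
    have e5 := C0_disj hl h2 g2
    have e6 := C0_disj hl h3 g3
    have e7 : c = c2 := Prod.ext e5 e6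
    have e8 : k = k2 := by
      have := h5.2.1.symm.trans g5.2.1
      omega
    subst e7 e8
    rfl
  have hsub : Q.image F ⊆ (Ioc N1 N).filter
      (fun n => Nat.Coprime n m ∧ ArithmeticFunction.cardFactors n ≤ 4) := by
    intro n hn
    rw [mem_image] at hn
    obtain ⟨⟨c, q, r, k, b⟩, hx, rfl⟩ := hn
    obtain ⟨h1, h2, h3, h4, h5⟩ := hmem _ hx
    dsimp only [F] at *
    rw [mem_Bw] at h5
    rw [mem_filter, mem_Ioc]
    refine ⟨h5.2.2.2.2, ?_, ?_⟩
    · exact Nat.Coprime.mul_left (Nat.Coprime.mul_left (C0_coprime h2) (C0_coprime h3)) h5.2.2.1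
    · rw [ArithmeticFunction.cardFactors_mul, omega_class h1 h2 h3, h5.2.1]
      · omega
      · have := Nat.mul_pos (C0_pos h2) (C0_pos h3); omega
      · omega
  calc _ = ∑ x ∈ Q, Lam m (F x) ^ 2 / ((F x : ℕ) : ℝ) := rfl
    _ = ∑ n ∈ Q.image F, Lam m n ^ 2 / (n : ℝ) := by
      rw [Finset.sum_image hinj]
    _ ≤ _ := Finset.sum_le_sum_of_subset_of_nonneg hsub fun n _ _ => by positivity

lemma uc_le {c : ℕ × ℕ} (hc : c ∈ Cls) : uc c.1 c.2 ≤ 120 := by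
  rw [mem_Cls] at hc
  unfold uc
  split_ifs <;> omega

lemma class_log_upper {m : ℕ} {c : ℕ × ℕ} (hc : c ∈ Cls) {q r : ℕ} (hq : q ∈ C0 m c.1)
    (hr : r ∈ C0 m c.2) : Real.log q + Real.log r ≤ (uc c.1 c.2 : ℝ) / 60 * ell m := by
  obtain ⟨i, j⟩ := c
  rw [mem_Cls] at hc
  dsimp only at *
  unfold uc
  rcases hc.2 with ⟨rfl, rfl⟩ | ⟨rfl, hj⟩ | ⟨hi, hij⟩
  · rw [mem_C0_zero] at hq hr
    subst hq hr
    simp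
  · rw [mem_C0_zero] at hq
    subst hq
    rw [if_neg (by omega), if_pos rfl]
    have := C0_log_upper (by omega) hr
    push_cast
    simpa using this
  · rw [if_neg (by omega), if_neg (by omega)]
    have h1 := C0_log_upper (by omega) hr
    have h2 := C0_log_upper (by omega) hq
    push_cast
    calc Real.log q + Real.log r ≤ ((i : ℝ) + 1) / 60 * ell m + ((j : ℝ) + 1) / 60 * ell m :=
          add_le_add h2 h1
      _ = _ := by ring

end S17

namespace S17
open Finset Filter

noncomputable def K0 (m : ℕ) : ℝ := 0.000078 * ell m
noncomputable def Dm (m : ℕ) : ℕ := fl m 1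
noncomputable def Nm (m : ℕ) : ℕ := fl m 7.8
noncomputable def N1m (m : ℕ) : ℕ := fl m 7.799922

/-- The lower bound for one class, given all the ingredients. -/
lemma class_lower (m : ℕ) (hl : 100 ≤ ell m) (hg : 0 < gam m) (θ K : ℝ) (hθ : 0 < θ) (hθ1 : θ ≤ 1)
    (hK : 0 ≤ K)
    (hLam : (gam m * ell m * (Fr 0 - 1 / 1000) ≤ Lam m 1) ∧
    (∀ q : ℕ, q.Prime → ¬ q ∣ m → Real.exp (1 / 10 * ell m) < q →
      gam m * ell m * (Fr 0 - Fr (Real.log q / ell m) - 1 / 1000) ≤ Lam m q) ∧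
    (∀ q r : ℕ, q.Prime → ¬ q ∣ m → Real.exp (1 / 10 * ell m) < q → r.Prime → ¬ r ∣ m →
      Real.exp (1 / 10 * ell m) < r → q ≠ r →
      gam m * ell m * (Fr 0 - Fr (Real.log q / ell m) - Fr (Real.log r / ell m)
        + Fr (Real.log q / ell m + Real.log r / ell m) - 1 / 1000) ≤ Lam m (q * r)))
    (hc12 : ∀ j : ℕ, 12 ≤ j → θ * ((wN j : ℝ) / 10 ^ 7) ≤ ∑ p ∈ cl m 12 j, 1 / (p : ℝ))
    (hc60 : ∀ j : ℕ, 6 ≤ j → θ * ((wN j : ℝ) / 10 ^ 7) ≤ ∑ p ∈ cl m 60 j, 1 / (p : ℝ))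
    (hwin : ∀ s b : ℕ, 1 ≤ s → 1 ≤ b → s * b * fl m 1 ≤ N1m m →
      K ≤ ∑ p ∈ Pr m (N1m m / (s * b)) (Nm m / (s * b)), Real.log p / p)
    (c : ℕ × ℕ) (hc : c ∈ Cls) :
    (gam m ^ 2 * ell m * K * θ ^ 5) * ((conN c.1 c.2 : ℝ) / (7.8 * (36 * 10 ^ 28))) ≤
    ∑ q ∈ C0 m c.1, ∑ r ∈ C0 m c.2, ∑ k ∈ range (4 - oc c.1 c.2),
      ∑ b ∈ Bw m (fl m 1) (k + 1) (N1m m) (Nm m) (q * r),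
        Lam m (q * r * b) ^ 2 / ((q * r * b : ℕ) : ℝ) := by
  have hl0 : 0 < ell m := by linarith
  have hcm := mem_Cls.mp hc
  have huc := uc_le hc
  have hij : c.1 + c.2 ≤ 118 := by omega
  -- weights of the cells
  have hcell : ∀ i : ℕ, (i = 0 ∨ 6 ≤ i) → θ * ((wc i : ℝ) / 10 ^ 7) ≤ ∑ q ∈ C0 m i, 1 / (q : ℝ) := by
    intro i hi
    unfold wc C0
    rcases hi with rfl | hi
    · norm_num; exact hθ1
    · rw [if_neg (by omega), if_neg (by omega)]
      exact hc60 i hi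
  set w : ℝ := (468 - c.1 - c.2 : ℝ) / 60 with hw
  have hijr : (c.1 : ℝ) + c.2 ≤ 118 := by exact_mod_cast hij
  have hwpos : 0 < w := by rw [hw]; apply div_pos <;> linarith
  have hdp := dp m hl0 θ hθ.le hc12 aT 81 (fun z _ => le_rfl) aT_rec
  have hz : zc c.1 c.2 ≤ 81 := by unfold zc; omega
  -- inner sums
  have hin : ∀ q ∈ C0 m c.1, ∀ r ∈ C0 m c.2, ∀ k ∈ range (4 - oc c.1 c.2),
      K * (θ ^ 3 * ((aT k (zc c.1 c.2) : ℝ) / 10 ^ 6)) / (w * ell m) ≤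
      ∑ b ∈ Bw m (fl m 1) (k + 1) (N1m m) (Nm m) (q * r), 1 / (b : ℝ) := by
    intro q hq r hr k hk
    have hq1 := C0_pos hq
    have hr1 := C0_pos hr
    have hq1r : (1 : ℝ) ≤ q := by exact_mod_cast hq1
    have hr1r : (1 : ℝ) ≤ r := by exact_mod_cast hr1
    have hs1 : 1 ≤ q * r := Nat.mul_pos hq1 hr1
    have hk3 : k ≤ 3 := by rw [mem_range] at hk; omega
    have hDpos : 1 ≤ fl m 1 := one_le_fl m 1 (by linarith)
    have hN1pos : 1 ≤ N1m m := one_le_fl m _ (by positivity)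
    have hlogs : Real.log ((q * r : ℕ) : ℝ) = Real.log q + Real.log r := by
      push_cast
      rw [Real.log_mul (by linarith) (by linarith)]
    have hbl := beta_lower m (fl m 1) k (N1m m) (Nm m) (q * r) hs1 hDpos K (w * ell m) (by
        have h1 := (log_fl m 7.8 (by positivity)).2
        have h2 := C0_log_lower hq
        have h3 := C0_log_lower hr
        rw [hlogs]
        unfold Nm
        rw [hw]
        linarith) (fun b hb h => hwin (q * r) b hs1 hb h)
    have h1 : Real.exp ((zc c.1 c.2 : ℝ) / 12 * ell m) ≤ (N1m m : ℝ) / ((q * r : ℕ) * (fl m 1 : ℕ)) := by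
      have hsp : (0 : ℝ) < ((q * r : ℕ) : ℝ) := by exact_mod_cast hs1
      have hDp : (0 : ℝ) < (fl m 1 : ℕ) := by exact_mod_cast hDpos
      have hNp : (0 : ℝ) < (N1m m : ℕ) := by exact_mod_cast hN1pos
      rw [← Real.le_log_iff_exp_le (by positivity), Real.log_div hNp.ne' (by positivity),
        Real.log_mul hsp.ne' hDp.ne', hlogs]
      have e1 := (log_fl m 7.799922 (by positivity)).1
      have e2 := (log_fl m 1 (by linarith)).2
      have e3 := class_log_upper hc hq hr
      have e4 : (zc c.1 c.2 : ℝ) * 5 ≤ 407 - uc c.1 c.2 := by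
        have : zc c.1 c.2 * 5 + uc c.1 c.2 ≤ 407 := by unfold zc; omega
        have : (zc c.1 c.2 : ℝ) * 5 + uc c.1 c.2 ≤ 407 := by exact_mod_cast this
        linarith
      unfold N1m
      have e5 : (zc c.1 c.2 : ℝ) / 12 * ell m ≤ (407 - uc c.1 c.2) / 60 * ell m :=
        mul_le_mul_of_nonneg_right (by linarith) hl0.le
      have : (407 - (uc c.1 c.2 : ℝ)) / 60 * ell m = 407 / 60 * ell m - uc c.1 c.2 / 60 * ell m := by
        ring
      linarith
    have h2 := alp_mono m (fl m 1) k (Real.exp_pos _).le h1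
    have h3 := hdp k hk3 _ hz
    rw [div_le_iff₀ (by positivity)]
    have hθ3 : θ ^ 3 ≤ θ ^ k := pow_le_pow_of_le_one hθ.le hθ1 hk3
    calc K * (θ ^ 3 * ((aT k (zc c.1 c.2) : ℝ) / 10 ^ 6))
        ≤ K * (θ ^ k * ((aT k (zc c.1 c.2) : ℝ) / 10 ^ 6)) := by gcongr
      _ ≤ K * alp m (fl m 1) k ((N1m m : ℝ) / ((q * r : ℕ) * (fl m 1 : ℕ))) :=
          mul_le_mul_of_nonneg_left (h3.trans h2) hK
      _ ≤ _ := hbl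
      _ = _ := mul_comm _ _
  set A : ℝ := (gam m * ell m * ((lamN c.1 c.2 : ℝ) / 60000)) ^ 2 with hA
  have hA0 : 0 ≤ A := sq_nonneg _
  set I : ℝ := K * (θ ^ 3 * ((Ac c.1 c.2 : ℝ) / 10 ^ 6)) / (w * ell m) with hI
  have hI0 : 0 ≤ I := by positivity
  have hin2 : ∀ q ∈ C0 m c.1, ∀ r ∈ C0 m c.2, A * I * (1 / (q : ℝ)) * (1 / (r : ℝ)) ≤
      ∑ k ∈ range (4 - oc c.1 c.2), ∑ b ∈ Bw m (fl m 1) (k + 1) (N1m m) (Nm m) (q * r),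
        Lam m (q * r * b) ^ 2 / ((q * r * b : ℕ) : ℝ) := by
    intro q hq r hr
    have hL := Lam_class (1 / 1000) rfl m hl0 hg hLam c hc q r hq hr
    have e1 : I ≤ ∑ k ∈ range (4 - oc c.1 c.2),
        ∑ b ∈ Bw m (fl m 1) (k + 1) (N1m m) (Nm m) (q * r), 1 / (b : ℝ) := by
      refine le_trans (le_of_eq ?_) (Finset.sum_le_sum fun k hk => hin q hq r hr k hk)
      rw [hI, ← Finset.sum_div, ← Finset.mul_sum, ← Finset.mul_sum, ← Finset.sum_div]
      unfold Ac
      push_cast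
      rfl
    calc A * I * (1 / (q : ℝ)) * (1 / (r : ℝ)) = (A * (1 / (q : ℝ)) * (1 / (r : ℝ))) * I := by ring
      _ ≤ (A * (1 / (q : ℝ)) * (1 / (r : ℝ))) * _ := mul_le_mul_of_nonneg_left e1 (by positivity)
      _ ≤ _ := by
        rw [Finset.mul_sum]
        refine Finset.sum_le_sum fun k _ => ?_
        rw [Finset.mul_sum]
        refine Finset.sum_le_sum fun b hb => ?_
        rw [mem_Bw] at hb
        have : Lam m (q * r * b) = Lam m (q * r) := by
          unfold Lam
          exact LamD_coprime _ _ _ _ hb.2.2.2.1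
        rw [this]
        push_cast
        calc A * (1 / (q : ℝ)) * (1 / (r : ℝ)) * (1 / (b : ℝ)) = A / (q * r * b) := by
              simp only [div_eq_mul_inv, mul_inv]; ring
          _ ≤ _ := by
              apply div_le_div_of_nonneg_right hL; positivity
  have hfin : A * I * (θ * ((wc c.1 : ℝ) / 10 ^ 7)) * (θ * ((wc c.2 : ℝ) / 10 ^ 7)) ≤
      ∑ q ∈ C0 m c.1, ∑ r ∈ C0 m c.2, A * I * (1 / (q : ℝ)) * (1 / (r : ℝ)) := by
    have e1 := hcell c.1 (by omega)
    have e2 := hcell c.2 (by omega)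
    have : ∑ q ∈ C0 m c.1, ∑ r ∈ C0 m c.2, A * I * (1 / (q : ℝ)) * (1 / (r : ℝ)) =
        A * I * (∑ q ∈ C0 m c.1, 1 / (q : ℝ)) * (∑ r ∈ C0 m c.2, 1 / (r : ℝ)) := by
      simp only [Finset.mul_sum, Finset.sum_mul]
      rw [Finset.sum_comm]
    rw [this]
    have hAI : 0 ≤ A * I := mul_nonneg hA0 hI0
    have e3 : 0 ≤ ∑ q ∈ C0 m c.1, 1 / (q : ℝ) := Finset.sum_nonneg fun _ _ => by positivity
    gcongr
  refine le_trans ?_ (hfin.trans (Finset.sum_le_sum fun q hq => Finset.sum_le_sum fun r hr =>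
    hin2 q hq r hr))
  have hcon : (conN c.1 c.2 : ℝ) ≤ (wc c.1 : ℝ) * wc c.2 * lamN c.1 c.2 ^ 2 * 468 * Ac c.1 c.2 /
      (60 * w) := by
    unfold conN
    refine Nat.cast_div_le.trans (le_of_eq ?_)
    rw [Nat.cast_sub (by omega), Nat.cast_sub (by omega), hw]
    push_cast
    congr 1
    ring
  have hden : (0 : ℝ) < 7.8 * (36 * 10 ^ 28) := by norm_num
  calc (gam m ^ 2 * ell m * K * θ ^ 5) * ((conN c.1 c.2 : ℝ) / (7.8 * (36 * 10 ^ 28)))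
      ≤ (gam m ^ 2 * ell m * K * θ ^ 5) * (((wc c.1 : ℝ) * wc c.2 * lamN c.1 c.2 ^ 2 * 468 *
        Ac c.1 c.2 / (60 * w)) / (7.8 * (36 * 10 ^ 28))) := by gcongr
    _ = _ := by
      rw [hA, hI]
      field_simp
      norm_num
      ring

/-- The contribution of integers with few prime factors. -/
noncomputable def Hg (m : ℕ) : ℝ := ∑ n ∈ (Ioc (N1m m) (Nm m)).filter
  (fun n => Nat.Coprime n m ∧ ArithmeticFunction.cardFactors n ≤ 4), Lam m n ^ 2 / (n : ℝ)

lemma ev_m_rpow_le_D : ∀ᶠ m : ℕ in atTop, (m : ℝ) ^ (rho / 2) ≤ fl m 1 := by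
  filter_upwards [ev_ell 2, eventually_ge_atTop 1] with m hl hm
  have h1 := exp_le_two_fl m 1 (by linarith)
  have h2 := exp_ell m hm (1 / 2)
  have h3 : (m : ℝ) ^ (rho / 2) = Real.exp (1 / 2 * ell m) := by rw [h2]; congr 1; ring
  rw [h3]
  have h4 : Real.exp (1 * ell m) = Real.exp (1 / 2 * ell m) * Real.exp (1 / 2 * ell m) := by
    rw [← Real.exp_add]; congr 1; ring
  have h5 : (2 : ℝ) ≤ Real.exp (1 / 2 * ell m) := by
    have := Real.add_one_le_exp (1 / 2 * ell m)
    linarith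
  have h6 := Real.exp_pos (1 / 2 * ell m)
  nlinarith

lemma Hg_lower : ∀ᶠ m : ℕ in atTop, 11.9 * (gam m ^ 2 * ell m * K0 m) ≤ Hg m := by
  have hr := rho_pos
  obtain ⟨C, hC, hev⟩ := prime_window (rho / 2) (by positivity)
  filter_upwards [hev, ev_m_rpow_le_D, ev_ell 100, ev_ell ((2 + C) * 10 ^ 9),
    Lam_lower (1 / 1000) (by norm_num), cell_sum 12 (by norm_num) (1 / 10000) (by norm_num)
    (by norm_num), cell_sum 60 (by norm_num) (1 / 10000) (by norm_num) (by norm_num),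
    eventually_ge_atTop 1] with m hpw hD hl hlC hLam hc12 hc60 hm
  have hg := gam_pos (m := m) (by omega)
  have hl0 : 0 < ell m := by linarith
  have hK0 : 0 < K0 m := by unfold K0; positivity
  have hcl := class_lower m hl hg (1 - 1 / 10000) (0.9999 * K0 m) (by norm_num) (by norm_num)
    (by positivity) hLam (fun j hj => hc12 j (by omega)) (fun j hj => hc60 j (by omega)) (by
      intro s b hs hb hsb
      have hsb1 : 0 < s * b := Nat.mul_pos hs hb
      have hDpos : 1 ≤ fl m 1 := one_le_fl m 1 (by linarith)
      have hDle : fl m 1 ≤ N1m m / (s * b) := by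
        rw [Nat.le_div_iff_mul_le hsb1]
        rw [mul_comm]; exact hsb
      have hN : N1m m ≤ Nm m := fl_mono m hl0.le (by norm_num)
      have h1 := hpw (N1m m / (s * b)) (Nm m / (s * b))
        (hD.trans (by exact_mod_cast hDle)) (Nat.div_le_div_right hN)
      have hle : s * b ≤ N1m m := le_trans (Nat.le_mul_of_pos_right _ hDpos) hsb
      have h2 := (log_div_floor (N1m m) (s * b) hsb1 hle).2
      have h3 := (log_div_floor (Nm m) (s * b) hsb1 (hle.trans hN)).1
      have h4 := (abs_le.mp h1).1
      have h5 := (log_fl m 7.8 (by positivity)).1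
      have h6 := (log_fl m 7.799922 (by positivity)).2
      have h7 : 0.9999 * K0 m ≤ K0 m - 2 - C := by unfold K0; linarith
      unfold K0 at h7 ⊢
      unfold Nm N1m at *
      linarith)
  have hcomb := Hg_comb m (N1m m) (Nm m) hl0
  have hcert : (9296 * (36 * 10 ^ 26) : ℝ) ≤ ∑ c ∈ Cls, (conN c.1 c.2 : ℝ) := by
    exact_mod_cast certificate
  have hsum := Finset.sum_le_sum hcl
  rw [← Finset.mul_sum, ← Finset.sum_div] at hsum
  have hfin := hsum.trans hcomb
  unfold Hg
  have hX : 0 < gam m ^ 2 * ell m * K0 m := by positivity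
  have hfrac : (92.96 / 7.8 : ℝ) ≤ (∑ c ∈ Cls, (conN c.1 c.2 : ℝ)) / (7.8 * (36 * 10 ^ 28)) := by
    rw [le_div_iff₀ (by norm_num)]
    refine le_trans (le_of_eq ?_) hcert
    norm_num
  refine le_trans ?_ (le_trans (mul_le_mul_of_nonneg_left hfrac ?_) (hfin.trans (le_of_eq ?_)))
  · have : gam m ^ 2 * ell m * (0.9999 * K0 m) * (1 - 1 / 10000) ^ 5 * (92.96 / 7.8) =
      (gam m ^ 2 * ell m * K0 m) * (0.9999 * (1 - 1 / 10000) ^ 5 * (92.96 / 7.8)) := by ring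
    rw [this, mul_comm]
    apply mul_le_mul_of_nonneg_left _ hX.le
    norm_num
  · positivity
  · congr!

end S17

namespace S17
open Finset Filter

/-- A tiny power of `m`. -/
noncomputable def Pm (m : ℕ) : ℝ := (m : ℝ) ^ (1 / 1000000 : ℝ)

noncomputable def Ws (m : ℕ) : Finset ℕ :=
  (Ioc (N1m m) (Nm m)).filter (fun n => Nat.Coprime n m)

lemma ev_P (C : ℝ) : ∀ᶠ m : ℕ in atTop, C ≤ Pm m := ev_rpow _ C (by norm_num)

lemma ev_P_tau : ∀ᶠ m : ℕ in atTop, ∀ n : ℕ, 1 ≤ n → n ≤ m ^ 4 → tau n ≤ Pm m :=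
  ev_tau _ (by norm_num)

lemma ev_P_log : ∀ᶠ m : ℕ in atTop, 5 * (1 + Real.log m) ≤ Pm m := ev_log_rpow _ 5 (by norm_num)

lemma Pm_pow (m k : ℕ) : Pm m ^ k = (m : ℝ) ^ ((k : ℝ) / 1000000) := by
  unfold Pm
  rw [← Real.rpow_natCast, ← Real.rpow_mul (Nat.cast_nonneg m)]
  congr 1; ring

lemma D_le_self (m : ℕ) (hm : 1 ≤ m) : fl m 1 ≤ m :=
  fl_le_self m hm 1 (by unfold rho; norm_num)

lemma Nm_le_self (m : ℕ) (hm : 1 ≤ m) : Nm m ≤ m :=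
  fl_le_self m hm 7.8 (by unfold rho; norm_num)

lemma ev_lam : ∀ᶠ m : ℕ in atTop, ∀ y : ℕ → ℝ, (∀ r, |y r| ≤ 5) →
    ∀ d, 1 ≤ d → |lamS m (fl m 1) y d| ≤ Pm m ^ 2 := by
  filter_upwards [ev_P 1, ev_P_tau, ev_P_log, ev_ell 1, eventually_ge_atTop 1]
    with m hP ht hlog hl hm y hy d hd
  have hD1 := one_le_fl m 1 (by linarith)
  have hDm := D_le_self m hm
  have h := lamS_bound m (fl m 1) y 5 (Pm m) hy (fun r h1 h2 => ht r h1
    (h2.trans (hDm.trans (Nat.le_self_pow (by norm_num) m)))) (by linarith) d hd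
  have hlogD : Real.log (fl m 1) ≤ Real.log m :=
    Real.log_le_log (by exact_mod_cast hD1) (by exact_mod_cast hDm)
  refine h.trans ?_
  nlinarith

lemma ev_lam_sum : ∀ᶠ m : ℕ in atTop, ∀ y : ℕ → ℝ, (∀ r, |y r| ≤ 5) →
    (∑ d ∈ Icc 1 (fl m 1), |lamS m (fl m 1) y d|) ^ 2 ≤ Pm m ^ 4 * Real.exp (2 * ell m) := by
  filter_upwards [ev_lam, ev_P 1] with m h hP y hy
  have h1 : ∑ d ∈ Icc 1 (fl m 1), |lamS m (fl m 1) y d| ≤ Real.exp (1 * ell m) * Pm m ^ 2 := by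
    refine (Finset.sum_le_card_nsmul _ _ (Pm m ^ 2)
      (fun d hd => h y hy d (mem_Icc.mp hd).1)).trans ?_
    rw [Nat.card_Icc, nsmul_eq_mul, Nat.add_sub_cancel]
    exact mul_le_mul_of_nonneg_right (fl_le m 1) (by positivity)
  have h2 := pow_le_pow_left₀ (Finset.sum_nonneg fun _ _ => abs_nonneg _) h1 2
  refine h2.trans (le_of_eq ?_)
  rw [mul_pow, ← Real.exp_nat_mul]
  push_cast
  ring_nf

lemma inv_N1 (m : ℕ) (hl : 0 ≤ ell m) : 1 / (N1m m : ℝ) ≤ 2 * Real.exp (-7.799922 * ell m) := by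
  have h1 := exp_le_two_fl m 7.799922 (by positivity)
  have h2 : (0 : ℝ) < N1m m := by exact_mod_cast one_le_fl m 7.799922 (by positivity)
  have h3 : Real.exp (-7.799922 * ell m) * Real.exp (7.799922 * ell m) = 1 := by
    rw [← Real.exp_add]; ring_nf; exact Real.exp_zero
  have h4 := Real.exp_pos (-7.799922 * ell m)
  rw [div_le_iff₀ h2]
  unfold N1m
  nlinarith

lemma ev_err : ∀ᶠ m : ℕ in atTop, ∀ y : ℕ → ℝ, (∀ r, |y r| ≤ 5) →
    (∑ d ∈ Icc 1 (fl m 1), |lamS m (fl m 1) y d|) ^ 2 * (1 / (N1m m : ℝ)) ≤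
      (m : ℝ) ^ (-0.50042 : ℝ) := by
  filter_upwards [ev_lam_sum, ev_P 2, ev_ell 1, eventually_ge_atTop 1] with m h hP hl hm y hy
  have hm0 : (0 : ℝ) < m := by exact_mod_cast hm
  have hm1 : (1 : ℝ) ≤ m := by exact_mod_cast hm
  have h1 := inv_N1 m (by linarith)
  calc _ ≤ (Pm m ^ 4 * Real.exp (2 * ell m)) * (2 * Real.exp (-7.799922 * ell m)) :=
        mul_le_mul (h y hy) h1 (by positivity) (by positivity)
    _ = Pm m ^ 4 * 2 * Real.exp (-5.799922 * ell m) := by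
        rw [show (-5.799922 * ell m) = 2 * ell m + -7.799922 * ell m by ring, Real.exp_add]; ring
    _ ≤ Pm m ^ 4 * Pm m * Real.exp (-5.799922 * ell m) := by gcongr
    _ = Pm m ^ 5 * Real.exp (-5.799922 * ell m) := by ring
    _ = (m : ℝ) ^ ((5 : ℕ) / 1000000 + -5.799922 * rho) := by
        rw [Pm_pow, exp_ell m hm, ← Real.rpow_add hm0]
    _ ≤ _ := by
        apply Real.rpow_le_rpow_of_exponent_le hm1
        unfold rho; norm_num

lemma quad_upper : ∀ᶠ m : ℕ in atTop, ∀ y : ℕ → ℝ, (∀ r, |y r| ≤ 5) →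
    ∑ n ∈ Ws m, LamD (lamS m (fl m 1) y) (fl m 1) n ^ 2 / n ≤
      gam m * (K0 m + 1) * (∑ r ∈ supp m (fl m 1), y r ^ 2 / r.totient) +
        (m : ℝ) ^ (-0.5 : ℝ) := by
  filter_upwards [ev_err, ev_P 4, ev_P_tau, ev_ell 1, eventually_ge_atTop 1]
    with m h hP ht hl hm y hy
  have hm0 : (0 : ℝ) < m := by exact_mod_cast hm
  have hm1 : (1 : ℝ) ≤ m := by exact_mod_cast hm
  have hl0 : 0 < ell m := by linarith
  have hN1 := one_le_fl m 7.799922 (by positivity)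
  have hNN : N1m m ≤ Nm m := fl_mono m hl0.le (by norm_num)
  have hq := quad_main m (by omega) (lamS m (fl m 1) y) (fl m 1) (N1m m) (Nm m) hN1 hNN
    (fun d hd => lamS_coprime m _ y d hd)
  rw [selberg_diag] at hq
  have h1 := (abs_le.mp hq).2
  have h2 := (harm_window (N1m m) (Nm m) hN1 hNN).2
  have h3 := (log_fl m 7.8 (by positivity)).2
  have h4 := (log_fl m 7.799922 (by positivity)).1
  have h5 : ∑ n ∈ Ioc (N1m m) (Nm m), (1 : ℝ) / n ≤ K0 m + 1 := by
    unfold K0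
    unfold Nm N1m at *
    linarith
  have hg := (gam_pos (m := m) (by omega)).le
  have hQ : 0 ≤ ∑ r ∈ supp m (fl m 1), y r ^ 2 / (r.totient : ℝ) :=
    Finset.sum_nonneg fun _ _ => by positivity
  have h6 : gam m * (∑ n ∈ Ioc (N1m m) (Nm m), (1 : ℝ) / n) *
      (∑ r ∈ supp m (fl m 1), y r ^ 2 / (r.totient : ℝ)) ≤
      gam m * (K0 m + 1) * (∑ r ∈ supp m (fl m 1), y r ^ 2 / (r.totient : ℝ)) := by gcongr
  have h7 : (∑ d ∈ Icc 1 (fl m 1), |lamS m (fl m 1) y d|) ^ 2 * (4 * tau m / (N1m m : ℝ)) ≤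
      (m : ℝ) ^ (-0.5 : ℝ) := by
    have htm := ht m hm (Nat.le_self_pow (by norm_num) m)
    have hB : 0 ≤ (∑ d ∈ Icc 1 (fl m 1), |lamS m (fl m 1) y d|) ^ 2 * (1 / (N1m m : ℝ)) := by
      positivity
    have ht0 := tau_nonneg m
    calc _ = ((∑ d ∈ Icc 1 (fl m 1), |lamS m (fl m 1) y d|) ^ 2 * (1 / (N1m m : ℝ))) *
          (4 * tau m) := by ring
      _ ≤ (m : ℝ) ^ (-0.50042 : ℝ) * (Pm m * Pm m) := by
          refine mul_le_mul (h y hy) ?_ (by positivity) (by positivity)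
          nlinarith
      _ = (m : ℝ) ^ (-0.50042 + (2 : ℕ) / 1000000 : ℝ) := by
          rw [← pow_two, Pm_pow, ← Real.rpow_add hm0]
      _ ≤ _ := Real.rpow_le_rpow_of_exponent_le hm1 (by norm_num)
  unfold Ws
  linarith

lemma yw_bound (m r : ℕ) : |yw m r| ≤ 5 := by
  unfold yw
  rw [abs_le]
  constructor <;> split_ifs <;> norm_num

lemma yw_sq (m : ℕ) (hl : 0 ≤ ell m) : ∑ r ∈ supp m (fl m 1), yw m r ^ 2 / (r.totient : ℝ) =
    4 * Gf m (fl m 1) + 5 * Gf m (fl m (3/4)) + 7 * Gf m (fl m (1/2)) + 9 * Gf m (fl m (1/4)) := by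
  have e : ∀ x : ℝ, x ≤ 1 → Gf m (fl m x) =
      ∑ r ∈ supp m (fl m 1), (if r ≤ fl m x then (1 : ℝ) else 0) / r.totient := by
    intro x hx
    unfold Gf
    rw [← supp_filter m (fl m 1) (fl m x) (fl_mono m hl hx), Finset.sum_filter]
    refine Finset.sum_congr rfl fun r _ => ?_
    split_ifs <;> simp
  rw [e 1 le_rfl, e (3/4) (by norm_num), e (1/2) (by norm_num), e (1/4) (by norm_num)]
  simp only [Finset.mul_sum, ← Finset.sum_add_distrib]
  refine Finset.sum_congr rfl fun r _ => ?_
  have h1 : fl m (1/4) ≤ fl m (1/2) := fl_mono m hl (by norm_num)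
  have h2 : fl m (1/2) ≤ fl m (3/4) := fl_mono m hl (by norm_num)
  have h3 : fl m (3/4) ≤ fl m 1 := fl_mono m hl (by norm_num)
  unfold yw
  have : ∀ t : ℝ, ∀ a b c d : ℝ, (2 * a + b + c + d) ^ 2 = 4 * a + 5 * b + 7 * c + 9 * d →
    (2 * a + b + c + d) ^ 2 / t = 4 * (a / t) + 5 * (b / t) + 7 * (c / t) + 9 * (d / t) := by
    intro t a b c d h
    rw [h]; ring
  apply this
  by_cases c1 : r ≤ fl m (1/4)
  · rw [if_pos c1, if_pos (c1.trans h1), if_pos (c1.trans (h1.trans h2)),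
      if_pos (c1.trans (h1.trans (h2.trans h3)))]; norm_num
  · by_cases c2 : r ≤ fl m (1/2)
    · rw [if_neg c1, if_pos c2, if_pos (c2.trans h2), if_pos (c2.trans (h2.trans h3))]; norm_num
    · by_cases c3 : r ≤ fl m (3/4)
      · rw [if_neg c1, if_neg c2, if_pos c3, if_pos (c3.trans h3)]; norm_num
      · rw [if_neg c1, if_neg c2, if_neg c3]
        split_ifs <;> norm_num

lemma ev_Gf : ∀ᶠ m : ℕ in atTop, ∀ x : ℝ, 0 ≤ x → x ≤ 1 →
    Gf m (fl m x) ≤ gam m * ell m * (x + 1 / 100000) ∧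
    gam m * ell m * (x - 2 / 100000) ≤ Gf m (fl m x) := by
  have hr := rho_pos
  filter_upwards [Gf_asymp (rho / 100000) (by positivity), ev_ell 100000, eventually_ge_atTop 1]
    with m h hl hm x hx hx1
  have hl0 : 0 < ell m := by linarith
  have hg := (gam_pos (m := m) (by omega)).le
  have h1 := h (fl m x) (one_le_fl m x (by positivity)) (fl_le_self m hm x (by
    unfold rho; linarith))
  have h2 : rho / 100000 * (gam m * Real.log m) = gam m * ell m / 100000 := by unfold ell; ring
  rw [h2, abs_le] at h1
  have h3 := log_fl m x (by positivity)
  have h4 := mul_le_mul_of_nonneg_left h3.1 hg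
  have h5 := mul_le_mul_of_nonneg_left h3.2 hg
  have h6 := mul_le_mul_of_nonneg_left hl hg
  constructor
  · linarith
  · linarith

/-- A lower bound for the natural scale. -/
lemma ev_scale : ∀ᶠ m : ℕ in atTop, 1 ≤ Pm m ^ 2 * gam m ^ 2 := by
  filter_upwards [ev_P_tau, eventually_ge_atTop 1] with m ht hm
  have h1 := ht m hm (Nat.le_self_pow (by norm_num) m)
  have h2 := inv_tau_le_gam m (by omega)
  have hg := (gam_pos (m := m) (by omega)).le
  have h3 : 1 ≤ Pm m * gam m := by nlinarith
  rw [← mul_pow]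
  exact one_le_pow₀ h3

noncomputable def hf (m n : ℕ) : ℝ := Lam m n ^ 2 / (n : ℝ)

lemma H_upper : ∀ᶠ m : ℕ in atTop, ∑ n ∈ Ws m, hf m n ≤
    13.51 * (gam m ^ 2 * ell m * K0 m) := by
  filter_upwards [quad_upper, ev_Gf, ev_ell (10 ^ 10), ev_scale, ev_P 1, eventually_ge_atTop 1]
    with m h hG hl hsc hP hm
  have hm0 : (0 : ℝ) < m := by exact_mod_cast hm
  have hm1 : (1 : ℝ) ≤ m := by exact_mod_cast hm
  have hl0 : 0 < ell m := by linarith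
  have hg := gam_pos (m := m) (by omega)
  have h1 := h (yw m) (yw_bound m)
  rw [yw_sq m hl0.le] at h1
  have hG1 := (hG 1 (by norm_num) (by norm_num)).1
  have hG2 := (hG (3/4) (by norm_num) (by norm_num)).1
  have hG3 := (hG (1/2) (by norm_num) (by norm_num)).1
  have hG4 := (hG (1/4) (by norm_num) (by norm_num)).1
  have hK : 1 ≤ 0.00001 * K0 m := by unfold K0; linarith
  have hK0 : 0 < K0 m := by unfold K0; positivity
  have h2 : 4 * Gf m (fl m 1) + 5 * Gf m (fl m (3/4)) + 7 * Gf m (fl m (1/2)) +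
      9 * Gf m (fl m (1/4)) ≤ gam m * ell m * 13.501 := by
    have : 0 < gam m * ell m := by positivity
    linarith
  have h3 : (m : ℝ) ^ (-0.5 : ℝ) ≤ gam m ^ 2 := by
    have e : (m : ℝ) ^ (-0.5 : ℝ) * Pm m ^ 2 ≤ 1 := by
      rw [Pm_pow, ← Real.rpow_add hm0]
      apply Real.rpow_le_one_of_one_le_of_nonpos hm1
      norm_num
    have e0 : 0 < (m : ℝ) ^ (-0.5 : ℝ) := by positivity
    have e1 : 0 ≤ gam m ^ 2 := by positivity
    nlinarith
  have h4 : gam m * (K0 m + 1) * (4 * Gf m (fl m 1) + 5 * Gf m (fl m (3/4)) +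
      7 * Gf m (fl m (1/2)) + 9 * Gf m (fl m (1/4))) ≤
      gam m * (1.00001 * K0 m) * (gam m * ell m * 13.501) := by
    apply mul_le_mul _ h2 _ (by positivity)
    · apply mul_le_mul_of_nonneg_left _ hg.le; linarith
    · have := Gf_nonneg m; have := this (fl m 1); have := Gf_nonneg m (fl m (3/4))
      have := Gf_nonneg m (fl m (1/2)); have := Gf_nonneg m (fl m (1/4))
      positivity
  have h5 : gam m ^ 2 ≤ 0.00001 * (gam m ^ 2 * ell m * K0 m) := by
    have : 1 ≤ ell m * (0.00001 * K0 m) := by nlinarith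
    have := mul_le_mul_of_nonneg_left this (sq_nonneg (gam m))
    linarith
  have h6 : 0 < gam m ^ 2 * ell m * K0 m := by positivity
  unfold hf Lam
  linarith

end S17

namespace S17
open Finset Filter

noncomputable def LV (m n : ℕ) : ℝ := LamD (lamS m (fl m 1) (fun _ => 1)) (fl m 1) n
noncomputable def nuf (m n : ℕ) : ℝ :=
  Real.log (Nm m) / Gf m (fl m 1) ^ 2 * (LV m n ^ 2 / (n : ℝ))
noncomputable def ff (n : ℕ) : ℝ := if n.Prime then Real.log n / n else 0

lemma one_le_Gf (m x : ℕ) (hx : 1 ≤ x) : 1 ≤ Gf m x := by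
  have h1 : 1 ∈ supp m x := by
    rw [mem_supp]
    exact ⟨⟨le_rfl, hx⟩, squarefree_one, Nat.coprime_one_left m⟩
  have := Finset.single_le_sum (f := fun r : ℕ => (1 : ℝ) / r.totient)
    (fun b _ => by positivity) h1
  unfold Gf
  simpa using this

lemma LV_prime (m p : ℕ) (hp : p.Prime) (hD : fl m 1 < p) : LV m p = Gf m (fl m 1) := by
  unfold LV
  have h := LamD_coprime (lamS m (fl m 1) (fun _ => 1)) (fl m 1) 1 p (by
    intro q hq hqp
    rw [(Nat.prime_dvd_prime_iff_eq hq hp).mp hqp]; exact hD)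
  rw [one_mul] at h
  rw [h, LamD_divisors _ _ _ _ one_ne_zero, Nat.divisors_one, Finset.sum_singleton]
  simp [lamS, Ysum, Gf]

lemma ff_nonneg (n : ℕ) : 0 ≤ ff n := by
  unfold ff
  split_ifs
  · exact div_nonneg (Real.log_natCast_nonneg n) (Nat.cast_nonneg n)
  · exact le_rfl

lemma ff_le_nuf (m n : ℕ) (hl : 0 ≤ ell m) (hn : n ∈ Ws m) : ff n ≤ nuf m n := by
  unfold Ws at hn
  rw [mem_filter, mem_Ioc] at hn
  have hG := one_le_Gf m (fl m 1) (one_le_fl m 1 (by linarith))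
  unfold ff nuf
  split_ifs with hp
  · have hD : fl m 1 < n := lt_of_le_of_lt (fl_mono m hl (by norm_num)) hn.1.1
    rw [LV_prime m n hp hD]
    have h1 : Real.log n ≤ Real.log (Nm m) :=
      Real.log_le_log (by exact_mod_cast hp.pos) (by exact_mod_cast hn.1.2)
    have hn0 : (0 : ℝ) < n := by exact_mod_cast hp.pos
    have : Real.log (Nm m) / Gf m (fl m 1) ^ 2 * (Gf m (fl m 1) ^ 2 / (n : ℝ)) =
        Real.log (Nm m) / n := by field_simp
    rw [this]
    gcongr
  · have := Real.log_natCast_nonneg (Nm m)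
    positivity

lemma V_upper : ∀ᶠ m : ℕ in atTop, ∑ n ∈ Ws m, nuf m n ≤ 7.8078 * K0 m := by
  filter_upwards [quad_upper, ev_Gf, ev_ell (10 ^ 10), ev_log_rpow 0.5 1 (by norm_num),
    eventually_ge_atTop 1] with m h hG hl hlog hm
  have hm0 : (0 : ℝ) < m := by exact_mod_cast hm
  have hm1 : (1 : ℝ) ≤ m := by exact_mod_cast hm
  have hl0 : 0 < ell m := by linarith
  have hg := gam_pos (m := m) (by omega)
  have h1 := h (fun _ => 1) (by intro r; norm_num)
  have hG1 := (hG 1 (by norm_num) (by norm_num)).2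
  have hG0 := one_le_Gf m (fl m 1) (one_le_fl m 1 (by linarith))
  have hsq : ∑ r ∈ supp m (fl m 1), (1 : ℝ) ^ 2 / (r.totient : ℝ) = Gf m (fl m 1) := by
    simp [Gf]
  rw [hsq] at h1
  set G := Gf m (fl m 1) with hGd
  have hK0 : 0 < K0 m := by unfold K0; positivity
  have hK : 1 ≤ 0.00001 * K0 m := by unfold K0; linarith
  have hlN := (log_fl m 7.8 (by positivity)).2
  have hlN0 : 0 ≤ Real.log (Nm m) := Real.log_natCast_nonneg _
  have hG2 : 1 ≤ G ^ 2 := one_le_pow₀ hG0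
  have e1 : ell m * (m : ℝ) ^ (-0.5 : ℝ) ≤ 1 := by
    rw [Real.rpow_neg hm0.le]
    rw [mul_inv_le_iff₀ (by positivity), one_mul]
    refine le_trans ?_ hlog
    have : 0 ≤ Real.log m := Real.log_natCast_nonneg m
    unfold ell rho
    linarith
  unfold nuf
  rw [← Finset.mul_sum]
  calc Real.log (Nm m) / G ^ 2 * ∑ n ∈ Ws m, LV m n ^ 2 / (n : ℝ)
      ≤ (7.8 * ell m) / G ^ 2 * (gam m * (K0 m + 1) * G + (m : ℝ) ^ (-0.5 : ℝ)) := by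
        apply mul_le_mul _ h1 (Finset.sum_nonneg fun _ _ => by positivity) (by positivity)
        gcongr
        exact hlN
    _ = 7.8 * (K0 m + 1) * (gam m * ell m / G) + 7.8 * (ell m * (m : ℝ) ^ (-0.5 : ℝ)) / G ^ 2 := by
        field_simp
    _ ≤ 7.8 * (K0 m + 1) * 1.0001 + 7.8 := by
        apply add_le_add
        · apply mul_le_mul_of_nonneg_left _ (by positivity)
          rw [div_le_iff₀ (by linarith)]
          have : 0 < gam m * ell m := by positivity
          linarith
        · rw [div_le_iff₀ (by linarith)]
          linarith
    _ ≤ _ := by linarith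

lemma S_lower : ∀ᶠ m : ℕ in atTop, 0.999 * K0 m ≤ ∑ n ∈ Ws m, ff n := by
  have hr := rho_pos
  obtain ⟨C, hC, hev⟩ := prime_window (rho / 2) (by positivity)
  filter_upwards [hev, ev_m_rpow_le_D, ev_ell ((1 + C) * 10 ^ 8), eventually_ge_atTop 1]
    with m h hD hl hm
  have hl0 : 0 < ell m := lt_of_lt_of_le (by positivity) hl
  have hDN : fl m 1 ≤ N1m m := fl_mono m hl0.le (by norm_num)
  have hNN : N1m m ≤ Nm m := fl_mono m hl0.le (by norm_num)
  have h1 := (abs_le.mp (h (N1m m) (Nm m) (hD.trans (by exact_mod_cast hDN)) hNN)).1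
  have h3 := (log_fl m 7.8 (by positivity)).1
  have h4 := (log_fl m 7.799922 (by positivity)).2
  have h5 : ∑ p ∈ Pr m (N1m m) (Nm m), Real.log p / p = ∑ n ∈ Ws m, ff n := by
    unfold ff
    rw [← Finset.sum_filter]
    apply Finset.sum_congr _ (fun _ _ => rfl)
    ext p
    unfold Ws
    rw [mem_Pr, mem_filter, mem_filter, mem_Ioc]
    constructor
    · rintro ⟨a, b, c⟩
      exact ⟨⟨a, (Nat.Prime.coprime_iff_not_dvd b).mpr c⟩, b⟩
    · rintro ⟨⟨a, c⟩, b⟩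
      exact ⟨a, b, (Nat.Prime.coprime_iff_not_dvd b).mp c⟩
  rw [← h5]
  unfold K0
  unfold Nm N1m at *
  linarith

noncomputable def hbf (m n : ℕ) : ℝ := if ArithmeticFunction.cardFactors n ≤ 4 then 0 else hf m n

lemma Hb_eq (m : ℕ) : ∑ n ∈ Ws m, hbf m n = ∑ n ∈ Ws m, hf m n - Hg m := by
  unfold Hg
  rw [← Finset.filter_filter, Finset.sum_filter]
  change _ = ∑ n ∈ Ws m, hf m n - ∑ n ∈ Ws m, _
  rw [← Finset.sum_sub_distrib]
  refine Finset.sum_congr rfl fun n _ => ?_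
  unfold hbf hf
  split_ifs <;> ring

lemma main_pos : ∀ᶠ m : ℕ in atTop, 1 ≤ K0 m ∧ 0.5 * (K0 m * (gam m ^ 2 * ell m * K0 m)) ≤
    (∑ n ∈ Ws m, ff n) * (∑ n ∈ Ws m, hf m n) - (∑ n ∈ Ws m, nuf m n) * (∑ n ∈ Ws m, hbf m n) := by
  filter_upwards [H_upper, V_upper, S_lower, Hg_lower, ev_ell (10 ^ 10), eventually_ge_atTop 1]
    with m hH hV hS hHg hl hm
  have hl0 : 0 < ell m := by linarith
  have hg := gam_pos (m := m) (by omega)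
  have hK0 : 1 ≤ K0 m := by unfold K0; linarith
  refine ⟨hK0, ?_⟩
  have hX : 0 < gam m ^ 2 * ell m * K0 m := by positivity
  have hHb0 : 0 ≤ ∑ n ∈ Ws m, hbf m n := Finset.sum_nonneg fun n _ => by
    unfold hbf hf; split_ifs <;> positivity
  have hHb := Hb_eq m
  rw [hHb] at hHb0 ⊢
  set X := gam m ^ 2 * ell m * K0 m
  set H := ∑ n ∈ Ws m, hf m n
  set V := ∑ n ∈ Ws m, nuf m n
  set S := ∑ n ∈ Ws m, ff n
  set g := Hg m
  set K := K0 m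
  have hH0 : 0 ≤ H := by linarith
  have a1 : V * (H - g) ≤ 7.8078 * K * (H - g) := mul_le_mul_of_nonneg_right hV hHb0
  have a2 : 0.999 * K * H ≤ S * H := mul_le_mul_of_nonneg_right hS hH0
  have a3 : K * (11.9 * X) ≤ K * g := mul_le_mul_of_nonneg_left hHg (by linarith)
  have a4 : K * H ≤ K * (13.51 * X) := mul_le_mul_of_nonneg_left hH (by linarith)
  have a5 : 0 < K * X := by positivity
  linarith

end S17

namespace S17
open Finset Filter

lemma hat_eq {m : ℕ} [NeZero m] (lam : ℕ → ℝ) (D : ℕ) (χ : DirichletCharacter ℂ m) :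
    hat (Ws m) (fun n => LamD lam D n ^ 2 / (n : ℝ)) χ =
    ∑ n ∈ Ioc (N1m m) (Nm m), χ (n : ZMod m) / n * ((LamD lam D n ^ 2 : ℝ) : ℂ) := by
  unfold hat Ws
  rw [Finset.sum_filter]
  refine Finset.sum_congr rfl fun n _ => ?_
  split_ifs with hc
  · push_cast; ring
  · rw [MulChar.map_nonunit χ (by rwa [ZMod.isUnit_iff_coprime])]
    simp

lemma PV_le : ∀ᶠ m : ℕ in atTop, PV m ≤ (m : ℝ) ^ (0.5 : ℝ) * Pm m ^ 2 := by
  filter_upwards [ev_P_tau, ev_P_log, ev_P 1, eventually_ge_atTop 1] with m ht hlog hP hm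
  have htm := ht m hm (Nat.le_self_pow (by norm_num) m)
  have h0 := tau_nonneg m
  have hl : 0 ≤ Real.log m := Real.log_natCast_nonneg m
  unfold PV
  rw [Real.sqrt_eq_rpow, show (1 / 2 : ℝ) = 0.5 by norm_num]
  apply mul_le_mul_of_nonneg_left _ (by positivity)
  rw [pow_two]
  apply mul_le_mul htm _ (by linarith) (by linarith)
  linarith

lemma ev_hat : ∀ᶠ m : ℕ in atTop, ∀ [NeZero m], ∀ y : ℕ → ℝ, (∀ r, |y r| ≤ 5) →
    ∀ χ : DirichletCharacter ℂ m, χ ≠ 1 →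
    ‖hat (Ws m) (fun n => LamD (lamS m (fl m 1) y) (fl m 1) n ^ 2 / (n : ℝ)) χ‖ * Pm m ≤
      (m : ℝ) ^ (-0.0004 : ℝ) := by
  filter_upwards [ev_err, PV_le, ev_P 2, ev_ell 1, eventually_ge_atTop 1]
    with m h hPV hP hl hm _ y hy χ hχ
  have hm0 : (0 : ℝ) < m := by exact_mod_cast hm
  have hm1 : (1 : ℝ) ≤ m := by exact_mod_cast hm
  have hl0 : 0 < ell m := by linarith
  have hN1 := one_le_fl m 7.799922 (by positivity)
  have hNN : N1m m ≤ Nm m := fl_mono m hl0.le (by norm_num)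
  have hq := quad_char (lamS m (fl m 1) y) (fl m 1) (N1m m) (Nm m) hN1 hNN χ hχ
  rw [hat_eq]
  have h1 := h y hy
  have hPV0 := PV_nonneg m
  calc _ ≤ ((∑ d ∈ Icc 1 (fl m 1), |lamS m (fl m 1) y d|) ^ 2 * (2 * PV m / (N1m m : ℝ))) * Pm m :=
        mul_le_mul_of_nonneg_right hq (by linarith)
    _ = ((∑ d ∈ Icc 1 (fl m 1), |lamS m (fl m 1) y d|) ^ 2 * (1 / (N1m m : ℝ))) *
          (2 * PV m * Pm m) := by ring
    _ ≤ (m : ℝ) ^ (-0.50042 : ℝ) * (Pm m * ((m : ℝ) ^ (0.5 : ℝ) * Pm m ^ 2) * Pm m) := by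
        apply mul_le_mul h1 _ (by positivity) (by positivity)
        gcongr
    _ = (m : ℝ) ^ (-0.50042 : ℝ) * (m : ℝ) ^ (0.5 : ℝ) * Pm m ^ 4 := by ring
    _ = (m : ℝ) ^ (-0.50042 + 0.5 + (4 : ℕ) / 1000000 : ℝ) := by
        rw [Pm_pow, ← Real.rpow_add hm0, ← Real.rpow_add hm0]
    _ ≤ _ := Real.rpow_le_rpow_of_exponent_le hm1 (by norm_num)

lemma ev_E : ∀ᶠ m : ℕ in atTop, ∀ [NeZero m], ∀ χ : DirichletCharacter ℂ m, χ ≠ 1 →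
    ‖hat (Ws m) (hf m) χ‖ ≤ (m : ℝ) ^ (-0.0004 : ℝ) ∧
    ‖hat (Ws m) (nuf m) χ‖ ≤ (m : ℝ) ^ (-0.0004 : ℝ) := by
  filter_upwards [ev_hat, ev_P 1, ev_P_log, ev_ell 1, eventually_ge_atTop 1]
    with m h hP hlog hl hm _ χ hχ
  have hl0 : 0 < ell m := by linarith
  constructor
  · have h1 := h (yw m) (yw_bound m) χ hχ
    refine le_trans ?_ h1
    exact le_mul_of_one_le_right (norm_nonneg _) hP
  · have h1 := h (fun _ => 1) (by intro r; norm_num) χ hχ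
    refine le_trans ?_ h1
    have hG := one_le_Gf m (fl m 1) (one_le_fl m 1 (by linarith))
    have e : hat (Ws m) (nuf m) χ = ((Real.log (Nm m) / Gf m (fl m 1) ^ 2 : ℝ) : ℂ) *
        hat (Ws m) (fun n => LamD (lamS m (fl m 1) (fun _ => 1)) (fl m 1) n ^ 2 / (n : ℝ)) χ := by
      unfold hat nuf LV
      rw [Finset.mul_sum]
      refine Finset.sum_congr rfl fun n _ => ?_
      push_cast; ring
    rw [e, norm_mul, mul_comm, Complex.norm_real]
    apply mul_le_mul_of_nonneg_left _ (norm_nonneg _)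
    have hlN0 : 0 ≤ Real.log (Nm m) := Real.log_natCast_nonneg _
    rw [Real.norm_of_nonneg (by positivity)]
    have hG2 : 1 ≤ Gf m (fl m 1) ^ 2 := one_le_pow₀ hG
    have h3 : Real.log (Nm m) ≤ Real.log m := Real.log_le_log
      (by exact_mod_cast one_le_fl m 7.8 (by positivity)) (by exact_mod_cast Nm_le_self m hm)
    have h4 : 0 ≤ Real.log m := Real.log_natCast_nonneg m
    exact (div_le_self hlN0 hG2).trans (by linarith)

lemma Lam_abs (m n : ℕ) (hn : 1 ≤ n) (B : ℝ)
    (hB : ∀ d, 1 ≤ d → |lamS m (fl m 1) (yw m) d| ≤ B) : |Lam m n| ≤ tau n * B := by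
  unfold Lam
  rw [LamD_divisors _ _ _ _ (by omega)]
  refine (Finset.abs_sum_le_sum_abs _ _).trans ?_
  refine (Finset.sum_le_card_nsmul _ _ B fun d hd => hB d (Nat.pos_of_mem_divisors hd)).trans ?_
  rw [nsmul_eq_mul]
  exact le_of_eq (by unfold tau; rfl)

lemma ev_B : ∀ᶠ m : ℕ in atTop, ∀ n ∈ Ws m, (0 ≤ ff n ∧ ff n ≤ Pm m ^ 6 * (1 / (N1m m : ℝ))) ∧
    (0 ≤ hbf m n ∧ hbf m n ≤ Pm m ^ 6 * (1 / (N1m m : ℝ))) := by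
  filter_upwards [ev_lam, ev_P 1, ev_P_log, ev_P_tau, ev_ell 1, eventually_ge_atTop 1]
    with m h hP hlog ht hl hm n hn
  have hl0 : 0 < ell m := by linarith
  have hN1 : (0 : ℝ) < N1m m := by exact_mod_cast one_le_fl m 7.799922 (by positivity)
  unfold Ws at hn
  rw [mem_filter, mem_Ioc] at hn
  have hn1 : 1 ≤ n := by omega
  have hnm : n ≤ m := hn.1.2.trans (Nm_le_self m hm)
  have hnr : (0 : ℝ) < n := by exact_mod_cast hn1
  have hinv : 1 / (n : ℝ) ≤ 1 / (N1m m : ℝ) :=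
    one_div_le_one_div_of_le hN1 (by exact_mod_cast hn.1.1.le)
  have hh : 0 ≤ hf m n ∧ hf m n ≤ Pm m ^ 6 * (1 / (N1m m : ℝ)) := by
    unfold hf
    refine ⟨by positivity, ?_⟩
    have h1 := Lam_abs m n hn1 _ (h (yw m) (yw_bound m))
    have h2 := ht n hn1 (hnm.trans (Nat.le_self_pow (by norm_num) m))
    have h3 : |Lam m n| ≤ Pm m ^ 3 := by
      refine h1.trans ?_
      calc tau n * Pm m ^ 2 ≤ Pm m * Pm m ^ 2 := by gcongr
        _ = _ := by ring
    have h4 : Lam m n ^ 2 ≤ Pm m ^ 6 := by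
      rw [← sq_abs]
      calc |Lam m n| ^ 2 ≤ (Pm m ^ 3) ^ 2 := by gcongr
        _ = _ := by ring
    rw [div_eq_mul_one_div]
    exact mul_le_mul h4 hinv (by positivity) (by positivity)
  refine ⟨⟨ff_nonneg n, ?_⟩, ?_⟩
  · unfold ff
    split_ifs
    · rw [div_eq_mul_one_div]
      apply mul_le_mul _ hinv (by positivity) (by positivity)
      have h3 : Real.log n ≤ Real.log m := Real.log_le_log hnr (by exact_mod_cast hnm)
      have h4 : 0 ≤ Real.log m := Real.log_natCast_nonneg m
      have h5 : Pm m ≤ Pm m ^ 6 := le_self_pow₀ hP (by norm_num)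
      linarith
    · positivity
  · unfold hbf
    split_ifs
    · exact ⟨le_rfl, by positivity⟩
    · exact hh

lemma ev_Mo : ∀ᶠ m : ℕ in atTop, ∀ T : ℕ, (T : ℝ) ≤ Pm m →
    (m : ℝ) * ((Pm m ^ 6 * (1 / (N1m m : ℝ))) ^ 4 * ((Nm m : ℝ) ^ 2 * (T * ((Nm m : ℝ) ^ 2 / m + 1))))
      ≤ (m : ℝ) ^ (0.0001 : ℝ) := by
  filter_upwards [ev_P 2, ev_ell 10, eventually_ge_atTop 1] with m hP hl hm T hT
  have hm0 : (0 : ℝ) < m := by exact_mod_cast hm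
  have hm1 : (1 : ℝ) ≤ m := by exact_mod_cast hm
  have hl0 : 0 < ell m := by linarith
  have hP0 : 0 < Pm m := by linarith
  have hN1 : (0 : ℝ) < N1m m := by exact_mod_cast one_le_fl m 7.799922 (by positivity)
  -- `N / N1` is small
  have hratio : (Nm m : ℝ) * (1 / (N1m m : ℝ)) ≤ Pm m ^ 8 := by
    calc (Nm m : ℝ) * (1 / (N1m m : ℝ)) ≤ Real.exp (7.8 * ell m) *
          (2 * Real.exp (-7.799922 * ell m)) :=
          mul_le_mul (fl_le m 7.8) (inv_N1 m hl0.le) (by positivity) (by positivity)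
      _ = 2 * Real.exp (0.000078 * ell m) := by
          rw [show 0.000078 * ell m = 7.8 * ell m + -7.799922 * ell m by ring, Real.exp_add]; ring
      _ ≤ Pm m * Pm m ^ 7 := by
          apply mul_le_mul hP _ (by positivity) (by positivity)
          rw [exp_ell m hm, Pm_pow]
          apply Real.rpow_le_rpow_of_exponent_le hm1
          unfold rho; norm_num
      _ = _ := by ring
  -- `N ^ 2` exceeds `m`
  have hN2 : (m : ℝ) ≤ (Nm m : ℝ) ^ 2 := by
    have h1 := exp_le_two_fl m 7.8 (by positivity)
    have h2 : Real.exp (7.8 * ell m) = Real.exp (5.85 * ell m) * Real.exp (1.95 * ell m) := by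
      rw [← Real.exp_add]; congr 1; ring
    have h3 : 2 ≤ Real.exp (1.95 * ell m) := by
      have := Real.add_one_le_exp (1.95 * ell m); linarith
    have h4 : Real.exp (5.85 * ell m) ≤ Nm m := by
      unfold Nm
      have := Real.exp_pos (5.85 * ell m)
      nlinarith
    calc (m : ℝ) = (m : ℝ) ^ (1 : ℝ) := (Real.rpow_one _).symm
      _ ≤ (m : ℝ) ^ ((2 * 5.85) * rho) := by
          apply Real.rpow_le_rpow_of_exponent_le hm1; unfold rho; norm_num
      _ = Real.exp (5.85 * ell m) ^ 2 := by
          rw [← exp_ell m hm, ← Real.exp_nat_mul]; congr 1; push_cast; ring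
      _ ≤ _ := by gcongr
  have hN2' : (Nm m : ℝ) ^ 2 / m + 1 ≤ 2 * (Nm m : ℝ) ^ 2 / m := by
    rw [div_add_one hm0.ne']
    gcongr
    linarith
  calc _ ≤ (m : ℝ) * ((Pm m ^ 6 * (1 / (N1m m : ℝ))) ^ 4 * ((Nm m : ℝ) ^ 2 *
        (Pm m * (2 * (Nm m : ℝ) ^ 2 / m)))) := by gcongr
    _ = 2 * Pm m ^ 25 * ((Nm m : ℝ) * (1 / (N1m m : ℝ))) ^ 4 := by
        field_simp
    _ ≤ Pm m * Pm m ^ 25 * (Pm m ^ 8) ^ 4 := by gcongr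
    _ = Pm m ^ 58 := by ring
    _ ≤ _ := by
        rw [Pm_pow]
        exact Real.rpow_le_rpow_of_exponent_le hm1 (by norm_num)

lemma final_switch : ∀ᶠ m : ℕ in atTop, ∀ [NeZero m], ∀ a : ZMod m, IsUnit a →
    ∃ p1 ∈ Ws m, ∃ p2 ∈ Ws m, ∃ p3 ∈ Ws m, ∃ p4 ∈ Ws m, ∃ n ∈ Ws m,
      a = ((p1 * (p2 * (p3 * (p4 * n))) : ℕ) : ZMod m) ∧
      ff p1 ≠ 0 ∧ ff p2 ≠ 0 ∧ ff p3 ≠ 0 ∧ ff p4 ≠ 0 ∧ hf m n ≠ hbf m n := by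
  filter_upwards [ev_E, ev_B, ev_Mo, main_pos, S_lower, ev_scale, ev_P_tau, ev_P 100, ev_ell 1,
    eventually_ge_atTop 1] with m hE hB hMo hmain hS hsc ht hP hl hm _ a ha
  have hm0 : (0 : ℝ) < m := by exact_mod_cast hm
  have hm1 : (1 : ℝ) ≤ m := by exact_mod_cast hm
  have hl0 : 0 < ell m := by linarith
  have hWm : ∀ n ∈ Ws m, Nat.Coprime n m := fun n hn => (mem_filter.mp hn).2
  have hW : ∀ n ∈ Ws m, 1 ≤ n ∧ n ≤ Nm m := by
    intro n hn
    have := mem_Ioc.mp (mem_filter.mp hn).1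
    omega
  have hNm := Nm_le_self m hm
  have hT : ∀ u, 1 ≤ u → u ≤ Nm m ^ 2 → u.divisors.card ≤ ⌊Pm m⌋₊ := by
    intro u hu1 hu
    apply Nat.le_floor
    refine ht u hu1 (hu.trans ?_)
    calc Nm m ^ 2 ≤ m ^ 2 := Nat.pow_le_pow_left hNm 2
      _ ≤ m ^ 4 := Nat.pow_le_pow_right hm (by norm_num)
  have hTr : ((⌊Pm m⌋₊ : ℕ) : ℝ) ≤ Pm m := Nat.floor_le (by linarith)
  have hMo2 := hMo _ hTr
  refine switching (Ws m) hWm ff (nuf m) (hf m) (hbf m) (fun n _ => ff_nonneg n)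
    (fun n hn => ff_le_nuf m n hl0.le hn) (fun n hn => (hB n hn).2.1) ((m : ℝ) ^ (-0.0004 : ℝ))
    ((m : ℝ) ^ (0.0001 : ℝ)) a ha (fun χ hχ => (hE χ hχ).1) (fun χ hχ => (hE χ hχ).2)
    ?_ ?_ (by positivity) ?_
  · exact (moment_bound (Ws m) (Nm m) _ hW hWm hT ff ff _ (fun n hn => (hB n hn).1)
      (fun n hn => (hB n hn).1)).trans hMo2
  · exact (moment_bound (Ws m) (Nm m) _ hW hWm hT ff (hbf m) _ (fun n hn => (hB n hn).1)
      (fun n hn => (hB n hn).2)).trans hMo2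
  · obtain ⟨hK, hmain⟩ := hmain
    have hg := gam_pos (m := m) (by omega)
    have h1 : (m : ℝ) ^ (-0.0004 : ℝ) * (m : ℝ) ^ (0.0001 : ℝ) * Pm m ^ 3 ≤ 1 := by
      rw [Pm_pow, ← Real.rpow_add hm0, ← Real.rpow_add hm0]
      apply Real.rpow_le_one_of_one_le_of_nonpos hm1
      norm_num
    set Z := (m : ℝ) ^ (-0.0004 : ℝ) * (m : ℝ) ^ (0.0001 : ℝ) with hZ
    have hZ0 : 0 < Z := by positivity
    have h2 : 100 * Z ≤ gam m ^ 2 := by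
      have e1 : Z * Pm m ≤ gam m ^ 2 := by
        have e2 : Z * Pm m ^ 3 * gam m ^ 2 ≤ 1 * gam m ^ 2 :=
          mul_le_mul_of_nonneg_right h1 (by positivity)
        have e3 : Z * Pm m * 1 ≤ Z * Pm m * (Pm m ^ 2 * gam m ^ 2) :=
          mul_le_mul_of_nonneg_left hsc (by positivity)
        calc Z * Pm m = Z * Pm m * 1 := by ring
          _ ≤ Z * Pm m * (Pm m ^ 2 * gam m ^ 2) := e3
          _ = Z * Pm m ^ 3 * gam m ^ 2 := by ring
          _ ≤ _ := e2
          _ = _ := by ring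
      have : Z * 100 ≤ Z * Pm m := mul_le_mul_of_nonneg_left hP hZ0.le
      linarith
    have h3 : gam m ^ 2 ≤ K0 m * (gam m ^ 2 * ell m * K0 m) := by
      have e1 : 1 ≤ K0 m * (ell m * K0 m) := by
        have : 1 ≤ ell m * K0 m := by nlinarith
        nlinarith
      have := mul_le_mul_of_nonneg_left e1 (sq_nonneg (gam m))
      linarith
    have h4 : (0.9 : ℝ) ^ 3 ≤ (∑ n ∈ Ws m, ff n) ^ 3 :=
      pow_le_pow_left₀ (by norm_num) (by linarith) 3
    have h5 : (0.9 : ℝ) ^ 3 * (50 * Z) ≤ (∑ n ∈ Ws m, ff n) ^ 3 *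
        ((∑ n ∈ Ws m, ff n) * (∑ n ∈ Ws m, hf m n) -
          (∑ n ∈ Ws m, nuf m n) * (∑ n ∈ Ws m, hbf m n)) := by
      apply mul_le_mul h4 _ (by positivity) (le_trans (by norm_num) h4)
      linarith
    refine lt_of_lt_of_le ?_ h5
    have : (0.9 : ℝ) ^ 3 * (50 * Z) = 36.45 * Z := by norm_num; ring
    rw [this]
    linarith

lemma ff_ne {n : ℕ} (h : ff n ≠ 0) : n.Prime := by
  by_contra hc
  exact h (by unfold ff; rw [if_neg hc])

lemma hf_ne {m n : ℕ} (h : hf m n ≠ hbf m n) : ArithmeticFunction.cardFactors n ≤ 4 := by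
  by_contra hc
  exact h (by unfold hbf; rw [if_neg hc])

lemma Nm_le_rpow (m : ℕ) (hm : 1 ≤ m) (ε : ℝ) (hε : 0 < ε) (q : ℕ) (hq : q ≤ Nm m) :
    (q : ℝ) ≤ (m : ℝ) ^ ((0.673 : ℝ) + ε) := by
  have hm1 : (1 : ℝ) ≤ m := by exact_mod_cast hm
  have h1 : (q : ℝ) ≤ Nm m := by exact_mod_cast hq
  refine h1.trans ((fl_le m 7.8).trans ?_)
  rw [exp_ell m hm]
  apply Real.rpow_le_rpow_of_exponent_le hm1
  unfold rho
  linarith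

end S17

theorem stmt_17 : ∀ ε : ℝ, 0 < ε → ∃ M : ℕ, ∀ m : ℕ, M ≤ m → ∀ a : ℤ, Int.gcd a m = 1 →
    ∃ L : List ℕ, L.length ≤ 8 ∧
      (∀ q ∈ L, q.Prime ∧ (q : ℝ) ≤ (m : ℝ) ^ ((0.673 : ℝ) + ε)) ∧
      ((L.prod : ℕ) : ℤ) ≡ a [ZMOD (m : ℤ)] := by
  intro ε hε
  obtain ⟨M, hM⟩ := Filter.eventually_atTop.mp (S17.final_switch.and (Filter.eventually_ge_atTop 1))
  refine ⟨M, fun m hMm a hgcd => ?_⟩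
  obtain ⟨hsw, hm⟩ := hM m hMm
  haveI : NeZero m := ⟨by omega⟩
  have hunit : IsUnit (a : ZMod m) := by
    rw [ZMod.coe_int_isUnit_iff_isCoprime]
    exact (Int.isCoprime_iff_gcd_eq_one.mpr hgcd).symm
  obtain ⟨p1, h1, p2, h2, p3, h3, p4, h4, n, hn, he, f1, f2, f3, f4, fn⟩ := hsw (a : ZMod m) hunit
  have hWle : ∀ x ∈ S17.Ws m, 1 ≤ x ∧ x ≤ S17.Nm m := by
    intro x hx
    have := Finset.mem_Ioc.mp (Finset.mem_filter.mp hx).1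
    omega
  have hn0 : n ≠ 0 := by have := (hWle n hn).1; omega
  refine ⟨p1 :: p2 :: p3 :: p4 :: n.primeFactorsList, ?_, ?_, ?_⟩
  · have := S17.hf_ne fn
    rw [ArithmeticFunction.cardFactors_apply] at this
    simp only [List.length_cons]
    omega
  · intro q hq
    have key : q.Prime ∧ q ≤ S17.Nm m := by
      simp only [List.mem_cons] at hq
      rcases hq with rfl | rfl | rfl | rfl | hq
      · exact ⟨S17.ff_ne f1, (hWle _ h1).2⟩
      · exact ⟨S17.ff_ne f2, (hWle _ h2).2⟩
      · exact ⟨S17.ff_ne f3, (hWle _ h3).2⟩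
      · exact ⟨S17.ff_ne f4, (hWle _ h4).2⟩
      · exact ⟨Nat.prime_of_mem_primeFactorsList hq,
          (Nat.le_of_mem_primeFactorsList hq).trans (hWle n hn).2⟩
    exact ⟨key.1, S17.Nm_le_rpow m hm ε hε q key.2⟩
  · rw [← ZMod.intCast_eq_intCast_iff]
    rw [he]
    simp only [List.prod_cons, Nat.prod_primeFactorsList hn0]
    push_cast
    rfl
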